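/- Let d ≥ 5 be an integer and let p, q, r be real exponents with 1 < p < ∞, d/(d-2) < q < ∞, and 1/r ≤ 1/p + 1/q (so in particular r > d/(2d-2)). Then the discrete bilinear spherical maximal operator T* is bounded from ℓ^p(ℤ^d) × ℓ^q(ℤ^d) to ℓ^r(ℤ^d): there exists a constant C > 0 such that for all f, g : ℤ^d → ℂ, ‖T*(f,g)‖_{ℓ^r(ℤ^d)} ≤ C ‖f‖_{ℓ^p(ℤ^d)} ‖g‖_{ℓ^q(ℤ^d)}. -/

import Mathlib

open scoped ENNReal NNReal BigOperators

noncomputable section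

/-- `|u|² = ∑ i, u i ^ 2` for `u ∈ ℤ^d`. -/
def normSq {d : ℕ} (u : Fin d → ℤ) : ℤ := ∑ i, u i ^ 2

/-- The discrete bilinear spherical average
`T_λ(f,g)(x) = λ^{-(d-1)} ∑_{|u|²+|v|²=λ} f(x-u) g(x-v)` (a finite sum). -/
def biAvg (d : ℕ) (f g : (Fin d → ℤ) → ℂ) (lam : ℕ) (x : Fin d → ℤ) : ℂ :=
  ((lam : ℂ) ^ (d - 1))⁻¹ *
    ∑ᶠ (p : (Fin d → ℤ) × (Fin d → ℤ)) (_ : normSq p.1 + normSq p.2 = (lam : ℤ)),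
      f (x - p.1) * g (x - p.2)

/-- The discrete bilinear spherical maximal operator
`T*(f,g)(x) = sup_{λ ≥ 1} |T_λ(f,g)(x)|`, valued in `ℝ≥0∞`. -/
def biMax (d : ℕ) (f g : (Fin d → ℤ) → ℂ) (x : Fin d → ℤ) : ℝ≥0∞ :=
  ⨆ (lam : ℕ) (_ : 1 ≤ lam), (‖biAvg d f g lam x‖₊ : ℝ≥0∞)

/-- The `ℓ^p(ℤ^d)` norm of a complex-valued function. -/
def lpNorm (d : ℕ) (p : ℝ) (f : (Fin d → ℤ) → ℂ) : ℝ≥0∞ :=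
  (∑' x : Fin d → ℤ, (‖f x‖₊ : ℝ≥0∞) ^ p) ^ (1 / p)

/-- The `ℓ^r(ℤ^d)` norm of an `ℝ≥0∞`-valued function. -/
def lpNormE (d : ℕ) (r : ℝ) (F : (Fin d → ℤ) → ℝ≥0∞) : ℝ≥0∞ :=
  (∑' x : Fin d → ℤ, F x ^ r) ^ (1 / r)

theorem lpNormE_mono {d : ℕ} {r : ℝ} (hr : 0 ≤ r) {F G : (Fin d → ℤ) → ℝ≥0∞}
    (h : ∀ x, F x ≤ G x) : lpNormE d r F ≤ lpNormE d r G := by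
  unfold lpNormE
  have h1 : (0 : ℝ) ≤ 1 / r := by positivity
  gcongr with x
  exact h x

theorem lpNormE_add_le {d : ℕ} {r : ℝ} (hr : 1 ≤ r) (F G : (Fin d → ℤ) → ℝ≥0∞) :
    lpNormE d r (fun x => F x + G x) ≤ lpNormE d r F + lpNormE d r G := by
  have := ENNReal.lintegral_Lp_add_le (μ := MeasureTheory.Measure.count)
    (f := F) (g := G) (Measurable.of_discrete.aemeasurable) (Measurable.of_discrete.aemeasurable) hr
  simpa [MeasureTheory.lintegral_count, lpNormE] using this

theorem lpNormE_const_mul {d : ℕ} {r : ℝ} (hr : 0 < r) (c : ℝ≥0∞) (F : (Fin d → ℤ) → ℝ≥0∞) :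
    lpNormE d r (fun x => c * F x) = c * lpNormE d r F := by
  unfold lpNormE
  simp_rw [ENNReal.mul_rpow_of_nonneg _ _ hr.le]
  rw [ENNReal.tsum_mul_left, ENNReal.mul_rpow_of_nonneg _ _ (by positivity), ← ENNReal.rpow_mul,
    mul_one_div_cancel hr.ne', ENNReal.rpow_one]

theorem lpNormE_sum_le {d : ℕ} {r : ℝ} (hr : 1 ≤ r) {ι : Type*} (s : Finset ι)
    (F : ι → (Fin d → ℤ) → ℝ≥0∞) :
    lpNormE d r (fun x => ∑ i ∈ s, F i x) ≤ ∑ i ∈ s, lpNormE d r (F i) := by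
  classical
  induction s using Finset.induction_on with
  | empty =>
    have h0 : (0 : ℝ) < r := by linarith
    simp [lpNormE, h0]
  | insert i s hi ih =>
    simp only [Finset.sum_insert hi]
    exact (lpNormE_add_le hr _ _).trans (by gcongr)

theorem lpNormE_rpow {d : ℕ} {r : ℝ} (hr : 0 < r) (F : (Fin d → ℤ) → ℝ≥0∞) :
    lpNormE d r F ^ r = ∑' x, F x ^ r := by
  unfold lpNormE
  rw [← ENNReal.rpow_mul, one_div_mul_cancel hr.ne', ENNReal.rpow_one]

theorem lpNormE_iSup_le {d : ℕ} {r : ℝ} (hr : 0 < r) {F : ℕ → (Fin d → ℤ) → ℝ≥0∞}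
    (hF : Monotone F) {B : ℝ≥0∞} (h : ∀ n, lpNormE d r (F n) ≤ B) :
    lpNormE d r (fun x => ⨆ n, F n x) ≤ B := by
  have h1 : ∀ n, ∑' x, F n x ^ r ≤ B ^ r := fun n => by
    rw [← lpNormE_rpow hr]
    exact ENNReal.rpow_le_rpow (h n) hr.le
  have h2 : ∑' x, (⨆ n, F n x) ^ r ≤ B ^ r := by
    have : ∀ x, (⨆ n, F n x) ^ r = ⨆ n, F n x ^ r := fun x =>
      (ENNReal.orderIsoRpow r hr).map_iSup _
    simp_rw [this]
    rw [← MeasureTheory.lintegral_count, MeasureTheory.lintegral_iSup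
      (fun n => Measurable.of_discrete)
      (fun m n hmn x => ENNReal.rpow_le_rpow (hF hmn x) hr.le)]
    simp_rw [MeasureTheory.lintegral_count]
    exact iSup_le h1
  rw [← lpNormE_rpow hr] at h2
  exact (ENNReal.rpow_le_rpow_iff hr).1 h2

/-- The lattice cube `[-R, R]^d`. -/
def latticeBox (d R : ℕ) : Finset (Fin d → ℤ) :=
  Fintype.piFinset fun _ => Finset.Icc (-(R : ℤ)) R

theorem mem_latticeBox {d R : ℕ} {v : Fin d → ℤ} :
    v ∈ latticeBox d R ↔ ∀ i, -(R : ℤ) ≤ v i ∧ v i ≤ R := by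
  simp [latticeBox]

/-- The dyadic Hardy–Littlewood maximal function over scales `2^k`, `k < L`. -/
def hlMax (d L : ℕ) (h : (Fin d → ℤ) → ℝ≥0∞) (x : Fin d → ℤ) : ℝ≥0∞ :=
  ⨆ k ∈ Finset.range L, ((2 : ℝ≥0∞) ^ (k * d))⁻¹ * ∑ v ∈ latticeBox d (2 ^ (k + 1)), h (x - v)

theorem closedBall_eq_image_latticeBox (d R : ℕ) (x : Fin d → ℤ) :
    Metric.closedBall x (R : ℝ) = ((latticeBox d R).image fun v => x - v : Finset _) := by
  ext y
  simp only [Finset.coe_image, Set.mem_image, Finset.mem_coe, mem_latticeBox, Metric.mem_closedBall]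
  rw [dist_pi_le_iff (by positivity)]
  constructor
  · intro h
    refine ⟨x - y, fun i => ?_, by abel⟩
    have := h i
    rw [Int.dist_eq] at this
    have h2 : |y i - x i| ≤ (R : ℤ) := by exact_mod_cast this
    rw [abs_le] at h2
    simp only [Pi.sub_apply]
    omega
  · rintro ⟨v, hv, rfl⟩ i
    rw [Int.dist_eq]
    have h2 : |(x - v) i - x i| ≤ (R : ℤ) := by
      rw [abs_le]; have := hv i; simp only [Pi.sub_apply]; omega
    exact_mod_cast h2

theorem card_latticeBox (d R : ℕ) : (latticeBox d R).card = (2 * R + 1) ^ d := by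
  simp [latticeBox, Fintype.card_piFinset]
  congr 1
  omega

theorem hlMax_weak (d L : ℕ) (h : (Fin d → ℤ) → ℝ≥0∞) (t : ℝ≥0∞) :
    t * MeasureTheory.Measure.count {x | t < hlMax d L h x} ≤ 21 ^ d * ∑' x, h x := by
  classical
  set O := {x | t < hlMax d L h x} with hO
  have hk : ∀ x ∈ O, ∃ k, k < L ∧
      t * 2 ^ (k * d) ≤ ∑ v ∈ latticeBox d (2 ^ (k + 1)), h (x - v) := by
    intro x hx
    simp only [hO, Set.mem_ofPred_eq, hlMax, lt_iSup_iff] at hx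
    obtain ⟨k, hk, hx⟩ := hx
    refine ⟨k, Finset.mem_range.1 hk, ?_⟩
    have h0 : ((2 : ℝ≥0∞) ^ (k * d)) ≠ 0 := by positivity
    have h1 : ((2 : ℝ≥0∞) ^ (k * d)) ≠ ⊤ := by finiteness
    calc t * 2 ^ (k * d) ≤ (((2 : ℝ≥0∞) ^ (k * d))⁻¹ *
          ∑ v ∈ latticeBox d (2 ^ (k + 1)), h (x - v)) * 2 ^ (k * d) := by gcongr
      _ = _ := by
        rw [mul_comm, ← mul_assoc, ENNReal.mul_inv_cancel h0 h1, one_mul]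
  choose! k hkL hk using hk
  obtain ⟨u, huO, hdisj, hcov⟩ := Vitali.exists_disjoint_subfamily_covering_enlargement_closedBall
    O (fun x => x) (fun x => ((2 ^ (k x + 1) : ℕ) : ℝ)) (2 ^ (L + 1) : ℕ)
    (fun a ha => by
      have := hkL a ha
      exact_mod_cast Nat.pow_le_pow_right (by norm_num) (by omega)) 5 (by norm_num)
  have hsub : O ⊆ ⋃ b ∈ u, Metric.closedBall b ((5 * 2 ^ (k b + 1) : ℕ) : ℝ) := by
    intro a ha
    obtain ⟨b, hb, hab⟩ := hcov a ha
    simp only [Set.mem_iUnion]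
    refine ⟨b, hb, ?_⟩
    have := hab (Metric.mem_closedBall_self (by positivity))
    push_cast at this ⊢
    exact this
  have hcard : ∀ (R : ℕ) (b : Fin d → ℤ), MeasureTheory.Measure.count
      (Metric.closedBall b (R : ℝ)) = ((2 * R + 1) ^ d : ℕ) := by
    intro R b
    rw [closedBall_eq_image_latticeBox, MeasureTheory.Measure.count_apply_finset,
      Finset.card_image_of_injective _ (sub_right_injective), card_latticeBox]
  have hsum : ∀ b ∈ u, t * 2 ^ (k b * d) ≤
      ∑' y : Metric.closedBall b ((2 ^ (k b + 1) : ℕ) : ℝ), h y := by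
    intro b hb
    refine (hk b (huO hb)).trans ?_
    rw [closedBall_eq_image_latticeBox, Finset.tsum_subtype' , Finset.sum_image]
    intro a _ c _ hac
    exact sub_right_injective hac
  calc t * MeasureTheory.Measure.count O
      ≤ t * ∑' b : u, MeasureTheory.Measure.count
        (Metric.closedBall (b : Fin d → ℤ) ((5 * 2 ^ (k b + 1) : ℕ) : ℝ)) := by
        gcongr
        refine (MeasureTheory.measure_mono hsub).trans ?_
        exact MeasureTheory.measure_biUnion_le _ (Set.to_countable u) _
    _ = ∑' b : u, t * MeasureTheory.Measure.count
        (Metric.closedBall (b : Fin d → ℤ) ((5 * 2 ^ (k b + 1) : ℕ) : ℝ)) := by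
        rw [ENNReal.tsum_mul_left]
    _ ≤ ∑' b : u, 21 ^ d * ∑' y : Metric.closedBall (b : Fin d → ℤ) ((2 ^ (k b + 1) : ℕ) : ℝ),
          h y := by
        refine ENNReal.tsum_le_tsum fun b => ?_
        rw [hcard]
        have h1 : ((2 * (5 * 2 ^ (k b + 1)) + 1) ^ d : ℕ) ≤ 21 ^ d * 2 ^ (k b * d) := by
          rw [pow_mul, ← mul_pow]
          gcongr
          have := Nat.one_le_two_pow (n := k b)
          rw [pow_succ]
          omega
        calc t * (((2 * (5 * 2 ^ (k b + 1)) + 1) ^ d : ℕ) : ℝ≥0∞)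
            ≤ t * ((21 ^ d * 2 ^ (k b * d) : ℕ) : ℝ≥0∞) := by gcongr
          _ = 21 ^ d * (t * 2 ^ (k b * d)) := by push_cast; ring
          _ ≤ _ := by gcongr; exact hsum b b.2
    _ = 21 ^ d * ∑' z : Σ b : u, Metric.closedBall (b : Fin d → ℤ)
          ((2 ^ (k b + 1) : ℕ) : ℝ), h z.2 := by
        rw [ENNReal.tsum_mul_left, ENNReal.tsum_sigma']
    _ ≤ _ := by
        gcongr
        refine ENNReal.tsum_comp_le_tsum_of_injective
          (f := fun z : Σ b : u, Metric.closedBall (b : Fin d → ℤ)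
          ((2 ^ (k b + 1) : ℕ) : ℝ) => (z.2 : Fin d → ℤ)) ?_ h
        rintro ⟨a, y⟩ ⟨b, z⟩ hyz
        have hab : a = b := by
          by_contra hab
          exact Set.disjoint_left.1 (hdisj a.2 b.2 (fun h => hab (Subtype.ext h))) y.2
            ((show (y : Fin d → ℤ) = z from hyz) ▸ z.2)
        subst hab
        congr 1
        exact Subtype.ext hyz

open MeasureTheory in
theorem lintegral_rpow_lt {a y : ℝ} (ha : -1 < a) (hy : 0 ≤ y) :
    ∫⁻ s in Set.Ioi (0 : ℝ), (if s < y then ENNReal.ofReal (s ^ a) else 0) =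
      ENNReal.ofReal (y ^ (a + 1) / (a + 1)) := by
  have h1 : (fun s : ℝ => if s < y then ENNReal.ofReal (s ^ a) else 0) =
      (Set.Iio y).indicator fun s => ENNReal.ofReal (s ^ a) := by
    ext s; simp [Set.indicator_apply]
  rw [h1, lintegral_indicator measurableSet_Iio, Measure.restrict_restrict measurableSet_Iio,
    Set.inter_comm, Set.Ioi_inter_Iio, restrict_Ioo_eq_restrict_Ioc]
  have h2 := intervalIntegral.intervalIntegrable_rpow' (a := 0) (b := y) ha
  rw [intervalIntegrable_iff_integrableOn_Ioc_of_le hy] at h2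
  rw [← ofReal_integral_eq_lintegral_ofReal h2, ← intervalIntegral.integral_of_le hy,
    integral_rpow (Or.inl ha), Real.zero_rpow (by linarith), sub_zero]
  filter_upwards [ae_restrict_mem measurableSet_Ioc] with s hs
  exact Real.rpow_nonneg hs.1.le _

open MeasureTheory in
theorem lintegral_rpow_ge {a y : ℝ} (ha : a < -1) (hy : 0 < y) :
    ∫⁻ s in Set.Ioi (0 : ℝ), (if y ≤ s then ENNReal.ofReal (s ^ a) else 0) =
      ENNReal.ofReal (y ^ (a + 1) / (-(a + 1))) := by
  have h1 : (fun s : ℝ => if y ≤ s then ENNReal.ofReal (s ^ a) else 0) =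
      (Set.Ici y).indicator fun s => ENNReal.ofReal (s ^ a) := by
    ext s; simp [Set.indicator_apply]
  have h3 : Set.Ici y ∩ Set.Ioi 0 = Set.Ici y := by
    ext s; simp; intro h; linarith
  rw [h1, lintegral_indicator measurableSet_Ici, Measure.restrict_restrict measurableSet_Ici,
    h3, ← restrict_Ioi_eq_restrict_Ici]
  rw [← ofReal_integral_eq_lintegral_ofReal (integrableOn_Ioi_rpow_of_lt ha hy),
    integral_Ioi_rpow_of_lt ha hy, div_neg, neg_div]
  filter_upwards [ae_restrict_mem measurableSet_Ioi] with s hs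
  exact Real.rpow_nonneg (hy.trans hs).le _

open MeasureTheory in
theorem lintegral_tsum_high {α : Type*} [Countable α] {p A κ : ℝ} (hp : 1 < p) (hA : 0 ≤ A)
    (hκ : 0 < κ) {h : α → ℝ} (h0 : ∀ x, 0 ≤ h x) :
    ∫⁻ t in Set.Ioi (0 : ℝ), (ENNReal.ofReal (A / t) *
      ∑' x, if κ * t < h x then ENNReal.ofReal (h x) else 0) * ENNReal.ofReal (t ^ (p - 1)) =
      ENNReal.ofReal (A * κ ^ (1 - p) / (p - 1)) * ∑' x, ENNReal.ofReal (h x ^ p) := by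
  have h1 : ∀ t ∈ Set.Ioi (0 : ℝ), (ENNReal.ofReal (A / t) *
      ∑' x, if κ * t < h x then ENNReal.ofReal (h x) else 0) * ENNReal.ofReal (t ^ (p - 1)) =
      ∑' x, ENNReal.ofReal (A * h x) *
        (if t < h x / κ then ENNReal.ofReal (t ^ (p - 2)) else 0) := by
    intro t ht
    rw [← ENNReal.tsum_mul_left, ← ENNReal.tsum_mul_right]
    congr 1 with x
    have ht' : 0 < t := ht
    by_cases hx : κ * t < h x
    · rw [if_pos hx, if_pos (by rw [lt_div_iff₀ hκ]; linarith),
        ← ENNReal.ofReal_mul (by positivity), ← ENNReal.ofReal_mul (by have := h0 x; positivity),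
        ← ENNReal.ofReal_mul (by have := h0 x; positivity)]
      congr 1
      rw [show p - 1 = (p - 2) + 1 by ring, Real.rpow_add_one ht'.ne']
      field_simp
    · rw [if_neg hx, if_neg (by rw [lt_div_iff₀ hκ]; linarith)]; simp
  rw [setLIntegral_congr_fun measurableSet_Ioi h1, lintegral_tsum, ← ENNReal.tsum_mul_left]
  · congr 1 with x
    rw [lintegral_const_mul', lintegral_rpow_lt (by linarith) (div_nonneg (h0 x) hκ.le),
      ← ENNReal.ofReal_mul (by have := h0 x; positivity), ← ENNReal.ofReal_mul (by
        have : 0 ≤ p - 1 := by linarith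
        positivity)]
    · congr 1
      rw [show p - 2 + 1 = p - 1 by ring, Real.div_rpow (h0 x) hκ.le, show 1 - p = -(p - 1) by ring,
        Real.rpow_neg hκ.le]
      rcases (h0 x).eq_or_lt with hx | hx
      · rw [← hx, Real.zero_rpow (by linarith : p ≠ 0)]; simp
      · have h5 : h x ^ p = h x ^ (p - 1) * h x := by
          rw [← Real.rpow_add_one hx.ne']; congr 1; ring
        rw [h5]
        ring
    · exact ENNReal.ofReal_ne_top
  · intro x
    refine Measurable.aemeasurable ?_
    refine Measurable.const_mul (Measurable.ite measurableSet_Iio ?_ measurable_const) _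
    fun_prop

open MeasureTheory in
theorem lintegral_tsum_low {α : Type*} [Countable α] {p B κ : ℝ} (hp0 : 0 < p) (hp : p < 2)
    (hB : 0 ≤ B) (hκ : 0 < κ) {h : α → ℝ} (h0 : ∀ x, 0 ≤ h x) :
    ∫⁻ t in Set.Ioi (0 : ℝ), (ENNReal.ofReal (B / t ^ 2) *
      ∑' x, if h x ≤ κ * t then ENNReal.ofReal (h x ^ 2) else 0) * ENNReal.ofReal (t ^ (p - 1)) =
      ENNReal.ofReal (B * κ ^ (2 - p) / (2 - p)) * ∑' x, ENNReal.ofReal (h x ^ p) := by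
  have h1 : ∀ t ∈ Set.Ioi (0 : ℝ), (ENNReal.ofReal (B / t ^ 2) *
      ∑' x, if h x ≤ κ * t then ENNReal.ofReal (h x ^ 2) else 0) * ENNReal.ofReal (t ^ (p - 1)) =
      ∑' x, ENNReal.ofReal (B * h x ^ 2) *
        (if h x / κ ≤ t then ENNReal.ofReal (t ^ (p - 3)) else 0) := by
    intro t ht
    rw [← ENNReal.tsum_mul_left, ← ENNReal.tsum_mul_right]
    congr 1 with x
    have ht' : 0 < t := ht
    by_cases hx : h x ≤ κ * t
    · rw [if_pos hx, if_pos (by rw [div_le_iff₀ hκ]; linarith),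
        ← ENNReal.ofReal_mul (by positivity), ← ENNReal.ofReal_mul (by have := h0 x; positivity),
        ← ENNReal.ofReal_mul (by have := h0 x; positivity)]
      congr 1
      rw [show p - 1 = (p - 3) + (2 : ℕ) by norm_num; ring, Real.rpow_add_natCast ht'.ne']
      field_simp
    · rw [if_neg hx, if_neg (by rw [div_le_iff₀ hκ]; linarith)]; simp
  rw [setLIntegral_congr_fun measurableSet_Ioi h1, lintegral_tsum, ← ENNReal.tsum_mul_left]
  · congr 1 with x
    rw [lintegral_const_mul' _ _ ENNReal.ofReal_ne_top]
    rcases (h0 x).eq_or_lt with hx | hx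
    · rw [← hx, Real.zero_rpow hp0.ne']; simp
    rw [lintegral_rpow_ge (by linarith) (div_pos hx hκ),
      ← ENNReal.ofReal_mul (by positivity), ← ENNReal.ofReal_mul (by
        have : 0 ≤ 2 - p := by linarith
        positivity)]
    congr 1
    rw [show p - 3 + 1 = -(2 - p) by ring, Real.rpow_neg (by positivity),
      Real.div_rpow (h0 x) hκ.le, neg_neg, inv_div]
    have h5 : h x ^ p = h x ^ 2 / h x ^ (2 - p) := by
      rw [← Real.rpow_two, ← Real.rpow_sub hx]; congr 1; ring
    rw [h5]
    ring
  · intro x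
    refine Measurable.aemeasurable ?_
    refine Measurable.const_mul (Measurable.ite measurableSet_Ici ?_ measurable_const) _
    fun_prop

open MeasureTheory in
theorem tsum_rpow_eq_lintegral {d : ℕ} {p : ℝ} (hp : 0 < p) {F : (Fin d → ℤ) → ℝ}
    (h0 : ∀ x, 0 ≤ F x) : ∑' x, ENNReal.ofReal (F x ^ p) =
      ENNReal.ofReal p * ∫⁻ t in Set.Ioi (0 : ℝ), Measure.count {x | t < F x} *
        ENNReal.ofReal (t ^ (p - 1)) := by
  rw [← lintegral_count]
  exact lintegral_rpow_eq_lintegral_meas_lt_mul _ (Filter.Eventually.of_forall h0)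
    Measurable.of_discrete.aemeasurable hp

open MeasureTheory in
theorem marcinkiewicz_high {d : ℕ} {p A κ : ℝ} (hp : 1 < p) (hA : 0 ≤ A) (hκ : 0 < κ)
    {F h : (Fin d → ℤ) → ℝ} (hF : ∀ x, 0 ≤ F x) (h0 : ∀ x, 0 ≤ h x)
    (H : ∀ t, 0 < t → Measure.count {x | t < F x} ≤ ENNReal.ofReal (A / t) *
      ∑' x, if κ * t < h x then ENNReal.ofReal (h x) else 0) :
    ∑' x, ENNReal.ofReal (F x ^ p) ≤ ENNReal.ofReal (p * (A * κ ^ (1 - p) / (p - 1))) *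
      ∑' x, ENNReal.ofReal (h x ^ p) := by
  rw [tsum_rpow_eq_lintegral (by linarith) hF, ENNReal.ofReal_mul (by linarith), mul_assoc,
    ← lintegral_tsum_high hp hA hκ h0]
  refine mul_le_mul le_rfl (setLIntegral_mono' measurableSet_Ioi fun t ht => ?_) bot_le bot_le
  gcongr
  exact H t ht

open MeasureTheory in
theorem marcinkiewicz_low {d : ℕ} {p A B κ : ℝ} (hp : 1 < p) (hp2 : p < 2) (hA : 0 ≤ A)
    (hB : 0 ≤ B) (hκ : 0 < κ)
    {F h : (Fin d → ℤ) → ℝ} (hF : ∀ x, 0 ≤ F x) (h0 : ∀ x, 0 ≤ h x)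
    (H : ∀ t, 0 < t → Measure.count {x | t < F x} ≤ ENNReal.ofReal (A / t) *
      (∑' x, if κ * t < h x then ENNReal.ofReal (h x) else 0) + ENNReal.ofReal (B / t ^ 2) *
      ∑' x, if h x ≤ κ * t then ENNReal.ofReal (h x ^ 2) else 0) :
    ∑' x, ENNReal.ofReal (F x ^ p) ≤
      ENNReal.ofReal (p * (A * κ ^ (1 - p) / (p - 1) + B * κ ^ (2 - p) / (2 - p))) *
      ∑' x, ENNReal.ofReal (h x ^ p) := by
  have h2 : 0 < 2 - p := by linarith
  have h1 : 0 < p - 1 := by linarith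
  rw [tsum_rpow_eq_lintegral (by linarith) hF, ENNReal.ofReal_mul (by linarith), mul_assoc,
    ENNReal.ofReal_add (by positivity) (by positivity), add_mul,
    ← lintegral_tsum_high hp hA hκ h0, ← lintegral_tsum_low (by linarith) hp2 hB hκ h0,
    ← lintegral_add_left']
  · refine mul_le_mul le_rfl (setLIntegral_mono' measurableSet_Ioi fun t ht => ?_) bot_le bot_le
    rw [← add_mul]
    gcongr
    exact H t ht
  · refine AEMeasurable.mul (AEMeasurable.mul (by fun_prop) ?_) (by fun_prop)
    refine Measurable.aemeasurable (Measurable.tsum fun x => ?_)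
    exact Measurable.ite (measurableSet_lt (by fun_prop) measurable_const) measurable_const
      measurable_const

theorem hlMax_add_le {d L : ℕ} (h₁ h₂ : (Fin d → ℤ) → ℝ≥0∞) (x : Fin d → ℤ) :
    hlMax d L (fun y => h₁ y + h₂ y) x ≤ hlMax d L h₁ x + hlMax d L h₂ x := by
  unfold hlMax
  refine iSup₂_le fun k hk => ?_
  rw [Finset.sum_add_distrib, mul_add]
  exact add_le_add
    (le_iSup₂ (f := fun k (_ : k ∈ Finset.range L) => ((2 : ℝ≥0∞) ^ (k * d))⁻¹ *
      ∑ v ∈ latticeBox d (2 ^ (k + 1)), h₁ (x - v)) k hk)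
    (le_iSup₂ (f := fun k (_ : k ∈ Finset.range L) => ((2 : ℝ≥0∞) ^ (k * d))⁻¹ *
      ∑ v ∈ latticeBox d (2 ^ (k + 1)), h₂ (x - v)) k hk)

theorem sum_latticeBox_le_hlMax {d L k : ℕ} (hk : k < L) (h : (Fin d → ℤ) → ℝ≥0∞)
    (x : Fin d → ℤ) :
    ((2 : ℝ≥0∞) ^ (k * d))⁻¹ * ∑ v ∈ latticeBox d (2 ^ (k + 1)), h (x - v) ≤ hlMax d L h x :=
  le_iSup₂ (f := fun k (_ : k ∈ Finset.range L) => ((2 : ℝ≥0∞) ^ (k * d))⁻¹ *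
      ∑ v ∈ latticeBox d (2 ^ (k + 1)), h (x - v)) k (Finset.mem_range.2 hk)

theorem hlMax_le_of_le {d L : ℕ} {h : (Fin d → ℤ) → ℝ≥0∞} {a : ℝ≥0∞} (hh : ∀ x, h x ≤ a)
    (x : Fin d → ℤ) : hlMax d L h x ≤ 5 ^ d * a := by
  unfold hlMax
  refine iSup₂_le fun k hk => ?_
  have h0 : ((2 : ℝ≥0∞) ^ (k * d)) ≠ 0 := by positivity
  have h1 : ((2 : ℝ≥0∞) ^ (k * d)) ≠ ⊤ := by finiteness
  rw [ENNReal.inv_mul_le_iff h0 h1]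
  calc ∑ v ∈ latticeBox d (2 ^ (k + 1)), h (x - v)
      ≤ ∑ v ∈ latticeBox d (2 ^ (k + 1)), a := Finset.sum_le_sum fun v _ => hh _
    _ = ((2 * 2 ^ (k + 1) + 1) ^ d : ℕ) * a := by
      rw [Finset.sum_const, card_latticeBox, nsmul_eq_mul]
    _ ≤ ((2 ^ (k * d) * 5 ^ d : ℕ) : ℝ≥0∞) * a := by
      gcongr
      rw [pow_mul, ← mul_pow]
      gcongr
      have := Nat.one_le_two_pow (n := k)
      rw [pow_succ]
      omega
    _ = _ := by push_cast; ring

theorem hlMax_ne_top {d L : ℕ} {h : (Fin d → ℤ) → ℝ≥0∞} (hh : ∀ x, h x ≠ ⊤)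
    (x : Fin d → ℤ) : hlMax d L h x ≠ ⊤ := by
  unfold hlMax
  rw [← lt_top_iff_ne_top, ← Finset.sup_eq_iSup, Finset.sup_lt_iff (by simp)]
  intro k _
  refine ENNReal.mul_lt_top (ENNReal.inv_lt_top.2 (by positivity)) (ENNReal.sum_lt_top.2 fun v _ => (hh _).lt_top)

theorem lpNormE_le_of_tsum_le {d : ℕ} {p : ℝ} (hp : 0 < p) {K : ℝ} {F h : (Fin d → ℤ) → ℝ≥0∞}
    (hF : ∀ x, F x ≠ ⊤) (hh : ∀ x, h x ≠ ⊤)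
    (H : ∑' x, ENNReal.ofReal ((F x).toReal ^ p) ≤
      ENNReal.ofReal K * ∑' x, ENNReal.ofReal ((h x).toReal ^ p)) :
    lpNormE d p F ≤ ENNReal.ofReal K ^ (1 / p) * lpNormE d p h := by
  have h1 : ∀ G : (Fin d → ℤ) → ℝ≥0∞, (∀ x, G x ≠ ⊤) →
      ∑' x, ENNReal.ofReal ((G x).toReal ^ p) = ∑' x, G x ^ p := fun G hG => by
    congr 1 with x
    rw [← ENNReal.ofReal_rpow_of_nonneg ENNReal.toReal_nonneg hp.le, ENNReal.ofReal_toReal (hG x)]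
  rw [h1 F hF, h1 h hh] at H
  unfold lpNormE
  rw [← ENNReal.mul_rpow_of_nonneg _ _ (by positivity)]
  gcongr

theorem eq_top_lpNormE {d : ℕ} {p : ℝ} (hp : 0 < p) {h : (Fin d → ℤ) → ℝ≥0∞} {x : Fin d → ℤ}
    (hx : h x = ⊤) : lpNormE d p h = ⊤ := by
  unfold lpNormE
  rw [ENNReal.tsum_eq_top_of_eq_top ⟨x, by rw [hx, ENNReal.top_rpow_of_pos hp]⟩,
    ENNReal.top_rpow_of_pos (by positivity)]

theorem hlMax_lp (d : ℕ) {p : ℝ} (hp : 1 < p) : ∃ C : ℝ≥0, ∀ L (h : (Fin d → ℤ) → ℝ≥0∞),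
    lpNormE d p (hlMax d L h) ≤ C * lpNormE d p h := by
  have hp0 : 0 < p := by linarith
  set K := p * (2 * 21 ^ d * (1 / (2 * 5 ^ d)) ^ (1 - p) / (p - 1)) with hK
  have hK0 : 0 < K := by
    have : 0 < p - 1 := by linarith
    positivity
  refine ⟨(K ^ (1 / p)).toNNReal, fun L h => ?_⟩
  have e1 : (((K ^ (1 / p)).toNNReal : ℝ≥0) : ℝ≥0∞) = ENNReal.ofReal K ^ (1 / p) := by
    rw [ENNReal.ofReal_rpow_of_pos hK0]; rfl
  rw [e1]
  by_cases hh : ∃ x, h x = ⊤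
  · obtain ⟨x, hx⟩ := hh
    rw [eq_top_lpNormE hp0 hx, ENNReal.mul_top]
    · exact le_top
    · simp [hK0]
  push Not at hh
  have hF := hlMax_ne_top (L := L) hh
  refine lpNormE_le_of_tsum_le hp0 hF hh ?_
  refine marcinkiewicz_high hp (by positivity) (by positivity) (fun _ => ENNReal.toReal_nonneg)
    (fun _ => ENNReal.toReal_nonneg) fun t ht => ?_
  set hi : (Fin d → ℤ) → ℝ≥0∞ := fun x =>
    if 1 / (2 * 5 ^ d) * t < (h x).toReal then ENNReal.ofReal (h x).toReal else 0 with hhi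
  set lo : (Fin d → ℤ) → ℝ≥0∞ := fun x =>
    if 1 / (2 * 5 ^ d) * t < (h x).toReal then 0 else h x with hlo
  have hsplit : h = fun x => lo x + hi x := by
    ext x
    simp only [hhi, hlo]
    split_ifs <;> simp [hh]
  have hlole : ∀ x, lo x ≤ ENNReal.ofReal (1 / (2 * 5 ^ d) * t) := by
    intro x
    simp only [hlo]
    split_ifs with hx
    · exact zero_le
    · exact (ENNReal.le_ofReal_iff_toReal_le (hh x) (by positivity)).2 (not_lt.1 hx)
  have hsub : {x | t < (hlMax d L h x).toReal} ⊆
      {x | ENNReal.ofReal (t / 2) < hlMax d L hi x} := by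
    intro x hx
    simp only [Set.mem_ofPred_eq] at hx ⊢
    rw [← ENNReal.ofReal_lt_iff_lt_toReal ht.le (hF x)] at hx
    by_contra hc
    rw [not_lt] at hc
    refine absurd hx (not_lt.2 ?_)
    have e2 : ENNReal.ofReal t = 5 ^ d * ENNReal.ofReal (1 / (2 * 5 ^ d) * t)
        + ENNReal.ofReal (t / 2) := by
      have : (5 : ℝ≥0∞) ^ d = ENNReal.ofReal (5 ^ d) := by
        rw [ENNReal.ofReal_pow (by norm_num)]; simp
      rw [this, ← ENNReal.ofReal_mul (by positivity), ← ENNReal.ofReal_add (by positivity)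
        (by positivity)]
      congr 1
      field_simp
      ring
    rw [e2, hsplit]
    exact (hlMax_add_le _ _ x).trans (add_le_add (hlMax_le_of_le hlole x) hc)
  have hw := hlMax_weak d L hi (ENNReal.ofReal (t / 2))
  calc MeasureTheory.Measure.count {x | t < (hlMax d L h x).toReal}
      ≤ MeasureTheory.Measure.count {x | ENNReal.ofReal (t / 2) < hlMax d L hi x} :=
        MeasureTheory.measure_mono hsub
    _ ≤ (21 ^ d * ∑' x, hi x) / ENNReal.ofReal (t / 2) := by
        rw [ENNReal.le_div_iff_mul_le (by simp [ht]) (by simp), mul_comm]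
        exact hw
    _ = _ := by
        rw [div_eq_mul_inv, mul_right_comm, ← div_eq_mul_inv]
        congr 1
        have : (21 : ℝ≥0∞) ^ d = ENNReal.ofReal (21 ^ d) := by
          rw [ENNReal.ofReal_pow (by norm_num)]; simp
        rw [this, ← ENNReal.ofReal_div_of_pos (by positivity)]
        congr 1
        field_simp

/-- Distance from a real number to the nearest integer. -/
def distInt (x : ℝ) : ℝ := |x - round x|

theorem distInt_nonneg (x : ℝ) : 0 ≤ distInt x := abs_nonneg _

theorem distInt_int_add {x : ℝ} (hx : |x| ≤ 1 / 2) (z : ℤ) : |x| ≤ distInt (z + x) := by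
  unfold distInt
  set w := round ((z : ℝ) + x)
  by_cases h : w = z
  · rw [h]; simp
  · have h1 : (1 : ℝ) ≤ |(z : ℝ) - w| := by
      have : 1 ≤ |z - w| := Int.one_le_abs (sub_ne_zero.2 (Ne.symm h))
      exact_mod_cast this
    have h2 : |(z : ℝ) - w| ≤ |(z : ℝ) + x - w| + |x| := by
      calc |(z : ℝ) - w| = |((z : ℝ) + x - w) - x| := by ring_nf
        _ ≤ _ := abs_sub _ _
    linarith

theorem sum_rpow_sub_one_le {ε : ℝ} (h0 : 0 < ε) (h1 : ε < 1) (n : ℕ) :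
    ∑ m ∈ Finset.range n, ((m : ℝ) + 1) ^ (ε - 1) ≤ (n : ℝ) ^ ε / ε := by
  induction n with
  | zero => simp [h0.ne']
  | succ n ih =>
    rw [Finset.sum_range_succ]
    have hn : (0 : ℝ) < n + 1 := by positivity
    have h2 : (n : ℝ) ^ ε ≤ ((n : ℝ) + 1) ^ ε - ε * ((n : ℝ) + 1) ^ (ε - 1) := by
      have h3 : (1 + (-(1 / ((n : ℝ) + 1)))) ^ ε ≤ 1 + ε * (-(1 / ((n : ℝ) + 1))) := by
        refine rpow_one_add_le_one_add_mul_self ?_ h0.le h1.le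
        rw [neg_le_neg_iff, div_le_one hn]; linarith [n.cast_nonneg (α := ℝ)]
      have h4 : (n : ℝ) = (n + 1) * (1 + (-(1 / ((n : ℝ) + 1)))) := by field_simp; ring
      have h5 : (0 : ℝ) ≤ 1 + (-(1 / ((n : ℝ) + 1))) := by
        have : 1 / ((n : ℝ) + 1) ≤ 1 := by
          rw [div_le_one hn]; linarith [n.cast_nonneg (α := ℝ)]
        linarith
      calc (n : ℝ) ^ ε = ((n + 1) * (1 + (-(1 / ((n : ℝ) + 1))))) ^ ε := by rw [← h4]
        _ = ((n : ℝ) + 1) ^ ε * (1 + (-(1 / ((n : ℝ) + 1)))) ^ ε := Real.mul_rpow hn.le h5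
        _ ≤ ((n : ℝ) + 1) ^ ε * (1 + ε * (-(1 / ((n : ℝ) + 1)))) := by gcongr
        _ = _ := by rw [Real.rpow_sub_one hn.ne']; ring
    push_cast
    rw [le_div_iff₀ h0] at ih ⊢
    linarith

theorem sum_inv_le_rpow {ε : ℝ} (h0 : 0 < ε) {q : ℕ} (hq : 1 ≤ q) :
    ∑ i ∈ Finset.range q, (1 : ℝ) / (i + 1) ≤ (1 + 1 / ε) * (q : ℝ) ^ ε := by
  have h1 := harmonic_le_one_add_log q
  have h2 : ((harmonic q : ℚ) : ℝ) = ∑ i ∈ Finset.range q, (1 : ℝ) / (i + 1) := by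
    simp [harmonic]
  rw [h2] at h1
  have h3 := Real.log_le_rpow_div (Nat.cast_nonneg (α := ℝ) q) h0
  have h4 : (1 : ℝ) ≤ (q : ℝ) ^ ε := Real.one_le_rpow (by exact_mod_cast hq) h0.le
  calc _ ≤ _ := h1
    _ ≤ (q : ℝ) ^ ε + (q : ℝ) ^ ε / ε := by linarith
    _ = _ := by ring

theorem sum_range_mod_le {q N : ℕ} (hq : 1 ≤ q) {φ : ℕ → ℝ} (h0 : ∀ n, 0 ≤ φ n) :
    ∑ n ∈ Finset.range N, φ (n % q) ≤ ((N : ℝ) / q + 1) * ∑ ρ ∈ Finset.range q, φ ρ := by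
  have h1 : ∀ K, ∑ n ∈ Finset.range (q * K), φ (n % q) = K * ∑ ρ ∈ Finset.range q, φ ρ := by
    intro K
    induction K with
    | zero => simp
    | succ K ih =>
      rw [mul_add, Finset.sum_range_add, ih, mul_one]
      have : ∑ x ∈ Finset.range q, φ ((q * K + x) % q) = ∑ ρ ∈ Finset.range q, φ ρ := by
        refine Finset.sum_congr rfl fun x hx => ?_
        rw [Nat.mul_add_mod, Nat.mod_eq_of_lt (Finset.mem_range.1 hx)]
      rw [this]; push_cast; ring
  have h2 : N ≤ q * (N / q + 1) := (Nat.lt_mul_div_succ N (by omega)).le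
  calc ∑ n ∈ Finset.range N, φ (n % q) ≤ ∑ n ∈ Finset.range (q * (N / q + 1)), φ (n % q) :=
        Finset.sum_le_sum_of_subset_of_nonneg (Finset.range_mono h2) fun _ _ _ => h0 _
    _ = ((N / q + 1 : ℕ) : ℝ) * ∑ ρ ∈ Finset.range q, φ ρ := h1 _
    _ ≤ _ := by
      have := Finset.sum_nonneg fun ρ (_ : ρ ∈ Finset.range q) => h0 ρ
      gcongr
      push_cast
      gcongr
      exact Nat.cast_div_le

theorem sum_range_mul_mod_le {q a : ℕ} (hq : 1 ≤ q) (ha : Nat.Coprime a q) {φ : ℕ → ℝ}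
    (h0 : ∀ n, 0 ≤ φ n) :
    ∑ ρ ∈ Finset.range q, φ (ρ * a % q) ≤ ∑ ρ ∈ Finset.range q, φ ρ := by
  have hinj : Set.InjOn (fun ρ => ρ * a % q) (Finset.range q : Set ℕ) := by
    intro x hx y hy hxy
    have h1 : x * a ≡ y * a [MOD q] := hxy
    have h2 := Nat.ModEq.cancel_right_of_coprime (by rwa [Nat.Coprime, Nat.gcd_comm] at ha) h1
    rw [Nat.ModEq, Nat.mod_eq_of_lt (Finset.mem_range.1 hx),
      Nat.mod_eq_of_lt (Finset.mem_range.1 hy)] at h2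
    exact h2
  rw [← Finset.sum_image (f := φ) hinj]
  refine Finset.sum_le_sum_of_subset_of_nonneg ?_ fun _ _ _ => h0 _
  intro y hy
  simp only [Finset.mem_image, Finset.mem_range] at hy ⊢
  obtain ⟨x, -, rfl⟩ := hy
  exact Nat.mod_lt _ (by omega)

theorem distInt_ge_of_mod {q n : ℕ} (hq : 1 ≤ q) {β : ℝ} (hβ : |β| ≤ 1 / (2 * q))
    (hn : n % q ≠ 0) :
    0 < distInt ((n : ℝ) / q + β) ∧ 1 / distInt ((n : ℝ) / q + β) ≤
      2 * q / ((n % q : ℕ) : ℝ) + 2 * q / ((q : ℝ) - (n % q : ℕ)) := by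
  have hq0 : (0 : ℝ) < q := by exact_mod_cast hq
  unfold distInt
  set z := round ((n : ℝ) / q + β)
  set ρ := n % q with hρ
  have hρq : ρ < q := Nat.mod_lt _ (by omega)
  have hρ0 : (0 : ℝ) < ρ := by exact_mod_cast Nat.pos_of_ne_zero hn
  have hρ1 : (0 : ℝ) < (q : ℝ) - ρ := by
    have : (ρ : ℝ) < q := by exact_mod_cast hρq
    linarith
  have key : (ρ : ℝ) ≤ |(n : ℝ) - q * z| ∨ (q : ℝ) - ρ ≤ |(n : ℝ) - q * z| := by
    have hn' : (n : ℤ) = q * ((n / q : ℕ) : ℤ) + ρ := by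
      rw [hρ]; exact_mod_cast (Nat.div_add_mod n q).symm
    rcases le_or_gt z ((n / q : ℕ) : ℤ) with h | h
    · left
      have h1 : (ρ : ℤ) ≤ (n : ℤ) - q * z := by rw [hn']; nlinarith
      have h2 : (ρ : ℝ) ≤ (n : ℝ) - q * z := by exact_mod_cast h1
      exact h2.trans (le_abs_self _)
    · right
      have h1 : (q : ℤ) - ρ ≤ -((n : ℤ) - q * z) := by
        rw [hn']
        have : ((n / q : ℕ) : ℤ) + 1 ≤ z := h
        nlinarith
      have h2 : (q : ℝ) - ρ ≤ -((n : ℝ) - q * z) := by exact_mod_cast h1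
      exact h2.trans (neg_le_abs _)
  have key2 : ∀ m : ℝ, 1 ≤ m → m ≤ |(n : ℝ) - q * z| →
      m / (2 * q) ≤ |(n : ℝ) / q + β - z| := by
    intro m hm1 hm
    have h1 : |(n : ℝ) - q * z| = q * |(n : ℝ) / q - z| := by
      rw [← abs_of_pos hq0, ← abs_mul, abs_of_pos hq0]; congr 1; field_simp
    have h2 : |(n : ℝ) / q - z| ≤ |(n : ℝ) / q + β - z| + |β| := by
      calc |(n : ℝ) / q - z| = |((n : ℝ) / q + β - z) - β| := by ring_nf
        _ ≤ _ := abs_sub _ _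
    rw [h1] at hm
    have h3 : m / q ≤ |(n : ℝ) / q - z| := by rw [div_le_iff₀ hq0]; linarith
    have h4 : 1 / (2 * (q : ℝ)) ≤ m / (2 * q) := by gcongr
    have h5 : m / q = m / (2 * q) + m / (2 * q) := by field_simp; ring
    linarith
  rcases key with h | h
  · have h1 := key2 ρ (by exact_mod_cast Nat.pos_of_ne_zero hn) h
    refine ⟨lt_of_lt_of_le (by positivity) h1, ?_⟩
    calc 1 / |(n : ℝ) / q + β - z| ≤ 1 / (ρ / (2 * q)) := by gcongr
      _ = 2 * q / ρ := by rw [one_div_div]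
      _ ≤ _ := le_add_of_nonneg_right (by positivity)
  · have h1 := key2 (q - ρ) (by
      have : (ρ : ℝ) + 1 ≤ q := by exact_mod_cast hρq
      linarith) h
    refine ⟨lt_of_lt_of_le (by positivity) h1, ?_⟩
    calc 1 / |(n : ℝ) / q + β - z| ≤ 1 / ((q - ρ) / (2 * q)) := by gcongr
      _ = 2 * q / (q - ρ) := by rw [one_div_div]
      _ ≤ _ := le_add_of_nonneg_left (by positivity)

theorem sum_pole_le {ε : ℝ} (h0 : 0 < ε) {q : ℕ} (hq : 1 ≤ q) :
    ∑ ρ ∈ Finset.range q, (2 * q / (ρ : ℝ) + 2 * q / ((q : ℝ) - ρ)) ≤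
      4 * (1 + 1 / ε) * q * (q : ℝ) ^ ε := by
  have h1 := sum_inv_le_rpow h0 hq
  have h2 : ∑ ρ ∈ Finset.range q, 2 * q / (ρ : ℝ) ≤
      2 * q * ∑ i ∈ Finset.range q, (1 : ℝ) / (i + 1) := by
    obtain ⟨m, rfl⟩ : ∃ m, q = m + 1 := ⟨q - 1, by omega⟩
    rw [Finset.sum_range_succ', Finset.mul_sum, Finset.sum_range_succ (n := m)]
    simp only [Nat.cast_zero, div_zero, add_zero]
    refine le_add_of_le_of_nonneg (le_of_eq ?_) (by positivity)
    refine Finset.sum_congr rfl fun i _ => ?_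
    push_cast; ring
  have h3 : ∑ ρ ∈ Finset.range q, 2 * q / ((q : ℝ) - ρ) =
      2 * q * ∑ i ∈ Finset.range q, (1 : ℝ) / (i + 1) := by
    rw [← Finset.sum_range_reflect, Finset.mul_sum]
    refine Finset.sum_congr rfl fun i hi => ?_
    have hi := Finset.mem_range.1 hi
    have : ((q - 1 - i : ℕ) : ℝ) = q - 1 - i := by
      rw [Nat.cast_sub (by omega), Nat.cast_sub hq]; simp
    rw [this]
    ring
  rw [Finset.sum_add_distrib, h3]
  have hq0 : (0 : ℝ) ≤ 2 * q := by positivity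
  have := mul_le_mul_of_nonneg_left h1 hq0
  linarith

theorem sum_resonant_le {ε c₀ : ℝ} (h0 : 0 < ε) (h1 : ε < 1) (hc : 0 < c₀) : ∃ C : ℝ, 0 < C ∧
    ∀ (L q : ℕ) (β J : ℝ), 1 ≤ L → 1 ≤ q → |β| * (4 * q * L) ≤ 1 → (q : ℝ) ≤ 16 * L → 1 ≤ J →
    (J = 1 ∨ J ≤ c₀ * L ^ 2 * |β|) →
    ∑ m ∈ Finset.range (2 * L / q + 1), 2 * (L : ℝ) / (1 + 2 * L * (q * m * |β|)) ≤
      C * L ^ 2 * (q * J) ^ (ε - 1) := by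
  refine ⟨36 + 2 * (c₀ + 1) + 2 * (c₀ + 1) * (2 / ε), by positivity, ?_⟩
  intro L q β J hL hq hβ hqL hJ hJc
  have hL0 : (0 : ℝ) < L := by exact_mod_cast hL
  have hq0 : (0 : ℝ) < q := by exact_mod_cast hq
  have hq1 : (1 : ℝ) ≤ q := by exact_mod_cast hq
  have hdiv : ((2 * L / q : ℕ) : ℝ) ≤ 2 * L / q := by
    exact_mod_cast (Nat.cast_div_le (α := ℝ) (m := 2 * L) (n := q))
  rcases hJc with rfl | hJc
  · have h2 : ∑ m ∈ Finset.range (2 * L / q + 1), 2 * (L : ℝ) / (1 + 2 * L * (q * m * |β|)) ≤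
        ∑ m ∈ Finset.range (2 * L / q + 1), 2 * (L : ℝ) := by
      refine Finset.sum_le_sum fun m _ => div_le_self (by positivity) ?_
      have : 0 ≤ 2 * L * (q * m * |β|) := by positivity
      linarith
    have h3 : ((2 * L / q + 1 : ℕ) : ℝ) ≤ 18 * L / q := by
      push_cast
      have : (1 : ℝ) ≤ 16 * L / q := by rw [le_div_iff₀ hq0]; linarith
      calc ((2 * L / q : ℕ) : ℝ) + 1 ≤ 2 * L / q + 16 * L / q := add_le_add hdiv this
        _ = _ := by ring
    have h4 : (q : ℝ)⁻¹ ≤ (q * 1) ^ (ε - 1) := by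
      rw [mul_one, ← Real.rpow_neg_one]
      exact Real.rpow_le_rpow_of_exponent_le hq1 (by linarith)
    calc _ ≤ _ := h2
      _ = ((2 * L / q + 1 : ℕ) : ℝ) * (2 * L) := by simp
      _ ≤ (18 * L / q) * (2 * L) := by gcongr
      _ = 36 * L ^ 2 * (q : ℝ)⁻¹ := by field_simp; ring
      _ ≤ (36 + 2 * (c₀ + 1) + 2 * (c₀ + 1) * (2 / ε)) * L ^ 2 * (q * 1) ^ (ε - 1) := by
        gcongr
        have : 0 < 2 * (c₀ + 1) + 2 * (c₀ + 1) * (2 / ε) := by positivity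
        linarith
  · have hβ0 : 0 < |β| := by
      by_contra h
      have : |β| = 0 := le_antisymm (not_lt.1 h) (abs_nonneg _)
      rw [this] at hJc
      linarith
    have hJ0 : 0 < J := by linarith
    have hqJ1 : 1 ≤ q * J := one_le_mul_of_one_le_of_one_le hq1 hJ
    have hqJ : q * J ≤ c₀ * L := by
      have h2 : q * J ≤ q * (c₀ * L ^ 2 * |β|) := by gcongr
      have h3 : q * (c₀ * L ^ 2 * |β|) = c₀ * L * (|β| * (4 * q * L)) / 4 := by ring
      have h4 : c₀ * L * (|β| * (4 * q * L)) ≤ c₀ * L * 1 := by gcongr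
      have h5 : 0 < c₀ * L := by positivity
      linarith
    -- the term `m = 0`
    have hz : 2 * (L : ℝ) ≤ 2 * ((c₀ + 1)) * L ^ 2 * (q * J) ^ (ε - 1) := by
      have h2 : (q * J) ^ (1 - ε) ≤ (c₀ + 1) * L := by
        calc (q * J) ^ (1 - ε) ≤ (q * J) ^ (1 : ℝ) :=
              Real.rpow_le_rpow_of_exponent_le hqJ1 (by linarith)
          _ = q * J := Real.rpow_one _
          _ ≤ _ := by nlinarith
      have h3 : (q * J) ^ (1 - ε) * (q * J) ^ (ε - 1) = 1 := by
        rw [← Real.rpow_add (by positivity)]; simp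
      calc 2 * (L : ℝ) = 2 * L * ((q * J) ^ (1 - ε) * (q * J) ^ (ε - 1)) := by rw [h3]; ring
        _ ≤ 2 * L * (((c₀ + 1) * L) * (q * J) ^ (ε - 1)) := by gcongr
        _ = _ := by ring
    have hterm : ∀ m : ℕ, 2 * (L : ℝ) / (1 + 2 * L * (q * (m + 1 : ℕ) * |β|)) ≤
        2 * L * ((c₀ + 1) * L / (q * J)) ^ (1 - ε) * ((m : ℝ) + 1) ^ (ε - 1) := by
      intro m
      have hm : (0 : ℝ) < (m : ℝ) + 1 := by positivity
      set y := 2 * (L : ℝ) * (q * ((m : ℝ) + 1) * |β|) with hy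
      have hy0 : 0 < y := by positivity
      have h2 : 1 / (1 + y) ≤ (1 / y) ^ (1 - ε) := by
        rcases le_or_gt y 1 with h | h
        · calc 1 / (1 + y) ≤ 1 := by rw [div_le_one (by positivity)]; linarith
            _ ≤ _ := Real.one_le_rpow (by rw [le_div_iff₀ hy0]; linarith) (by linarith)
        · calc 1 / (1 + y) ≤ 1 / y := by gcongr; linarith
            _ = (1 / y) ^ (1 : ℝ) := (Real.rpow_one _).symm
            _ ≤ _ := Real.rpow_le_rpow_of_exponent_ge (by positivity)
              (by rw [div_le_one hy0]; exact h.le) (by linarith)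
      have h3 : 1 / y ≤ ((c₀ + 1) * L / (q * J)) * ((m : ℝ) + 1)⁻¹ := by
        rw [← div_eq_mul_inv, div_div, div_le_div_iff₀ hy0 (by positivity), hy]
        have h4 : J ≤ (c₀ + 1) * L ^ 2 * |β| := hJc.trans (by gcongr; linarith)
        have h6 : 0 ≤ (c₀ + 1) * L ^ 2 * |β| * (q * (m + 1)) := by positivity
        calc 1 * (q * J * ((m : ℝ) + 1)) = J * (q * (m + 1)) := by ring
          _ ≤ ((c₀ + 1) * L ^ 2 * |β|) * (q * (m + 1)) := by gcongr
          _ ≤ 2 * (((c₀ + 1) * L ^ 2 * |β|) * (q * (m + 1))) := by linarith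
          _ = _ := by ring
      calc 2 * (L : ℝ) / (1 + 2 * L * (q * (m + 1 : ℕ) * |β|)) = 2 * L * (1 / (1 + y)) := by
            rw [hy]; push_cast; ring
        _ ≤ 2 * L * (1 / y) ^ (1 - ε) := by gcongr
        _ ≤ 2 * L * (((c₀ + 1) * L / (q * J)) * ((m : ℝ) + 1)⁻¹) ^ (1 - ε) := by
          gcongr
        _ = _ := by
          rw [Real.mul_rpow (by positivity) (by positivity), Real.inv_rpow hm.le,
            ← Real.rpow_neg hm.le]
          rw [neg_sub]; ring
    have hsum : ∑ m ∈ Finset.range (2 * L / q),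
        2 * (L : ℝ) / (1 + 2 * L * (q * (m + 1 : ℕ) * |β|)) ≤
        2 * (c₀ + 1) * (2 / ε) * L ^ 2 * (q * J) ^ (ε - 1) := by
      calc _ ≤ ∑ m ∈ Finset.range (2 * L / q),
          2 * L * ((c₀ + 1) * L / (q * J)) ^ (1 - ε) * ((m : ℝ) + 1) ^ (ε - 1) :=
            Finset.sum_le_sum fun m _ => hterm m
        _ = 2 * L * ((c₀ + 1) * L / (q * J)) ^ (1 - ε) *
            ∑ m ∈ Finset.range (2 * L / q), ((m : ℝ) + 1) ^ (ε - 1) := by rw [Finset.mul_sum]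
        _ ≤ 2 * L * ((c₀ + 1) * L / (q * J)) ^ (1 - ε) * ((2 * L) ^ ε / ε) := by
            gcongr
            refine (sum_rpow_sub_one_le h0 h1 _).trans ?_
            gcongr
            exact hdiv.trans (div_le_self (by positivity) hq1)
        _ = 2 * L * ((c₀ + 1) ^ (1 - ε) * L ^ (1 - ε) * (q * J) ^ (ε - 1)) *
            (2 ^ ε * L ^ ε / ε) := by
            rw [Real.div_rpow (by positivity) (by positivity), Real.mul_rpow (by positivity)
              (by positivity), Real.mul_rpow (by positivity) hL0.le, div_eq_mul_inv,
              ← Real.rpow_neg (x := q * J) (by positivity), neg_sub]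
        _ = 2 * (c₀ + 1) ^ (1 - ε) * (2 ^ ε / ε) * (L * (L ^ (1 - ε) * L ^ ε)) *
            (q * J) ^ (ε - 1) := by ring
        _ = 2 * (c₀ + 1) ^ (1 - ε) * (2 ^ ε / ε) * L ^ 2 * (q * J) ^ (ε - 1) := by
            rw [← Real.rpow_add hL0]; simp [pow_two]
        _ ≤ 2 * (c₀ + 1) ^ (1 : ℝ) * (2 ^ (1 : ℝ) / ε) * L ^ 2 * (q * J) ^ (ε - 1) := by
            gcongr <;> linarith
        _ = _ := by simp only [Real.rpow_one]
    rw [Finset.sum_range_succ']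
    simp only [Nat.cast_zero, mul_zero, zero_mul, add_zero, div_one]
    have h9 : 0 ≤ (L : ℝ) ^ 2 * (q * J) ^ (ε - 1) := by positivity
    linarith

theorem weyl_sum {ε c₀ : ℝ} (h0 : 0 < ε) (h1 : ε < 1) (hc : 0 < c₀) : ∃ C : ℝ, 0 < C ∧
    ∀ (L q a : ℕ) (β J : ℝ), 1 ≤ L → 1 ≤ q → Nat.Coprime a q → |β| * (4 * q * L) ≤ 1 →
    (q : ℝ) ≤ 16 * L → 1 ≤ J → (J = 1 ∨ J ≤ c₀ * L ^ 2 * |β|) →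
    ∑ h ∈ Finset.range L, 2 * (L : ℝ) / (1 + 2 * L * distInt (2 * h * ((a : ℝ) / q + β))) ≤
      C * L ^ 2 * (q * J) ^ (ε - 1) := by
  obtain ⟨C₁, hC₁, H⟩ := sum_resonant_le h0 h1 hc
  refine ⟨C₁ + 18 * (4 * (1 + 1 / ε)) * (c₀ + 16), by positivity, ?_⟩
  intro L q a β J hL hq ha hβ hqL hJ hJc
  have hL0 : (0 : ℝ) < L := by exact_mod_cast hL
  have hq0 : (0 : ℝ) < q := by exact_mod_cast hq
  have hq1 : (1 : ℝ) ≤ q := by exact_mod_cast hq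
  have hJ0 : 0 < J := by linarith
  have hqJ1 : 1 ≤ q * J := one_le_mul_of_one_le_of_one_le hq1 hJ
  have hqJ : q * J ≤ (c₀ + 16) * L := by
    rcases hJc with rfl | hJc
    · nlinarith
    · have h2 : q * J ≤ q * (c₀ * L ^ 2 * |β|) := by gcongr
      have h3 : q * (c₀ * L ^ 2 * |β|) = c₀ * L * (|β| * (4 * q * L)) / 4 := by ring
      have h4 : c₀ * L * (|β| * (4 * q * L)) ≤ c₀ * L * 1 := by gcongr
      have h5 : 0 < c₀ * L := by positivity
      linarith
  set χ : ℕ → ℝ := fun ρ => 2 * q / ((ρ % q : ℕ) : ℝ) + 2 * q / ((q : ℝ) - (ρ % q : ℕ)) with hχ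
  have hχ0 : ∀ ρ, 0 ≤ χ ρ := by
    intro ρ
    have : ((ρ % q : ℕ) : ℝ) ≤ q := by exact_mod_cast (Nat.mod_lt _ (by omega)).le
    have : 0 ≤ (q : ℝ) - (ρ % q : ℕ) := by linarith
    simp only [hχ]; positivity
  have hsmall : ∀ h ∈ Finset.range L, |2 * (h : ℝ) * β| ≤ 1 / (2 * q) := by
    intro h hh
    have : (h : ℝ) ≤ L := by exact_mod_cast (Finset.mem_range.1 hh).le
    rw [abs_mul, abs_of_nonneg (by positivity), le_div_iff₀ (by positivity)]
    calc 2 * (h : ℝ) * |β| * (2 * q) ≤ 2 * L * |β| * (2 * q) := by gcongr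
      _ = |β| * (4 * q * L) := by ring
      _ ≤ 1 := hβ
  have hterm : ∀ h ∈ Finset.range L,
      2 * (L : ℝ) / (1 + 2 * L * distInt (2 * h * ((a : ℝ) / q + β))) ≤
      (if q ∣ 2 * h then 2 * (L : ℝ) / (1 + 2 * L * (q * (2 * h / q : ℕ) * |β|)) else 0) +
        χ (2 * h * a) := by
    intro h hh
    split_ifs with hd
    · obtain ⟨m, hm⟩ := hd
      have h2 : 2 * h / q = m := by rw [hm]; exact Nat.mul_div_cancel_left m (by omega)
      rw [h2]
      have h3 : (2 : ℝ) * h = q * m := by exact_mod_cast hm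
      refine le_add_of_le_of_nonneg ?_ (hχ0 _)
      have h4 : 2 * (h : ℝ) * ((a : ℝ) / q + β) = ((m * a : ℕ) : ℤ) + 2 * h * β := by
        rw [mul_add, h3]; push_cast; field_simp
      have h6 := hsmall h hh
      have h5 := distInt_int_add (h6.trans (by
        gcongr; linarith)) ((m * a : ℕ) : ℤ)
      rw [← h4] at h5
      rw [abs_mul, h3, abs_of_nonneg (by positivity : (0 : ℝ) ≤ q * m)] at h5
      gcongr
      rwa [h3]
    · rw [zero_add]
      by_cases hd2 : (2 * h * a) % q = 0
      · exact absurd (Nat.Coprime.dvd_of_dvd_mul_right (Nat.Coprime.symm ha)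
          (Nat.dvd_of_mod_eq_zero hd2)) hd
      obtain ⟨h4, h2⟩ := distInt_ge_of_mod hq (hsmall h hh) hd2
      have h3 : ((2 * h * a : ℕ) : ℝ) / q + 2 * h * β = 2 * h * ((a : ℝ) / q + β) := by
        push_cast; ring
      rw [h3] at h2 h4
      refine le_trans ?_ h2
      rw [div_le_div_iff₀ (by positivity) h4]
      nlinarith
  have hB : ∑ h ∈ Finset.range L, χ (2 * h * a) ≤
      18 * (4 * (1 + 1 / ε)) * (c₀ + 16) * L ^ 2 * (q * J) ^ (ε - 1) := by
    have e1 : ∑ h ∈ Finset.range L, χ (2 * h * a) ≤ ∑ n ∈ Finset.range (2 * L), χ (n * a) := by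
      rw [← Finset.sum_image (f := fun n => χ (n * a)) (g := fun h => 2 * h)
        (fun x _ y _ hxy => by simpa using hxy)]
      refine Finset.sum_le_sum_of_subset_of_nonneg ?_ fun _ _ _ => hχ0 _
      intro n hn
      simp only [Finset.mem_image, Finset.mem_range] at hn ⊢
      omega
    have e2 : ∀ n, χ (n * a) = χ ((n % q) * a % q) := by
      intro n
      simp only [hχ]
      congr 3 <;> simp [Nat.mul_mod]
    have e3 := sum_range_mod_le (N := 2 * L) hq (φ := fun n => χ (n * a % q)) (fun _ => hχ0 _)
    have e4 := sum_range_mul_mod_le hq ha hχ0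
    have e5 : ∑ ρ ∈ Finset.range q, χ ρ ≤ 4 * (1 + 1 / ε) * q * (q : ℝ) ^ ε := by
      refine le_trans (le_of_eq (Finset.sum_congr rfl fun ρ hρ => ?_)) (sum_pole_le h0 hq)
      simp only [hχ]
      rw [Nat.mod_eq_of_lt (Finset.mem_range.1 hρ)]
    have e6 : (q : ℝ) ^ ε ≤ (c₀ + 16) * L * (q * J) ^ (ε - 1) := by
      have h2 : (q : ℝ) ^ ε ≤ (q * J) ^ ε := by
        gcongr
        nlinarith
      calc (q : ℝ) ^ ε ≤ (q * J) ^ ε := h2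
        _ = (q * J) * (q * J) ^ (ε - 1) := by
          rw [Real.rpow_sub_one (by positivity)]; field_simp
        _ ≤ _ := by gcongr
    have e7 : ((2 * L : ℕ) : ℝ) / q + 1 ≤ 18 * L / q := by
      have : (1 : ℝ) ≤ 16 * L / q := by rw [le_div_iff₀ hq0]; linarith
      push_cast
      calc _ ≤ 2 * (L : ℝ) / q + 16 * L / q := by gcongr
        _ = _ := by ring
    simp_rw [← e2] at e3
    have e8 : 0 ≤ ∑ ρ ∈ Finset.range q, χ (ρ * a % q) := Finset.sum_nonneg fun _ _ => hχ0 _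
    calc _ ≤ _ := e1
      _ = ∑ n ∈ Finset.range (2 * L), χ (n % q * a % q) := Finset.sum_congr rfl fun n _ => e2 n
      _ ≤ ((2 * L : ℕ) / q + 1) * ∑ ρ ∈ Finset.range q, χ (ρ * a % q) :=
        sum_range_mod_le hq (φ := fun n => χ (n * a % q)) (fun _ => hχ0 _)
      _ ≤ (18 * L / q) * (4 * (1 + 1 / ε) * q * ((c₀ + 16) * L * (q * J) ^ (ε - 1))) := by
        gcongr
        exact e4.trans (e5.trans (by gcongr))
      _ = _ := by field_simp
  have hA : ∑ h ∈ Finset.range L,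
      (if q ∣ 2 * h then 2 * (L : ℝ) / (1 + 2 * L * (q * (2 * h / q : ℕ) * |β|)) else 0) ≤
      C₁ * L ^ 2 * (q * J) ^ (ε - 1) := by
    refine le_trans ?_ (H L q β J hL hq hβ hqL hJ hJc)
    rw [← Finset.sum_filter]
    rw [← Finset.sum_image (f := fun m : ℕ => 2 * (L : ℝ) / (1 + 2 * L * (q * m * |β|)))
      (g := fun h => 2 * h / q)]
    · refine Finset.sum_le_sum_of_subset_of_nonneg ?_ fun _ _ _ => by positivity
      intro n hn
      simp only [Finset.mem_image, Finset.mem_range, Finset.mem_filter] at hn ⊢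
      obtain ⟨h, ⟨hh, -⟩, rfl⟩ := hn
      exact Nat.lt_succ_of_le (Nat.div_le_div_right (by omega))
    · intro x hx y hy hxy
      simp only [Finset.coe_filter, Set.mem_ofPred_eq] at hx hy
      have h2 := Nat.div_mul_cancel hx.2
      have h3 := Nat.div_mul_cancel hy.2
      simp only at hxy
      rw [hxy, h3] at h2
      omega
  calc _ ≤ _ := Finset.sum_le_sum hterm
    _ ≤ C₁ * L ^ 2 * (q * J) ^ (ε - 1) +
        18 * (4 * (1 + 1 / ε)) * (c₀ + 16) * L ^ 2 * (q * J) ^ (ε - 1) := by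
      rw [Finset.sum_add_distrib]; exact add_le_add hA hB
    _ = _ := by ring

/-- The character `x ↦ exp (2πix)`. -/
def expi (x : ℝ) : ℂ := Complex.exp ((2 * Real.pi * x : ℝ) * Complex.I)

theorem expi_add (x y : ℝ) : expi (x + y) = expi x * expi y := by
  simp only [expi, ← Complex.exp_add]; congr 1; push_cast; ring

@[simp] theorem norm_expi (x : ℝ) : ‖expi x‖ = 1 := by
  simp only [expi, Complex.norm_exp_ofReal_mul_I]

@[simp] theorem expi_zero : expi 0 = 1 := by simp [expi]

theorem expi_int (n : ℤ) : expi n = 1 := by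
  rw [expi, Complex.exp_eq_one_iff]
  exact ⟨n, by push_cast; ring⟩

theorem expi_add_int (x : ℝ) (n : ℤ) : expi (x + n) = expi x := by
  rw [expi_add, expi_int, mul_one]

theorem expi_neg (x : ℝ) : expi (-x) = (expi x)⁻¹ := by
  simp only [expi, ← Complex.exp_neg]; congr 1; push_cast; ring

theorem conj_expi (x : ℝ) : (starRingEnd ℂ) (expi x) = expi (-x) := by
  rw [expi_neg, Complex.inv_def, Complex.normSq_eq_norm_sq]
  simp

theorem expi_nat_mul (n : ℕ) (x : ℝ) : expi (n * x) = expi x ^ n := by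
  simp only [expi, ← Complex.exp_nat_mul]; congr 1; push_cast; ring

theorem expi_sum {ι : Type*} (s : Finset ι) (f : ι → ℝ) :
    expi (∑ i ∈ s, f i) = ∏ i ∈ s, expi (f i) := by
  classical
  induction s using Finset.induction_on with
  | empty => simp
  | insert i s hi ih => rw [Finset.sum_insert hi, Finset.prod_insert hi, expi_add, ih]

theorem norm_expi_sub_one (x : ℝ) : ‖expi x - 1‖ = 2 * |Real.sin (Real.pi * x)| := by
  have := Complex.norm_exp_I_mul_ofReal_sub_one (2 * Real.pi * x)
  rw [expi, mul_comm, this, norm_mul]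
  simp only [Real.norm_eq_abs]
  rw [abs_of_pos (by norm_num : (0 : ℝ) < 2)]
  congr 3; ring

theorem norm_expi_sub_one_le (x : ℝ) : ‖expi x - 1‖ ≤ 7 * |x| := by
  rw [norm_expi_sub_one]
  have h1 : |Real.sin (Real.pi * x)| ≤ |Real.pi * x| := Real.abs_sin_le_abs
  rw [abs_mul, abs_of_pos Real.pi_pos] at h1
  have := Real.pi_lt_d2
  nlinarith [abs_nonneg x]

theorem norm_expi_sub_expi_le (x y : ℝ) : ‖expi x - expi y‖ ≤ 7 * |x - y| := by
  have : expi x - expi y = (expi (x - y) - 1) * expi y := by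
    rw [sub_mul, ← expi_add]; simp
  rw [this, norm_mul, norm_expi, mul_one]
  exact norm_expi_sub_one_le _

theorem four_mul_distInt_le (x : ℝ) : 4 * distInt x ≤ ‖expi x - 1‖ := by
  have h0 : expi x = expi (x - round x) := by
    conv_lhs => rw [show x = (x - round x) + (round x : ℤ) by ring]
    rw [expi_add_int]
  rw [h0, norm_expi_sub_one, distInt]
  set y := x - round x
  have hy : |y| ≤ 1 / 2 := abs_sub_round x
  have hπ := Real.pi_pos
  have h1 := Real.mul_abs_le_abs_sin (x := Real.pi * y) (by
    rw [abs_mul, abs_of_pos hπ]; nlinarith)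
  rw [abs_mul, abs_of_pos hπ] at h1
  have h2 : 2 / Real.pi * (Real.pi * |y|) = 2 * |y| := by field_simp
  rw [h2] at h1
  linarith

theorem norm_geom_sum_expi_le {N L : ℕ} (hL : 1 ≤ L) (h : N ≤ L) (x : ℝ) :
    ‖∑ m ∈ Finset.range N, expi (m * x)‖ ≤ 2 * L / (1 + 2 * L * distInt x) := by
  have hL0 : (1 : ℝ) ≤ L := by exact_mod_cast hL
  have hd := distInt_nonneg x
  set S := ∑ m ∈ Finset.range N, expi (m * x) with hS
  have h1 : ‖S‖ ≤ L := by
    calc ‖S‖ ≤ ∑ m ∈ Finset.range N, ‖expi (m * x)‖ := norm_sum_le _ _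
      _ = N := by simp
      _ ≤ L := by exact_mod_cast h
  have h2 : ‖S‖ * (4 * distInt x) ≤ 2 := by
    calc ‖S‖ * (4 * distInt x) ≤ ‖S‖ * ‖expi x - 1‖ := by
          gcongr; exact four_mul_distInt_le x
      _ = ‖expi x ^ N - 1‖ := by
        rw [← norm_mul, ← geom_sum_mul]
        simp only [hS, expi_nat_mul]
      _ ≤ ‖expi x ^ N‖ + ‖(1 : ℂ)‖ := norm_sub_le _ _
      _ = 2 := by simp; norm_num
  rw [le_div_iff₀ (by positivity)]
  nlinarith

/-- Square-summable functions on `ℤ^d`. -/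
abbrev SqLat (d : ℕ) : Type := lp (fun _ : Fin d → ℤ => ℂ) 2

/-- The convolution algebra of finitely supported functions on `ℤ^d`. -/
abbrev ConvAlg (d : ℕ) : Type := AddMonoidAlgebra ℂ (Fin d → ℤ)

theorem norm_sq_eq_tsum {d : ℕ} (g : SqLat d) : ‖g‖ ^ 2 = ∑' x, ‖g x‖ ^ 2 := by
  have := lp.norm_rpow_eq_tsum (p := 2) (by norm_num) g
  simpa using this

theorem memℓp_two_iff {d : ℕ} {f : (Fin d → ℤ) → ℂ} :
    Memℓp (E := fun _ : Fin d → ℤ => ℂ) f 2 ↔ Summable fun x => ‖f x‖ ^ 2 := by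
  rw [memℓp_gen_iff (by norm_num)]
  simp

/-- Translation by `v` on square-summable functions. -/
def shiftBy {d : ℕ} (v : Fin d → ℤ) : SqLat d →ₗᵢ[ℂ] SqLat d where
  toFun g := ⟨fun x => g (x - v), memℓp_two_iff.2
    ((memℓp_two_iff.1 g.2).comp_injective (Equiv.subRight v).injective)⟩
  map_add' f g := rfl
  map_smul' c f := rfl
  norm_map' g := by
    have h1 := norm_sq_eq_tsum g
    rw [← (Equiv.subRight v).tsum_eq (fun x => ‖g x‖ ^ 2)] at h1
    rw [← sq_eq_sq₀ (norm_nonneg _) (norm_nonneg _), h1, norm_sq_eq_tsum]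
    rfl

theorem shiftBy_apply {d : ℕ} (v : Fin d → ℤ) (g : SqLat d) (x : Fin d → ℤ) :
    shiftBy v g x = g (x - v) := rfl

theorem shiftBy_add {d : ℕ} (v w : Fin d → ℤ) (g : SqLat d) :
    shiftBy (v + w) g = shiftBy v (shiftBy w g) := by
  ext x; simp only [shiftBy_apply, sub_sub]

/-- Translations as a multiplicative family of operators. -/
def shiftHom (d : ℕ) : Multiplicative (Fin d → ℤ) →* (SqLat d →L[ℂ] SqLat d) where
  toFun v := (shiftBy v.toAdd).toContinuousLinearMap
  map_one' := by
    ext g x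
    simp [shiftBy_apply]
  map_mul' v w := by
    ext g x
    simp [shiftBy_add]

/-- The action of the convolution algebra on square-summable functions. -/
def act {d : ℕ} : ConvAlg d →ₐ[ℂ] (SqLat d →L[ℂ] SqLat d) :=
  AddMonoidAlgebra.lift ℂ _ _ (shiftHom d)

theorem act_single {d : ℕ} (v : Fin d → ℤ) (c : ℂ) (g : SqLat d) :
    act (AddMonoidAlgebra.single v c) g = c • shiftBy v g := by
  rw [act, AddMonoidAlgebra.lift_single]; rfl

theorem act_sum_single_apply {d : ℕ} {ι : Type*} (s : Finset ι) (v : ι → Fin d → ℤ) (c : ι → ℂ)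
    (g : SqLat d) (x : Fin d → ℤ) :
    act (∑ i ∈ s, AddMonoidAlgebra.single (v i) (c i)) g x = ∑ i ∈ s, c i * g (x - v i) := by
  rw [map_sum, sum_apply, lp.coeFn_sum, Finset.sum_apply]
  refine Finset.sum_congr rfl fun i _ => ?_
  rw [act_single]; rfl

/-- The operator norm of convolution on square-summable functions. -/
def nrm {d : ℕ} (K : ConvAlg d) : ℝ := ‖act K‖

theorem nrm_nonneg {d : ℕ} (K : ConvAlg d) : 0 ≤ nrm K := norm_nonneg _

theorem norm_act_le {d : ℕ} (K : ConvAlg d) (g : SqLat d) : ‖act K g‖ ≤ nrm K * ‖g‖ :=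
  (act K).le_opNorm g

theorem nrm_le {d : ℕ} {K : ConvAlg d} {M : ℝ} (hM : 0 ≤ M) (h : ∀ g, ‖act K g‖ ≤ M * ‖g‖) :
    nrm K ≤ M := (act K).opNorm_le_bound hM h

theorem nrm_add_le {d : ℕ} (K K' : ConvAlg d) : nrm (K + K') ≤ nrm K + nrm K' := by
  unfold nrm; rw [map_add]; exact norm_add_le _ _

theorem nrm_sub_le {d : ℕ} (K K' : ConvAlg d) : nrm (K - K') ≤ nrm K + nrm K' := by
  unfold nrm; rw [map_sub]; exact norm_sub_le _ _

theorem nrm_mul_le {d : ℕ} (K K' : ConvAlg d) : nrm (K * K') ≤ nrm K * nrm K' := by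
  unfold nrm; rw [map_mul]; exact norm_mul_le _ _

theorem nrm_smul {d : ℕ} (c : ℂ) (K : ConvAlg d) : nrm (c • K) = ‖c‖ * nrm K := by
  unfold nrm; rw [map_smul]; exact norm_smul _ _

theorem nrm_one_le {d : ℕ} : nrm (1 : ConvAlg d) ≤ 1 :=
  nrm_le zero_le_one fun g => by simp

theorem nrm_zero {d : ℕ} : nrm (0 : ConvAlg d) = 0 := by simp [nrm]

theorem nrm_sum_le {d : ℕ} {ι : Type*} (s : Finset ι) (K : ι → ConvAlg d) :
    nrm (∑ i ∈ s, K i) ≤ ∑ i ∈ s, nrm (K i) := by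
  unfold nrm; rw [map_sum]; exact norm_sum_le _ _

theorem nrm_single_le {d : ℕ} (v : Fin d → ℤ) (c : ℂ) :
    nrm (AddMonoidAlgebra.single v c) ≤ ‖c‖ :=
  nrm_le (norm_nonneg _) fun g => by
    rw [act_single, norm_smul, LinearIsometry.norm_map]

theorem nrm_prod_le {d : ℕ} {ι : Type*} (s : Finset ι) (K : ι → ConvAlg d) :
    nrm (∏ i ∈ s, K i) ≤ ∏ i ∈ s, nrm (K i) := by
  classical
  induction s using Finset.induction_on with
  | empty => simpa using nrm_one_le
  | insert i s hi ih =>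
    rw [Finset.prod_insert hi, Finset.prod_insert hi]
    exact (nrm_mul_le _ _).trans (mul_le_mul_of_nonneg_left ih (nrm_nonneg _))

theorem sum_triangle_fiber {M : Type*} [AddCommMonoid M] (L : ℕ) (f : ℕ → ℕ → M) :
    ∑ p ∈ (Finset.range L ×ˢ Finset.range L).filter (fun p => p.2 ≤ p.1), f p.1 p.2 =
      ∑ h ∈ Finset.range L, ∑ m ∈ Finset.range (L - h), f (m + h) m := by
  rw [← Finset.sum_fiberwise_of_maps_to (t := Finset.range L) (g := fun p : ℕ × ℕ => p.1 - p.2)]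
  · refine Finset.sum_congr rfl fun h hh => ?_
    refine Finset.sum_nbij' (fun p => p.2) (fun m => (m + h, m)) ?_ ?_ ?_ ?_ ?_
    · intro p hp; simp at hp ⊢; omega
    · intro m hm; simp at hm hh ⊢; omega
    · rintro ⟨n, m⟩ hp; simp at hp ⊢; omega
    · intro m hm; simp
    · rintro ⟨n, m⟩ hp
      simp only [Finset.mem_filter] at hp ⊢
      congr 1; omega
  · rintro ⟨n, m⟩ hp; simp at hp ⊢; omega

theorem norm_sum_shiftBy_sq_le {d : ℕ} (L : ℕ) (c : ℕ → ℂ) (w : Fin d → ℤ) {B : ℕ → ℝ}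
    (hB : ∀ h ∈ Finset.range L,
      ‖∑ m ∈ Finset.range (L - h), c (m + h) * (starRingEnd ℂ) (c m)‖ ≤ B h) (g : SqLat d) :
    ‖∑ n ∈ Finset.range L, c n • shiftBy ((n : ℤ) • w) g‖ ^ 2 ≤
      2 * (∑ h ∈ Finset.range L, B h) * ‖g‖ ^ 2 := by
  set ψ : ℕ → ℂ := fun h => inner ℂ g (shiftBy ((h : ℤ) • w) g) with hψ
  have hψn : ∀ h, ‖ψ h‖ ≤ ‖g‖ ^ 2 := by
    intro h
    refine (norm_inner_le_norm _ _).trans ?_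
    rw [LinearIsometry.norm_map, pow_two]
  have hin : ∀ m h : ℕ, inner ℂ (shiftBy ((m : ℤ) • w) g)
      (shiftBy (((m + h : ℕ) : ℤ) • w) g) = ψ h := by
    intro m h
    rw [show ((m + h : ℕ) : ℤ) • w = (m : ℤ) • w + (h : ℤ) • w by push_cast; rw [add_smul],
      shiftBy_add, LinearIsometry.inner_map_map]
  set f : ℕ → ℕ → ℂ := fun n m => c n * (starRingEnd ℂ) (c m) *
    inner ℂ (shiftBy ((m : ℤ) • w) g) (shiftBy ((n : ℤ) • w) g) with hf
  have hfconj : ∀ n m, (starRingEnd ℂ) (f n m) = f m n := by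
    intro n m
    simp only [hf, map_mul, inner_conj_symm, Complex.conj_conj]
    ring
  have hT : ‖∑ p ∈ (Finset.range L ×ˢ Finset.range L).filter (fun p => p.2 ≤ p.1),
      f p.1 p.2‖ ≤ (∑ h ∈ Finset.range L, B h) * ‖g‖ ^ 2 := by
    rw [sum_triangle_fiber, Finset.sum_mul]
    refine norm_sum_le_of_le _ fun h hh => ?_
    simp only [hf, hin]
    rw [← Finset.sum_mul, norm_mul]
    exact mul_le_mul (hB h hh) (hψn h) (norm_nonneg _) ((norm_nonneg _).trans (hB h hh))
  have hT' : ‖∑ p ∈ (Finset.range L ×ˢ Finset.range L).filter (fun p => ¬ p.2 ≤ p.1),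
      f p.1 p.2‖ ≤ (∑ h ∈ Finset.range L, B h) * ‖g‖ ^ 2 := by
    have e : ∑ p ∈ (Finset.range L ×ˢ Finset.range L).filter (fun p => ¬ p.2 ≤ p.1), f p.1 p.2 =
        ∑ p ∈ (Finset.range L ×ˢ Finset.range L).filter (fun p => p.2 ≤ p.1),
          (fun n m => if n = m then 0 else (starRingEnd ℂ) (f n m)) p.1 p.2 := by
      rw [Finset.sum_filter, Finset.sum_filter, Finset.sum_product, Finset.sum_product_right]
      refine Finset.sum_congr rfl fun x _ => Finset.sum_congr rfl fun y _ => ?_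
      simp only [hfconj]
      split_ifs <;> first | rfl | omega
    rw [e, sum_triangle_fiber L (fun n m => if n = m then 0 else (starRingEnd ℂ) (f n m)),
      Finset.sum_mul]
    refine norm_sum_le_of_le _ fun h hh => ?_
    have hBn : 0 ≤ B h := (norm_nonneg _).trans (hB h hh)
    rcases Nat.eq_zero_or_pos h with rfl | hpos
    · simp; positivity
    · have : ∀ m, m + h ≠ m := by omega
      simp only [this, if_false]
      rw [← map_sum, RCLike.norm_conj]
      simp only [hf, hin]
      rw [← Finset.sum_mul, norm_mul]
      exact mul_le_mul (hB h hh) (hψn h) (norm_nonneg _) hBn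
  have hsq : ((‖∑ n ∈ Finset.range L, c n • shiftBy ((n : ℤ) • w) g‖ ^ 2 : ℝ) : ℂ) =
      ∑ p ∈ Finset.range L ×ˢ Finset.range L, f p.1 p.2 := by
    have := inner_self_eq_norm_sq_to_K (𝕜 := ℂ)
      (∑ n ∈ Finset.range L, c n • shiftBy ((n : ℤ) • w) g)
    rw [Complex.ofReal_pow]
    refine this.symm.trans ?_
    rw [inner_sum, Finset.sum_product]
    refine Finset.sum_congr rfl fun n _ => ?_
    rw [sum_inner]
    refine Finset.sum_congr rfl fun m _ => ?_
    rw [inner_smul_left, inner_smul_right]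
    simp only [hf]; ring
  rw [← Finset.sum_filter_add_sum_filter_not _ (fun p : ℕ × ℕ => p.2 ≤ p.1)] at hsq
  have h3 := congrArg (fun z : ℂ => ‖z‖) hsq
  simp only [Complex.norm_real, norm_pow, norm_norm] at h3
  rw [h3]
  refine (norm_add_le _ _).trans ?_
  linarith

/-- The sum `∑_{n < L} e(θ n² + φ n) T_{n w}`. -/
def chirp {d : ℕ} (θ φ : ℝ) (w : Fin d → ℤ) (L : ℕ) : ConvAlg d :=
  ∑ n ∈ Finset.range L, AddMonoidAlgebra.single ((n : ℤ) • w) (expi (θ * n ^ 2 + φ * n))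

theorem nrm_chirp_sq_le {d : ℕ} (θ φ : ℝ) (w : Fin d → ℤ) {L : ℕ} (hL : 1 ≤ L) :
    nrm (chirp θ φ w L) ^ 2 ≤
      2 * ∑ h ∈ Finset.range L, 2 * (L : ℝ) / (1 + 2 * L * distInt (2 * h * θ)) := by
  set B : ℕ → ℝ := fun h => 2 * (L : ℝ) / (1 + 2 * L * distInt (2 * h * θ)) with hBd
  have hB0 : 0 ≤ 2 * ∑ h ∈ Finset.range L, B h := by
    refine mul_nonneg zero_le_two (Finset.sum_nonneg fun h _ => ?_)
    have := distInt_nonneg (2 * h * θ)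
    simp only [hBd]; positivity
  have h1 : nrm (chirp θ φ w L) ≤ √(2 * ∑ h ∈ Finset.range L, B h) := by
    refine nrm_le (Real.sqrt_nonneg _) fun g => ?_
    have h2 := norm_sum_shiftBy_sq_le L (fun n => expi (θ * n ^ 2 + φ * n)) w (B := B) ?_ g
    · have h3 : act (chirp θ φ w L) g =
          ∑ n ∈ Finset.range L, expi (θ * n ^ 2 + φ * n) • shiftBy ((n : ℤ) • w) g := by
        rw [chirp, map_sum, sum_apply]
        simp only [act_single]
      rw [h3]
      refine Real.le_sqrt_of_sq_le (h2) |>.trans ?_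
      rw [Real.sqrt_mul hB0, Real.sqrt_sq (norm_nonneg _)]
    · intro h hh
      have h3 : ∀ m : ℕ, expi (θ * (m + h : ℕ) ^ 2 + φ * (m + h : ℕ)) *
          (starRingEnd ℂ) (expi (θ * m ^ 2 + φ * m)) =
          expi (θ * h ^ 2 + φ * h) * expi (m * (2 * h * θ)) := by
        intro m
        rw [conj_expi, ← expi_add, ← expi_add]; congr 1; push_cast; ring
      simp only [h3]
      rw [← Finset.mul_sum, norm_mul, norm_expi, one_mul]
      exact norm_geom_sum_expi_le hL (by omega) _
  calc nrm (chirp θ φ w L) ^ 2 ≤ √(2 * ∑ h ∈ Finset.range L, B h) ^ 2 := by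
        gcongr; exact nrm_nonneg _
    _ = _ := Real.sq_sqrt hB0

theorem nrm_chirp_weyl {ε c₀ : ℝ} (h0 : 0 < ε) (h1 : ε < 1) (hc : 0 < c₀) : ∃ C : ℝ, 0 < C ∧
    ∀ (d L q a : ℕ) (β J φ : ℝ) (w : Fin d → ℤ), 1 ≤ L → 1 ≤ q → Nat.Coprime a q →
    |β| * (4 * q * L) ≤ 1 → (q : ℝ) ≤ 16 * L → 1 ≤ J → (J = 1 ∨ J ≤ c₀ * L ^ 2 * |β|) →
    nrm (chirp ((a : ℝ) / q + β) φ w L) ≤ C * L * (q * J) ^ ((ε - 1) / 2) := by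
  obtain ⟨C, hC, H⟩ := weyl_sum h0 h1 hc
  refine ⟨√(2 * C), by positivity, ?_⟩
  intro d L q a β J φ w hL hq ha hβ hqL hJ hJc
  have h2 := (nrm_chirp_sq_le ((a : ℝ) / q + β) φ w hL).trans
    (mul_le_mul_of_nonneg_left (H L q a β J hL hq ha hβ hqL hJ hJc) zero_le_two)
  have hqJ : (0 : ℝ) < q * J := by
    have : (0 : ℝ) < q := by exact_mod_cast hq
    positivity
  refine le_of_sq_le_sq (h2.trans (le_of_eq ?_)) (by positivity)
  rw [mul_pow, mul_pow, Real.sq_sqrt (by positivity), ← Real.rpow_mul_natCast hqJ.le]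
  rw [show (ε - 1) / 2 * ((2 : ℕ) : ℝ) = ε - 1 by push_cast; ring]
  ring

theorem act_mul_apply {d : ℕ} (A B : ConvAlg d) (g : SqLat d) : act (A * B) g = act A (act B g) := by
  rw [map_mul]; rfl

theorem nrm_mul_le_of_le {d : ℕ} {A B : ConvAlg d} {a b : ℝ} (ha : nrm A ≤ a) (hb : nrm B ≤ b) :
    nrm (A * B) ≤ a * b :=
  (nrm_mul_le A B).trans (mul_le_mul ha hb (nrm_nonneg _) ((nrm_nonneg _).trans ha))

theorem nrm_mul_one_sub_prod_le {d : ℕ} {ι : Type*} (s : Finset ι) {p : ι → ConvAlg d}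
    (hp : ∀ i, nrm (p i) ≤ 1) (A : ConvAlg d) :
    nrm (A * (1 - ∏ i ∈ s, p i)) ≤ ∑ i ∈ s, nrm (A * (1 - p i)) := by
  classical
  induction s using Finset.induction_on with
  | empty => simp [nrm_zero]
  | insert a s ha ih =>
    rw [Finset.prod_insert ha, Finset.sum_insert ha]
    have h : A * (1 - p a * ∏ i ∈ s, p i) =
        A * (1 - p a) + p a * (A * (1 - ∏ i ∈ s, p i)) := by ring
    rw [h]
    refine (nrm_add_le _ _).trans (add_le_add le_rfl ?_)
    have := nrm_mul_le_of_le (hp a) ih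
    linarith

theorem nrm_prod_sub_prod_le {d : ℕ} {ι : Type*} (s : Finset ι) {a b : ι → ConvAlg d} {B : ℝ}
    (hB : 1 ≤ B) (ha : ∀ i, nrm (a i) ≤ B) (hb : ∀ i, nrm (b i) ≤ B) :
    nrm (∏ i ∈ s, a i - ∏ i ∈ s, b i) ≤ B ^ s.card * ∑ i ∈ s, nrm (a i - b i) := by
  classical
  induction s using Finset.induction_on with
  | empty => simp [nrm_zero]
  | insert i s hi ih =>
    rw [Finset.prod_insert hi, Finset.prod_insert hi, Finset.sum_insert hi,
      Finset.card_insert_of_notMem hi]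
    have h : a i * ∏ i ∈ s, a i - b i * ∏ i ∈ s, b i =
        (∏ i ∈ s, a i) * (a i - b i) + b i * (∏ i ∈ s, a i - ∏ i ∈ s, b i) := by ring
    rw [h]
    refine (nrm_add_le _ _).trans ?_
    have h1 : nrm (∏ i ∈ s, a i) ≤ B ^ s.card :=
      (nrm_prod_le _ _).trans ((Finset.prod_le_prod (fun _ _ => nrm_nonneg _) fun i _ => ha i).trans
        (by simp))
    have h2 := nrm_mul_le_of_le h1 (le_refl (nrm (a i - b i)))
    have h3 := nrm_mul_le_of_le (hb i) ih
    have h4 : B ^ s.card * nrm (a i - b i) ≤ B ^ (s.card + 1) * nrm (a i - b i) :=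
      mul_le_mul_of_nonneg_right (pow_le_pow_right₀ hB (Nat.le_succ _)) (nrm_nonneg _)
    rw [pow_succ] at h4 ⊢
    nlinarith

theorem norm_act_prod_sub_prod_le {d : ℕ} {ι : Type*} (s : Finset ι) {a b : ι → ConvAlg d}
    (ha : ∀ i, nrm (a i) ≤ 1) (hb : ∀ i, nrm (b i) ≤ 1) (g : SqLat d) :
    ‖act (∏ i ∈ s, a i - ∏ i ∈ s, b i) g‖ ≤ ∑ i ∈ s, ‖act (a i - b i) g‖ := by
  classical
  induction s using Finset.induction_on with
  | empty => simp
  | insert i s hi ih =>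
    rw [Finset.prod_insert hi, Finset.prod_insert hi, Finset.sum_insert hi]
    have h : a i * ∏ i ∈ s, a i - b i * ∏ i ∈ s, b i =
        (∏ i ∈ s, a i) * (a i - b i) + b i * (∏ i ∈ s, a i - ∏ i ∈ s, b i) := by ring
    rw [h, map_add, add_apply, act_mul_apply, act_mul_apply]
    refine (norm_add_le _ _).trans (add_le_add ?_ ?_)
    · have h1 : nrm (∏ i ∈ s, a i) ≤ 1 :=
        (nrm_prod_le _ _).trans (Finset.prod_le_one (fun _ _ => nrm_nonneg _) fun i _ => ha i)
      exact (norm_act_le _ _).trans (mul_le_of_le_one_left (norm_nonneg _) h1)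
    · exact ((norm_act_le _ _).trans (mul_le_of_le_one_left (norm_nonneg _) (hb i))).trans ih

theorem sum_pow_natDist_le {ρ : ℝ} (h0 : 0 ≤ ρ) (h1 : ρ < 1) (s : ℕ) (S : Finset ℕ) :
    ∑ l ∈ S, ρ ^ (Nat.dist s l) ≤ 2 / (1 - ρ) := by
  have hg : ∀ T : Finset ℕ, ∑ n ∈ T, ρ ^ n ≤ 1 / (1 - ρ) := fun T => by
    rw [one_div, ← tsum_geometric_of_lt_one h0 h1]
    exact (summable_geometric_of_lt_one h0 h1).sum_le_tsum T fun _ _ => by positivity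
  rw [← Finset.sum_filter_add_sum_filter_not S (fun l => l ≤ s)]
  have h2 : ∑ l ∈ S.filter (fun l => l ≤ s), ρ ^ (Nat.dist s l) ≤ 1 / (1 - ρ) := by
    rw [← Finset.sum_image (f := fun n => ρ ^ n) (g := fun l => Nat.dist s l)]
    · exact hg _
    · intro a ha b hb hab
      simp only [Finset.coe_filter, Set.mem_ofPred_eq, Nat.dist] at ha hb hab
      omega
  have h3 : ∑ l ∈ S.filter (fun l => ¬ l ≤ s), ρ ^ (Nat.dist s l) ≤ 1 / (1 - ρ) := by
    rw [← Finset.sum_image (f := fun n => ρ ^ n) (g := fun l => Nat.dist s l)]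
    · exact hg _
    · intro a ha b hb hab
      simp only [Finset.coe_filter, Set.mem_ofPred_eq, Nat.dist] at ha hb hab
      omega
  have : 2 / (1 - ρ) = 1 / (1 - ρ) + 1 / (1 - ρ) := by ring
  linarith

theorem sum_sq_sum_pow_natDist_le {ρ : ℝ} (h0 : 0 ≤ ρ) (h1 : ρ < 1) (S T : Finset ℕ)
    (b : ℕ → ℝ) :
    ∑ s ∈ S, (∑ l ∈ T, ρ ^ (Nat.dist s l) * b l) ^ 2 ≤ (2 / (1 - ρ)) ^ 2 * ∑ l ∈ T, b l ^ 2 := by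
  have hK : 0 ≤ 2 / (1 - ρ) := div_nonneg (by norm_num) (by linarith)
  have h2 : ∀ s ∈ S, (∑ l ∈ T, ρ ^ (Nat.dist s l) * b l) ^ 2 ≤
      2 / (1 - ρ) * ∑ l ∈ T, ρ ^ (Nat.dist s l) * b l ^ 2 := fun s _ => by
    have h3 : (∑ l ∈ T, ρ ^ (Nat.dist s l) * b l) ^ 2 ≤
        (∑ l ∈ T, ρ ^ (Nat.dist s l)) * ∑ l ∈ T, ρ ^ (Nat.dist s l) * b l ^ 2 :=
      Finset.sum_sq_le_sum_mul_sum_of_sq_le_mul T (fun l _ => by positivity)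
        (fun l _ => by positivity) fun l _ => le_of_eq (by ring)
    exact h3.trans (mul_le_mul_of_nonneg_right (sum_pow_natDist_le h0 h1 s T)
      (Finset.sum_nonneg fun l _ => by positivity))
  refine (Finset.sum_le_sum h2).trans ?_
  rw [← Finset.mul_sum, Finset.sum_comm, sq, mul_assoc]
  refine mul_le_mul_of_nonneg_left ?_ hK
  rw [Finset.mul_sum]
  refine Finset.sum_le_sum fun l _ => ?_
  rw [← Finset.sum_mul]
  refine mul_le_mul_of_nonneg_right ?_ (sq_nonneg _)
  simpa only [Nat.dist_comm] using sum_pow_natDist_le h0 h1 l S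

/-- The smoothed low-frequency projection `3 x² - 2 x³`. -/
def smoothStep {d : ℕ} (x : ConvAlg d) : ConvAlg d := 3 * x ^ 2 - 2 * x ^ 3

theorem nrm_nat_mul_le {d : ℕ} (n : ℕ) (K : ConvAlg d) : nrm ((n : ConvAlg d) * K) ≤ n * nrm K := by
  have : (n : ConvAlg d) * K = (n : ℂ) • K := by
    rw [← nsmul_eq_mul, ← Nat.cast_smul_eq_nsmul ℂ]
  rw [this, nrm_smul]
  simp

theorem sum_norm_sq_act_sub_le {d : ℕ} {ρ A B : ℝ} (h0 : 1 / 2 ≤ ρ) (h1 : ρ < 1) (hB : 0 ≤ B)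
    {P : ℕ → ConvAlg d} (hP0 : P 0 = 1) (hP : ∀ l, nrm (P l) ≤ 1)
    (hsq : ∀ N (g : SqLat d), ∑ l ∈ Finset.range N, ‖act (P l - P (l + 1)) g‖ ^ 2 ≤ A * ‖g‖ ^ 2)
    (S : Finset ℕ) (H : ℕ → ConvAlg d) (σ : ℕ → ℂ)
    (hU : ∀ s ∈ S, ∀ l ≤ s, nrm (H s * (1 - P l)) ≤ B * ρ ^ (s - l))
    (hV : ∀ s ∈ S, ∀ l, s ≤ l → nrm ((H s - σ s • 1) * P l) ≤ B * ρ ^ (l - s)) (g : SqLat d) :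
    ∑ s ∈ S, ‖act (H s - σ s • smoothStep (P s)) g‖ ^ 2 ≤
      (58 * B / (1 - ρ)) ^ 2 * (A + 1) * ‖g‖ ^ 2 := by
  have hρ : 0 < ρ := by linarith
  obtain ⟨Λ, hΛ⟩ : ∃ Λ, ∀ s ∈ S, s < Λ := ⟨S.sup id + 1, fun s hs =>
    Nat.lt_succ_of_le (Finset.le_sup (f := id) hs)⟩
  set R : ℕ → ConvAlg d := fun l => 3 * P l + 3 * P (l + 1) - 2 * P l ^ 2 -
    2 * (P l * P (l + 1)) - 2 * P (l + 1) ^ 2 with hR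
  have hstep : ∀ l, smoothStep (P l) - smoothStep (P (l + 1)) = R l * (P l - P (l + 1)) := fun l => by
    simp only [smoothStep, hR]; ring
  set b : ℕ → ℝ := fun l => if l < Λ then ‖act (P l - P (l + 1)) g‖ else ‖g‖ with hb
  have hbsum : ∑ l ∈ Finset.range (Λ + 1), b l ^ 2 ≤ (A + 1) * ‖g‖ ^ 2 := by
    rw [Finset.sum_range_succ]
    have h3 : ∑ l ∈ Finset.range Λ, b l ^ 2 = ∑ l ∈ Finset.range Λ, ‖act (P l - P (l + 1)) g‖ ^ 2 :=
      Finset.sum_congr rfl fun l hl => by simp [hb, Finset.mem_range.1 hl]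
    have h4 : b Λ = ‖g‖ := by simp [hb]
    rw [h3, h4]
    linarith [hsq Λ g]
  have n1 : ∀ l, nrm (1 - P l) ≤ 2 := fun l =>
    (nrm_sub_le _ _).trans (by linarith [hP l, nrm_one_le (d := d)])
  have n2 : ∀ K : ConvAlg d, nrm (2 * K) ≤ 2 * nrm K := fun K => by
    simpa using nrm_nat_mul_le 2 K
  have n3 : nrm (3 : ConvAlg d) ≤ 3 := by
    have := nrm_nat_mul_le (d := d) 3 1
    have h := nrm_one_le (d := d)
    simp only [Nat.cast_ofNat, mul_one] at this
    linarith
  have hlow : ∀ s ∈ S, ∀ l < s, nrm (H s * R l) ≤ 29 * B * ρ ^ (s - l) := by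
    intro s hs l hl
    have e : H s * R l = (H s * (1 - P l)) * (3 - 2 * (1 - P l)) +
        (H s * (1 - P (l + 1))) * (3 - 2 * (1 - P l) - 2 * (1 - P (l + 1))) := by
      simp only [hR]; ring
    rw [e]
    have c1 : nrm (3 - 2 * (1 - P l)) ≤ 7 :=
      (nrm_sub_le _ _).trans (by linarith [n2 (1 - P l), n1 l])
    have c2 : nrm (3 - 2 * (1 - P l) - 2 * (1 - P (l + 1))) ≤ 11 :=
      (nrm_sub_le _ _).trans (by linarith [n2 (1 - P (l + 1)), n1 (l + 1)])
    have d1 := nrm_mul_le_of_le (hU s hs l hl.le) c1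
    have d2 := nrm_mul_le_of_le (hU s hs (l + 1) hl) c2
    have d3 : ρ ^ (s - l) = ρ ^ (s - (l + 1)) * ρ := by rw [← pow_succ]; congr 1; omega
    have d4 : 0 ≤ B * ρ ^ (s - (l + 1)) := by positivity
    refine (nrm_add_le _ _).trans ?_
    have d5 : B * ρ ^ (s - (l + 1)) * 1 ≤ B * ρ ^ (s - (l + 1)) * (2 * ρ) :=
      mul_le_mul_of_nonneg_left (by linarith) d4
    rw [d3] at d1 ⊢
    linarith
  have hhigh : ∀ s ∈ S, ∀ l, s ≤ l → nrm ((H s - σ s • 1) * R l) ≤ 29 * B * ρ ^ (l - s) := by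
    intro s hs l hl
    have e : (H s - σ s • 1) * R l = ((H s - σ s • 1) * P l) * (3 - 2 * P l - 2 * P (l + 1)) +
        ((H s - σ s • 1) * P (l + 1)) * (3 - 2 * P (l + 1)) := by
      simp only [hR]; ring
    rw [e]
    have c1 : nrm (3 - 2 * P l) ≤ 5 := (nrm_sub_le _ _).trans (by linarith [n2 (P l), hP l])
    have c3 : nrm (3 - 2 * P (l + 1)) ≤ 5 :=
      (nrm_sub_le _ _).trans (by linarith [n2 (P (l + 1)), hP (l + 1)])
    have c2 : nrm (3 - 2 * P l - 2 * P (l + 1)) ≤ 7 :=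
      (nrm_sub_le _ _).trans (by linarith [n2 (P (l + 1)), hP (l + 1)])
    have d1 := nrm_mul_le_of_le (hV s hs l hl) c2
    have d2 := nrm_mul_le_of_le (hV s hs (l + 1) (by omega)) c3
    have d3 : ρ ^ (l + 1 - s) = ρ ^ (l - s) * ρ := by rw [← pow_succ]; congr 1; omega
    have d4 : 0 ≤ B * ρ ^ (l - s) := by positivity
    refine (nrm_add_le _ _).trans ?_
    have d5 : B * ρ ^ (l - s) * ρ ≤ B * ρ ^ (l - s) * 1 :=
      mul_le_mul_of_nonneg_left h1.le d4
    rw [d3] at d2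
    linarith
  have hrem : ∀ s ∈ S, nrm ((H s - σ s • 1) * smoothStep (P Λ)) ≤ 29 * B * ρ ^ (Λ - s) := by
    intro s hs
    have e : (H s - σ s • 1) * smoothStep (P Λ) =
        ((H s - σ s • 1) * P Λ) * (P Λ * (3 - 2 * P Λ)) := by
      simp only [smoothStep]; ring
    rw [e]
    have c1 : nrm (3 - 2 * P Λ) ≤ 5 := (nrm_sub_le _ _).trans (by linarith [n2 (P Λ), hP Λ])
    have c2 := nrm_mul_le_of_le (hP Λ) c1
    have d1 := nrm_mul_le_of_le (hV s hs Λ (hΛ s hs).le) c2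
    have d4 : 0 ≤ B * ρ ^ (Λ - s) := by positivity
    linarith
  have hdec : ∀ s ∈ S, H s - σ s • smoothStep (P s) =
      ∑ l ∈ Finset.range Λ, (if l < s then H s else H s - σ s • 1) * (R l * (P l - P (l + 1))) +
        (H s - σ s • 1) * smoothStep (P Λ) := by
    intro s hs
    have hs' := hΛ s hs
    simp only [← hstep]
    rw [← Finset.sum_range_add_sum_Ico _ hs'.le]
    have e1 : ∑ l ∈ Finset.range s, (if l < s then H s else H s - σ s • 1) *
        (smoothStep (P l) - smoothStep (P (l + 1))) = H s * (1 - smoothStep (P s)) := by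
      rw [Finset.sum_congr rfl fun l hl => by rw [if_pos (Finset.mem_range.1 hl)],
        ← Finset.mul_sum, Finset.sum_range_sub', hP0]
      simp only [smoothStep]; ring
    have e2 : ∑ l ∈ Finset.Ico s Λ, (if l < s then H s else H s - σ s • 1) *
        (smoothStep (P l) - smoothStep (P (l + 1))) =
        (H s - σ s • 1) * (smoothStep (P s) - smoothStep (P Λ)) := by
      rw [Finset.sum_congr rfl fun l hl => by
        rw [if_neg (not_lt.2 (Finset.mem_Ico.1 hl).1)], ← Finset.mul_sum]
      congr 1
      rw [Finset.sum_Ico_eq_sum_range]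
      have := Finset.sum_range_sub' (fun i => smoothStep (P (s + i))) (Λ - s)
      simp only [add_zero, ← add_assoc] at this
      rw [this]
      congr 3; omega
    rw [e1, e2, Algebra.smul_def, Algebra.smul_def]
    ring
  have hpt : ∀ s ∈ S, ‖act (H s - σ s • smoothStep (P s)) g‖ ≤
      ∑ l ∈ Finset.range (Λ + 1), ρ ^ (Nat.dist s l) * (29 * B * b l) := by
    intro s hs
    rw [hdec s hs, map_add, add_apply, Finset.sum_range_succ, map_sum]
    refine (norm_add_le _ _).trans (add_le_add ?_ ?_)
    · rw [sum_apply]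
      refine (norm_sum_le _ _).trans (Finset.sum_le_sum fun l hl => ?_)
      have hl' := Finset.mem_range.1 hl
      rw [← mul_assoc, act_mul_apply]
      refine (norm_act_le _ _).trans ?_
      have hbl : b l = ‖act (P l - P (l + 1)) g‖ := by simp [hb, hl']
      rw [← hbl]
      have hbn : 0 ≤ b l := by rw [hbl]; positivity
      split_ifs with hls
      · have e : Nat.dist s l = s - l := by simp [Nat.dist]; omega
        rw [e]
        have := mul_le_mul_of_nonneg_right (hlow s hs l hls) hbn
        linarith
      · have e : Nat.dist s l = l - s := by simp [Nat.dist]; omega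
        rw [e]
        have := mul_le_mul_of_nonneg_right (hhigh s hs l (not_lt.1 hls)) hbn
        linarith
    · refine (norm_act_le _ _).trans ?_
      have hbl : b Λ = ‖g‖ := by simp [hb]
      have hs' := hΛ s hs
      have e : Nat.dist s Λ = Λ - s := by simp [Nat.dist]; omega
      rw [e, hbl]
      have := mul_le_mul_of_nonneg_right (hrem s hs) (norm_nonneg g)
      linarith
  calc ∑ s ∈ S, ‖act (H s - σ s • smoothStep (P s)) g‖ ^ 2
      ≤ ∑ s ∈ S, (∑ l ∈ Finset.range (Λ + 1), ρ ^ (Nat.dist s l) * (29 * B * b l)) ^ 2 :=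
        Finset.sum_le_sum fun s hs => pow_le_pow_left₀ (norm_nonneg _) (hpt s hs) 2
    _ ≤ (2 / (1 - ρ)) ^ 2 * ∑ l ∈ Finset.range (Λ + 1), (29 * B * b l) ^ 2 :=
        sum_sq_sum_pow_natDist_le hρ.le h1 _ _ _
    _ = (58 * B / (1 - ρ)) ^ 2 * ∑ l ∈ Finset.range (Λ + 1), b l ^ 2 := by
        simp_rw [mul_pow, ← Finset.mul_sum]; ring
    _ ≤ _ := by
        rw [mul_assoc]
        exact mul_le_mul_of_nonneg_left hbsum (sq_nonneg _)

theorem prod_sum_single {d : ℕ} {α : Type*} [DecidableEq α] (S : Fin d → Finset α) (v : Fin d → α → Fin d → ℤ)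
    (c : Fin d → α → ℂ) :
    ∏ i, ∑ n ∈ S i, (AddMonoidAlgebra.single (v i n) (c i n) : ConvAlg d) =
      ∑ φ ∈ Fintype.piFinset S, AddMonoidAlgebra.single (∑ i, v i (φ i)) (∏ i, c i (φ i)) := by
  rw [Finset.prod_univ_sum]
  refine Finset.sum_congr rfl fun φ _ => ?_
  have : ∀ s : Finset (Fin d), ∏ i ∈ s, (AddMonoidAlgebra.single (v i (φ i)) (c i (φ i)) : ConvAlg d) =
      AddMonoidAlgebra.single (∑ i ∈ s, v i (φ i)) (∏ i ∈ s, c i (φ i)) := fun s => by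
    induction s using Finset.induction_on with
    | empty => simp [AddMonoidAlgebra.one_def]
    | insert a s ha ih =>
      rw [Finset.prod_insert ha, Finset.sum_insert ha, Finset.prod_insert ha, ih,
        AddMonoidAlgebra.single_mul_single]
  exact this _

theorem act_smul_apply {d : ℕ} (c : ℂ) (K : ConvAlg d) (g : SqLat d) (x : Fin d → ℤ) :
    act (c • K) g x = c * act K g x := by
  rw [map_smul]; rfl

theorem sum_smul_piSingle {d : ℕ} (q : ℤ) (n : Fin d → ℤ) :
    ∑ i, n i • (Pi.single i q : Fin d → ℤ) = fun i => n i * q := by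
  ext j
  simp [Finset.sum_apply, Pi.single_apply]

/-- Translation by `n q` in the `i`-th coordinate direction. -/
def stepBy {d : ℕ} (q : ℕ) (i : Fin d) (n : ℤ) : ConvAlg d :=
  AddMonoidAlgebra.single (n • Pi.single i (q : ℤ)) 1

theorem stepBy_add {d : ℕ} (q : ℕ) (i : Fin d) (m n : ℤ) :
    stepBy q i (m + n) = stepBy q i m * stepBy q i n := by
  simp [stepBy, AddMonoidAlgebra.single_mul_single, add_smul]

theorem stepBy_zero {d : ℕ} (q : ℕ) (i : Fin d) : stepBy q i 0 = 1 := by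
  simp [stepBy, AddMonoidAlgebra.one_def]

theorem nrm_stepBy_le {d : ℕ} (q : ℕ) (i : Fin d) (n : ℤ) : nrm (stepBy q i n) ≤ 1 :=
  (nrm_single_le _ _).trans (by simp)

theorem norm_act_stepBy {d : ℕ} (q : ℕ) (i : Fin d) (n : ℤ) (g : SqLat d) :
    ‖act (stepBy q i n) g‖ = ‖g‖ := by
  rw [stepBy, act_single, one_smul, LinearIsometry.norm_map]

/-- The average over `0 ≤ n < 2^l` of the translations by `n q` in the `i`-th direction. -/
def dyadicAvg {d : ℕ} (q : ℕ) (i : Fin d) : ℕ → ConvAlg d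
  | 0 => 1
  | l + 1 => (1 / 2 : ℂ) • (dyadicAvg q i l * (1 + stepBy q i (2 ^ l)))

theorem dyadicAvg_eq {d : ℕ} (q : ℕ) (i : Fin d) (l : ℕ) :
    dyadicAvg q i l = ((2 : ℂ) ^ l)⁻¹ • ∑ n ∈ Finset.range (2 ^ l), stepBy q i n := by
  induction l with
  | zero => simp [dyadicAvg, stepBy_zero]
  | succ l ih =>
    rw [dyadicAvg, ih, show 2 ^ (l + 1) = 2 ^ l + 2 ^ l by ring, Finset.sum_range_add]
    simp only [Nat.cast_add, stepBy_add]
    rw [← Finset.mul_sum, mul_add, mul_one, smul_mul_assoc, smul_add, smul_smul, smul_smul,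
      ← smul_add]
    congr 1
    · rw [pow_succ, mul_inv]; ring
    · push_cast; ring

theorem nrm_dyadicAvg_le {d : ℕ} (q : ℕ) (i : Fin d) (l : ℕ) : nrm (dyadicAvg q i l) ≤ 1 := by
  rw [dyadicAvg_eq, nrm_smul, norm_inv, norm_pow, Complex.norm_ofNat]
  rw [inv_mul_le_iff₀ (by positivity), mul_one]
  have h : ∑ n ∈ Finset.range (2 ^ l), nrm (stepBy q i (n : ℤ)) ≤ ∑ n ∈ Finset.range (2 ^ l), 1 :=
    Finset.sum_le_sum fun n _ => nrm_stepBy_le q i n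
  exact (nrm_sum_le _ _).trans (h.trans (by simp))

theorem norm_dyadicAvg_sub_sq {d : ℕ} (q : ℕ) (i : Fin d) (l : ℕ) (g : SqLat d) :
    ‖act (dyadicAvg q i l - dyadicAvg q i (l + 1)) g‖ ^ 2 =
      ‖act (dyadicAvg q i l) g‖ ^ 2 - ‖act (dyadicAvg q i (l + 1)) g‖ ^ 2 := by
  set a := act (dyadicAvg q i l) g with ha
  set b := act (stepBy q i (2 ^ l)) a with hb
  have e1 : act (dyadicAvg q i (l + 1)) g = (1 / 2 : ℂ) • (a + b) := by
    rw [dyadicAvg, map_smul, mul_comm, map_mul, map_add, map_one]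
    rfl
  have e2 : act (dyadicAvg q i l - dyadicAvg q i (l + 1)) g = (1 / 2 : ℂ) • (a - b) := by
    rw [map_sub, sub_apply, e1, ← ha]
    module
  have hab : ‖b‖ = ‖a‖ := norm_act_stepBy _ _ _ _
  have hp := parallelogram_law_with_norm ℂ a b
  rw [e1, e2, norm_smul, norm_smul]
  have : ‖(1 / 2 : ℂ)‖ = 1 / 2 := by simp
  rw [this]
  rw [hab] at hp
  nlinarith

/-- The average over translations by `q n`, `n ∈ [0, 2^l)^d`. -/
def boxAvg (d q l : ℕ) : ConvAlg d := ∏ i, dyadicAvg q i l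

theorem boxAvg_zero (d q : ℕ) : boxAvg d q 0 = 1 := by simp [boxAvg, dyadicAvg]

theorem nrm_boxAvg_le (d q l : ℕ) : nrm (boxAvg d q l) ≤ 1 :=
  (nrm_prod_le _ _).trans
    (Finset.prod_le_one (fun _ _ => nrm_nonneg _) fun i _ => nrm_dyadicAvg_le q i l)

theorem sum_norm_sq_boxAvg_sub_le (d q N : ℕ) (g : SqLat d) :
    ∑ l ∈ Finset.range N, ‖act (boxAvg d q l - boxAvg d q (l + 1)) g‖ ^ 2 ≤
      (d : ℝ) ^ 2 * ‖g‖ ^ 2 := by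
  have h1 : ∀ l, ‖act (boxAvg d q l - boxAvg d q (l + 1)) g‖ ^ 2 ≤
      d * ∑ i : Fin d, ‖act (dyadicAvg q i l - dyadicAvg q i (l + 1)) g‖ ^ 2 := fun l => by
    have := norm_act_prod_sub_prod_le Finset.univ (fun i => nrm_dyadicAvg_le q i l)
      (fun i => nrm_dyadicAvg_le q i (l + 1)) g
    refine (pow_le_pow_left₀ (norm_nonneg _) this 2).trans ?_
    simpa using sq_sum_le_card_mul_sum_sq (s := (Finset.univ : Finset (Fin d)))
      (f := fun i => ‖act (dyadicAvg q i l - dyadicAvg q i (l + 1)) g‖)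
  refine (Finset.sum_le_sum fun l _ => h1 l).trans ?_
  rw [← Finset.mul_sum, Finset.sum_comm, sq, mul_assoc]
  refine mul_le_mul_of_nonneg_left ?_ (Nat.cast_nonneg _)
  have h2 : ∀ i : Fin d, ∑ l ∈ Finset.range N, ‖act (dyadicAvg q i l - dyadicAvg q i (l + 1)) g‖ ^ 2
      ≤ ‖g‖ ^ 2 := fun i => by
    simp_rw [norm_dyadicAvg_sub_sq]
    rw [Finset.sum_range_sub']
    have : act (dyadicAvg q i 0) g = g := by simp [dyadicAvg]
    rw [this]
    linarith [sq_nonneg ‖act (dyadicAvg q i N) g‖]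
  refine (Finset.sum_le_sum fun i _ => h2 i).trans ?_
  simp

theorem act_boxAvg_apply (d q l : ℕ) (g : SqLat d) (x : Fin d → ℤ) :
    act (boxAvg d q l) g x = ((2 : ℂ) ^ (l * d))⁻¹ *
      ∑ n ∈ Fintype.piFinset fun _ : Fin d => Finset.range (2 ^ l),
        g (x - fun i => (n i : ℤ) * q) := by
  have e : boxAvg d q l = ((2 : ℂ) ^ (l * d))⁻¹ •
      ∑ φ ∈ Fintype.piFinset fun _ : Fin d => Finset.range (2 ^ l),
        AddMonoidAlgebra.single (fun i => (φ i : ℤ) * (q : ℤ)) (1 : ℂ) := by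
    have h := prod_sum_single (fun _ : Fin d => Finset.range (2 ^ l))
      (fun i (n : ℕ) => (n : ℤ) • (Pi.single i (q : ℤ) : Fin d → ℤ)) (fun _ _ => (1 : ℂ))
    simp only [sum_smul_piSingle (q : ℤ) (fun i => ((_ : Fin d → ℕ) i : ℤ)),
      Finset.prod_const_one] at h
    rw [← h]
    simp_rw [boxAvg, dyadicAvg_eq, Algebra.smul_def]
    rw [Finset.prod_mul_distrib, Finset.prod_const, ← map_pow]
    simp only [Finset.card_univ, Fintype.card_fin, inv_pow, ← pow_mul]
    rfl
  rw [e, act_smul_apply, act_sum_single_apply]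
  simp

/-- The dyadic maximal function along the sublattice `q ℤ^d`. -/
def hlStep (d q L : ℕ) (h : (Fin d → ℤ) → ℝ≥0∞) (x : Fin d → ℤ) : ℝ≥0∞ :=
  ⨆ k ∈ Finset.range L, ((2 : ℝ≥0∞) ^ (k * d))⁻¹ *
    ∑ v ∈ latticeBox d (2 ^ (k + 1)), h (x - fun i => v i * q)

/-- Coordinatewise Euclidean division by `q` on `ℤ^d`. -/
def divModPi (d q : ℕ) [NeZero q] : (Fin d → ℤ) ≃ (Fin d → Fin q) × (Fin d → ℤ) :=
  ((Equiv.piCongrRight fun _ => Int.divModEquiv q).trans (Equiv.arrowProdEquivProdArrow _ _ _)).trans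
    (Equiv.prodComm _ _)

theorem divModPi_symm_apply (d q : ℕ) [NeZero q] (b : Fin d → Fin q) (y : Fin d → ℤ) :
    (divModPi d q).symm (b, y) = fun i => y i * q + (b i : ℕ) := by
  ext i
  simp [divModPi, Equiv.arrowProdEquivProdArrow, Int.divModEquiv]

theorem hlStep_lp (d : ℕ) {p : ℝ} (hp : 1 < p) : ∃ C : ℝ≥0, ∀ q L (h : (Fin d → ℤ) → ℝ≥0∞),
    1 ≤ q → lpNormE d p (hlStep d q L h) ≤ C * lpNormE d p h := by
  obtain ⟨C, hC⟩ := hlMax_lp d hp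
  refine ⟨C, fun q L h hq => ?_⟩
  have hp0 : 0 < p := by linarith
  have : NeZero q := ⟨by omega⟩
  have key : ∀ F : (Fin d → ℤ) → ℝ≥0∞, ∑' x, F x ^ p =
      ∑' b : Fin d → Fin q, ∑' y : Fin d → ℤ, F (fun i => y i * q + (b i : ℕ)) ^ p := fun F => by
    rw [← (divModPi d q).symm.tsum_eq, ENNReal.tsum_prod']
    simp_rw [divModPi_symm_apply]
  have h1 : ∀ (b : Fin d → Fin q) (y : Fin d → ℤ),
      hlStep d q L h (fun i => y i * q + (b i : ℕ)) =
        hlMax d L (fun y => h (fun i => y i * q + (b i : ℕ))) y := fun b y => by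
    unfold hlStep hlMax
    have e : ∀ v : Fin d → ℤ, ((fun i => y i * q + (b i : ℕ)) - fun i => v i * (q : ℤ)) =
        fun i => (y - v) i * q + (b i : ℕ) := fun v => by
      ext i
      simp only [Pi.sub_apply]
      ring
    simp only [e]
  have h2 : ∑' x, hlStep d q L h x ^ p ≤ (C * lpNormE d p h) ^ p := by
    rw [ENNReal.mul_rpow_of_nonneg _ _ hp0.le, lpNormE_rpow hp0, key, key h, ← ENNReal.tsum_mul_left]
    refine ENNReal.tsum_le_tsum fun b => ?_
    simp_rw [h1]
    have := ENNReal.rpow_le_rpow (hC L (fun y => h (fun i => y i * q + (b i : ℕ)))) hp0.le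
    rwa [ENNReal.mul_rpow_of_nonneg _ _ hp0.le, lpNormE_rpow hp0, lpNormE_rpow hp0] at this
  rw [lpNormE, one_div]
  exact (ENNReal.rpow_inv_le_iff hp0).2 h2

theorem enorm_act_boxAvg_le {d q l L : ℕ} (hl : l < L) {g : SqLat d} {h : (Fin d → ℤ) → ℝ≥0∞}
    (hg : ∀ x, ‖g x‖ₑ ≤ h x) (x : Fin d → ℤ) : ‖act (boxAvg d q l) g x‖ₑ ≤ hlStep d q L h x := by
  refine le_trans ?_ (le_iSup₂ (f := fun k (_ : k ∈ Finset.range L) => ((2 : ℝ≥0∞) ^ (k * d))⁻¹ *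
    ∑ v ∈ latticeBox d (2 ^ (k + 1)), h (x - fun i => v i * q)) l (Finset.mem_range.2 hl))
  rw [act_boxAvg_apply, enorm_mul]
  have e : ‖((2 : ℂ) ^ (l * d))⁻¹‖ₑ = ((2 : ℝ≥0∞) ^ (l * d))⁻¹ := by
    rw [enorm_inv (pow_ne_zero _ two_ne_zero), enorm_pow]
    congr 2
    rw [← ofReal_norm]; simp
  rw [e]
  refine mul_le_mul le_rfl ?_ bot_le bot_le
  refine (enorm_sum_le _ _).trans ((Finset.sum_le_sum fun n _ => hg _).trans ?_)
  have hinj : Function.Injective fun (n : Fin d → ℕ) i => (n i : ℤ) := fun a b hab => by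
    ext i; exact Nat.cast_injective (congrFun hab i)
  rw [← Finset.sum_image (f := fun v : Fin d → ℤ => h (x - fun i => v i * q))
    (g := fun (n : Fin d → ℕ) i => (n i : ℤ)) (fun a _ b _ hab => hinj hab)]
  refine Finset.sum_le_sum_of_subset fun v hv => ?_
  obtain ⟨n, hn, rfl⟩ := Finset.mem_image.1 hv
  rw [mem_latticeBox]
  intro i
  have := Finset.mem_range.1 (Fintype.mem_piFinset.1 hn i)
  have h2 : n i < 2 ^ (l + 1) := by rw [pow_succ]; omega
  push_cast
  have h3 : (n i : ℤ) < 2 ^ (l + 1) := by exact_mod_cast h2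
  omega

theorem lpNormE_two_enorm {d : ℕ} (g : SqLat d) : lpNormE d 2 (fun x => ‖g x‖ₑ) = ‖g‖ₑ := by
  have h1 : ∑' x, ‖g x‖ₑ ^ (2 : ℝ) = ‖g‖ₑ ^ (2 : ℝ) := by
    rw [← ofReal_norm g, ENNReal.ofReal_rpow_of_nonneg (norm_nonneg _) (by norm_num),
      Real.rpow_two, norm_sq_eq_tsum,
      ENNReal.ofReal_tsum_of_nonneg (fun x => by positivity) (memℓp_two_iff.1 g.2)]
    refine tsum_congr fun x => ?_
    rw [← ofReal_norm, ENNReal.ofReal_rpow_of_nonneg (norm_nonneg _) (by norm_num),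
      Real.rpow_two]
  rw [lpNormE, h1, ← ENNReal.rpow_mul]
  norm_num

theorem lpNormE_iSup_smoothStep (d : ℕ) : ∃ C : ℝ≥0, ∀ (q : ℕ) (S : Finset ℕ) (g : SqLat d), 1 ≤ q →
    lpNormE d 2 (fun x => ⨆ s ∈ S, ‖act (smoothStep (boxAvg d q s)) g x‖ₑ) ≤ C * ‖g‖ₑ := by
  obtain ⟨C, hC⟩ := hlStep_lp d (p := 2) (by norm_num)
  refine ⟨3 * (C * C) + 2 * (C * (C * C)), fun q S g hq => ?_⟩
  obtain ⟨Λ, hΛ⟩ : ∃ Λ, ∀ s ∈ S, s < Λ := ⟨S.sup id + 1, fun s hs =>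
    Nat.lt_succ_of_le (Finset.le_sup (f := id) hs)⟩
  set M := hlStep d q Λ with hM
  set h : (Fin d → ℤ) → ℝ≥0∞ := fun x => ‖g x‖ₑ with hh
  have hpt : ∀ x, ⨆ s ∈ S, ‖act (smoothStep (boxAvg d q s)) g x‖ₑ ≤
      3 * M (M h) x + 2 * M (M (M h)) x := fun x => by
    refine iSup₂_le fun s hs => ?_
    have hs' := hΛ s hs
    have a1 : ∀ x, ‖act (boxAvg d q s) g x‖ₑ ≤ M h x := enorm_act_boxAvg_le hs' fun x => le_rfl
    have a2 := enorm_act_boxAvg_le (q := q) hs' a1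
    have a3 := enorm_act_boxAvg_le (q := q) hs' a2
    have e : act (smoothStep (boxAvg d q s)) g x =
        (3 : ℂ) * act (boxAvg d q s) (act (boxAvg d q s) g) x -
        (2 : ℂ) * act (boxAvg d q s) (act (boxAvg d q s) (act (boxAvg d q s) g)) x := by
      have : smoothStep (boxAvg d q s) = (3 : ℂ) • (boxAvg d q s * boxAvg d q s) -
          (2 : ℂ) • (boxAvg d q s * (boxAvg d q s * boxAvg d q s)) := by
        simp only [smoothStep, Algebra.smul_def, map_ofNat]; ring
      rw [this, map_sub, sub_apply, lp.coeFn_sub, Pi.sub_apply, act_smul_apply, act_smul_apply]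
      simp only [act_mul_apply]
    rw [e]
    refine enorm_sub_le.trans ?_
    rw [enorm_mul, enorm_mul]
    have c3 : ‖(3 : ℂ)‖ₑ = 3 := by rw [← ofReal_norm]; simp
    have c2 : ‖(2 : ℂ)‖ₑ = 2 := by rw [← ofReal_norm]; simp
    rw [c3, c2]
    exact add_le_add (mul_le_mul le_rfl (a2 x) bot_le bot_le)
      (mul_le_mul le_rfl (a3 x) bot_le bot_le)
  refine (lpNormE_mono (by norm_num) hpt).trans ((lpNormE_add_le (by norm_num) _ _).trans ?_)
  rw [lpNormE_const_mul (by norm_num), lpNormE_const_mul (by norm_num)]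
  have b1 := hC q Λ h hq
  have b2 := (hC q Λ (M h) hq).trans (mul_le_mul le_rfl b1 bot_le bot_le)
  have b3 := (hC q Λ (M (M h)) hq).trans (mul_le_mul le_rfl b2 bot_le bot_le)
  rw [lpNormE_two_enorm] at b2 b3
  push_cast
  rw [add_mul]
  refine add_le_add ?_ ?_
  · calc _ ≤ 3 * (↑C * (↑C * ‖g‖ₑ)) := mul_le_mul le_rfl b2 bot_le bot_le
      _ = _ := by ring
  · calc _ ≤ 2 * (↑C * (↑C * (↑C * ‖g‖ₑ))) := mul_le_mul le_rfl b3 bot_le bot_le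
      _ = _ := by ring

/-- The quadratic exponential kernel `∑_{|m| ≤ M} e(γ m²) δ_{m w}`. -/
def sqKer {d : ℕ} (w : Fin d → ℤ) (γ : ℝ) (M : ℕ) : ConvAlg d :=
  ∑ n ∈ Finset.range (2 * M + 1),
    AddMonoidAlgebra.single (((n : ℤ) - M) • w) (expi (γ * ((n : ℝ) - M) ^ 2))

theorem sqKer_eq_chirp {d : ℕ} (w : Fin d → ℤ) (γ : ℝ) (M : ℕ) :
    sqKer w γ M = AddMonoidAlgebra.single ((-(M : ℤ)) • w) (expi (γ * M ^ 2)) *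
      chirp γ (-2 * γ * M) w (2 * M + 1) := by
  rw [sqKer, chirp, Finset.mul_sum]
  refine Finset.sum_congr rfl fun n _ => ?_
  rw [AddMonoidAlgebra.single_mul_single, ← add_smul, ← expi_add]
  congr 2 <;> ring_nf

theorem nrm_sqKer_le_chirp {d : ℕ} (w : Fin d → ℤ) (γ : ℝ) (M : ℕ) :
    nrm (sqKer w γ M) ≤ nrm (chirp γ (-2 * γ * M) w (2 * M + 1)) := by
  rw [sqKer_eq_chirp]
  have := nrm_mul_le_of_le (nrm_single_le ((-(M : ℤ)) • w) (expi (γ * M ^ 2)))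
    (le_refl (nrm (chirp γ (-2 * γ * M) w (2 * M + 1))))
  rwa [norm_expi, one_mul] at this

theorem nrm_sqKer_le {d : ℕ} (w : Fin d → ℤ) (γ : ℝ) (M : ℕ) :
    nrm (sqKer w γ M) ≤ 2 * M + 1 := by
  refine (nrm_sum_le _ _).trans ((Finset.sum_le_sum fun n _ => (nrm_single_le _ _).trans
    (norm_expi _).le).trans ?_)
  simp

/-- The total mass of `sqKer`. -/
def sqMass (γ : ℝ) (M : ℕ) : ℂ := ∑ n ∈ Finset.range (2 * M + 1), expi (γ * ((n : ℝ) - M) ^ 2)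

theorem norm_sqMass_le_nrm (γ : ℝ) (M : ℕ) :
    ‖sqMass γ M‖ ≤ nrm (sqKer (0 : Fin 0 → ℤ) γ M) := by
  have e : sqKer (0 : Fin 0 → ℤ) γ M = sqMass γ M • 1 := by
    simp only [sqKer, sqMass, smul_zero, AddMonoidAlgebra.one_def, Finset.sum_smul]
    simp
  rw [e, nrm_smul]
  refine le_mul_of_one_le_right (norm_nonneg _) ?_
  have hg : Memℓp (E := fun _ : Fin 0 → ℤ => ℂ) (fun _ => (1 : ℂ)) 2 :=
    memℓp_two_iff.2 (Summable.of_finite)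
  have hne : (⟨_, hg⟩ : SqLat 0) ≠ 0 := fun h => by
    have := congrArg (fun g : SqLat 0 => g 0) h
    simp at this
  have := norm_act_le (1 : ConvAlg 0) ⟨_, hg⟩
  rw [map_one] at this
  have h2 : 0 < ‖(⟨_, hg⟩ : SqLat 0)‖ := norm_pos_iff.2 hne
  by_contra hlt
  push Not at hlt
  have h3 := mul_lt_mul_of_pos_right hlt h2
  rw [one_mul] at h3
  exact absurd (lt_of_le_of_lt this h3) (lt_irrefl _)

theorem nrm_sqKer_mul_one_sub_le {d : ℕ} (q : ℕ) (i : Fin d) (γ : ℝ) (M : ℕ) :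
    nrm (sqKer (Pi.single i (q : ℤ)) γ M * (1 - stepBy q i 1)) ≤ 2 + 28 * |γ| * M ^ 2 := by
  set c : ℕ → ℂ := fun n => expi (γ * ((n : ℝ) - M) ^ 2) with hc
  set w : Fin d → ℤ := Pi.single i (q : ℤ) with hw
  set E : ℕ → Fin d → ℤ := fun n => ((n : ℤ) - M) • w with hE
  have e : sqKer w γ M * (1 - stepBy q i 1) =
      ∑ n ∈ Finset.range (2 * M), AddMonoidAlgebra.single (E (n + 1)) (c (n + 1) - c n) +
        (AddMonoidAlgebra.single (E 0) (c 0) -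
          AddMonoidAlgebra.single (E (2 * M + 1)) (c (2 * M))) := by
    have e1 : sqKer w γ M = ∑ n ∈ Finset.range (2 * M),
        AddMonoidAlgebra.single (E (n + 1)) (c (n + 1)) + AddMonoidAlgebra.single (E 0) (c 0) := by
      rw [sqKer, Finset.sum_range_succ']
    have e2 : sqKer w γ M * stepBy q i 1 = ∑ n ∈ Finset.range (2 * M),
        AddMonoidAlgebra.single (E (n + 1)) (c n) +
          AddMonoidAlgebra.single (E (2 * M + 1)) (c (2 * M)) := by
      rw [← Finset.sum_range_succ (fun n => (AddMonoidAlgebra.single (E (n + 1)) (c n) : ConvAlg d)),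
        sqKer, Finset.sum_mul]
      refine Finset.sum_congr rfl fun n _ => ?_
      rw [stepBy, AddMonoidAlgebra.single_mul_single, mul_one, ← add_smul]
      simp only [hE]
      congr 2
      push_cast; ring
    rw [mul_sub, mul_one, e2, e1]
    simp only [AddMonoidAlgebra.single_sub, Finset.sum_sub_distrib]
    ring
  have hb : ∀ n ∈ Finset.range (2 * M), nrm (AddMonoidAlgebra.single (E (n + 1)) (c (n + 1) - c n))
      ≤ 7 * (|γ| * (2 * M)) := fun n hn => by
    refine (nrm_single_le _ _).trans ((norm_expi_sub_expi_le _ _).trans ?_)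
    rw [← mul_sub, abs_mul]
    have h2 : |((↑(n + 1) : ℝ) - M) ^ 2 - ((n : ℝ) - M) ^ 2| ≤ 2 * M := by
      have : (n : ℝ) + 1 ≤ 2 * M := by exact_mod_cast Finset.mem_range.1 hn
      have h0 : (0 : ℝ) ≤ n := Nat.cast_nonneg _
      push_cast
      rw [abs_le]; constructor <;> nlinarith
    have := mul_le_mul_of_nonneg_left h2 (abs_nonneg γ)
    linarith
  rw [e]
  refine (nrm_add_le _ _).trans ?_
  have h1 := (nrm_sum_le (Finset.range (2 * M)) _).trans (Finset.sum_le_sum hb)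
  have h2 := nrm_sub_le (AddMonoidAlgebra.single (E 0) (c 0) : ConvAlg d)
    (AddMonoidAlgebra.single (E (2 * M + 1)) (c (2 * M)))
  have h3 := nrm_single_le (E 0) (c 0)
  have h4 := nrm_single_le (E (2 * M + 1)) (c (2 * M))
  simp only [hc, norm_expi] at h3 h4
  simp only [Finset.sum_const, Finset.card_range, nsmul_eq_mul] at h1
  push_cast at h1
  simp only [hc] at *
  nlinarith

theorem nrm_mul_one_sub_stepBy_le {d : ℕ} (A : ConvAlg d) (q : ℕ) (i : Fin d) (n : ℕ) :
    nrm (A * (1 - stepBy q i n)) ≤ n * nrm (A * (1 - stepBy q i 1)) := by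
  induction n with
  | zero => simp [stepBy_zero, nrm_zero]
  | succ n ih =>
    have e : A * (1 - stepBy q i (n + 1 : ℕ)) =
        A * (1 - stepBy q i n) + stepBy q i n * (A * (1 - stepBy q i 1)) := by
      push_cast; rw [stepBy_add]; ring
    rw [e]
    have := nrm_mul_le_of_le (nrm_stepBy_le q i (n : ℤ)) (le_refl (nrm (A * (1 - stepBy q i 1))))
    refine (nrm_add_le _ _).trans ?_
    push_cast
    linarith

theorem nrm_mul_one_sub_dyadicAvg_le {d : ℕ} (A : ConvAlg d) (q : ℕ) (i : Fin d) (l : ℕ) :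
    nrm (A * (1 - dyadicAvg q i l)) ≤ 2 ^ l * nrm (A * (1 - stepBy q i 1)) := by
  have e : A * (1 - dyadicAvg q i l) =
      ((2 : ℂ) ^ l)⁻¹ • ∑ n ∈ Finset.range (2 ^ l), A * (1 - stepBy q i n) := by
    rw [← Finset.mul_sum, Finset.sum_sub_distrib, dyadicAvg_eq]
    simp only [Finset.sum_const, Finset.card_range, mul_sub, smul_sub, mul_one]
    congr 1
    · rw [← Nat.cast_smul_eq_nsmul ℂ, mul_smul_comm, mul_one, smul_smul]
      push_cast
      rw [inv_mul_cancel₀ (pow_ne_zero _ two_ne_zero), one_smul]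
    · rw [mul_smul_comm]
  rw [e, nrm_smul, norm_inv, norm_pow, Complex.norm_ofNat, inv_mul_le_iff₀ (by positivity)]
  have hN := nrm_nonneg (A * (1 - stepBy q i 1))
  have h : ∑ n ∈ Finset.range (2 ^ l), nrm (A * (1 - stepBy q i (n : ℤ))) ≤
      ∑ n ∈ Finset.range (2 ^ l), (2 : ℝ) ^ l * nrm (A * (1 - stepBy q i 1)) :=
    Finset.sum_le_sum fun n hn => (nrm_mul_one_sub_stepBy_le A q i n).trans
      (mul_le_mul_of_nonneg_right (by exact_mod_cast (Finset.mem_range.1 hn).le) hN)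
  refine (nrm_sum_le _ _).trans (h.trans ?_)
  simp

theorem nrm_one_sub_stepBy_mul_dyadicAvg_le {d : ℕ} (q : ℕ) (i : Fin d) (l : ℕ) (n : ℤ) :
    nrm (dyadicAvg q i l * (1 - stepBy q i n)) ≤ |(n : ℝ)| * (2 / 2 ^ l) := by
  have h1 : nrm (dyadicAvg q i l * (1 - stepBy q i 1)) ≤ 2 / 2 ^ l := by
    have e : dyadicAvg q i l * (1 - stepBy q i 1) = ((2 : ℂ) ^ l)⁻¹ • (1 - stepBy q i (2 ^ l : ℕ)) := by
      rw [dyadicAvg_eq, smul_mul_assoc, Finset.sum_mul]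
      have : ∀ n : ℕ, stepBy q i (n : ℤ) * (1 - stepBy q i 1) =
          stepBy q i (n : ℤ) - stepBy q i ((n + 1 : ℕ) : ℤ) := fun n => by
        push_cast; rw [stepBy_add]; ring
      simp_rw [this]
      rw [Finset.sum_range_sub' (fun n : ℕ => stepBy q i (n : ℤ)), Nat.cast_zero, stepBy_zero]
    rw [e, nrm_smul, norm_inv, norm_pow, Complex.norm_ofNat, inv_mul_eq_div]
    gcongr
    refine (nrm_sub_le _ _).trans ?_
    linarith [nrm_one_le (d := d), nrm_stepBy_le q i (2 ^ l : ℕ)]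
  have h2 : ∀ n : ℕ, nrm (dyadicAvg q i l * (1 - stepBy q i n)) ≤ n * (2 / 2 ^ l) := fun n =>
    (nrm_mul_one_sub_stepBy_le _ q i n).trans (mul_le_mul_of_nonneg_left h1 (Nat.cast_nonneg _))
  obtain ⟨m, rfl | rfl⟩ := n.eq_nat_or_neg
  · simpa using h2 m
  · have e : dyadicAvg q i l * (1 - stepBy q i (-m)) =
        stepBy q i (-m) * ((-1 : ℂ) • (dyadicAvg q i l * (1 - stepBy q i m))) := by
      have : stepBy q i (-m) * stepBy q i m = 1 := by rw [← stepBy_add]; simp [stepBy_zero]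
      rw [neg_one_smul]
      linear_combination (-dyadicAvg q i l) * this
    rw [e]
    have h3 := nrm_mul_le_of_le (nrm_stepBy_le q i (-m))
      (le_refl (nrm ((-1 : ℂ) • (dyadicAvg q i l * (1 - stepBy q i m)))))
    rw [nrm_smul] at h3
    simp only [norm_neg, norm_one, one_mul] at h3
    simpa using h3.trans (h2 m)

theorem nrm_sqKer_sub_mass_mul_le {d : ℕ} (q : ℕ) (i : Fin d) (γ : ℝ) (M l : ℕ) :
    nrm ((sqKer (Pi.single i (q : ℤ)) γ M - sqMass γ M • 1) * dyadicAvg q i l) ≤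
      (2 * M + 1) * (M * (2 / 2 ^ l)) := by
  have e : (sqKer (Pi.single i (q : ℤ)) γ M - sqMass γ M • 1) * dyadicAvg q i l =
      ∑ n ∈ Finset.range (2 * M + 1), (-expi (γ * ((n : ℝ) - M) ^ 2)) •
        (dyadicAvg q i l * (1 - stepBy q i ((n : ℤ) - M))) := by
    rw [sqKer, sqMass, Finset.sum_smul, ← Finset.sum_sub_distrib, Finset.sum_mul]
    refine Finset.sum_congr rfl fun n _ => ?_
    have : (AddMonoidAlgebra.single (((n : ℤ) - M) • Pi.single i (q : ℤ))
        (expi (γ * ((n : ℝ) - M) ^ 2)) : ConvAlg d) =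
        expi (γ * ((n : ℝ) - M) ^ 2) • stepBy q i ((n : ℤ) - M) := by
      rw [stepBy, AddMonoidAlgebra.smul_single, smul_eq_mul, mul_one]
    rw [this]
    simp only [Algebra.smul_def, map_neg]
    ring
  rw [e]
  have h : ∀ n ∈ Finset.range (2 * M + 1), nrm ((-expi (γ * ((n : ℝ) - M) ^ 2)) •
        (dyadicAvg q i l * (1 - stepBy q i ((n : ℤ) - M)))) ≤ M * (2 / 2 ^ l) := fun n hn => by
    rw [nrm_smul, norm_neg, norm_expi, one_mul]
    refine (nrm_one_sub_stepBy_mul_dyadicAvg_le _ _ _ _).trans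
      (mul_le_mul_of_nonneg_right ?_ (by positivity))
    have h1 : (n : ℝ) < 2 * M + 1 := by exact_mod_cast Finset.mem_range.1 hn
    have h2 : n ≤ 2 * M := by have := Finset.mem_range.1 hn; omega
    have h3 : (n : ℝ) ≤ 2 * M := by exact_mod_cast h2
    push_cast
    rw [abs_le]; constructor <;> linarith [(Nat.cast_nonneg n : (0 : ℝ) ≤ n)]
  refine (nrm_sum_le _ _).trans ((Finset.sum_le_sum h).trans ?_)
  simp

theorem lpNormE_iSup_le_of_sum_sq {d : ℕ} (S : Finset ℕ) (g : ℕ → SqLat d) {K : ℝ} (hK : 0 ≤ K)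
    (h : ∑ s ∈ S, ‖g s‖ ^ 2 ≤ K ^ 2) :
    lpNormE d 2 (fun x => ⨆ s ∈ S, ‖g s x‖ₑ) ≤ ENNReal.ofReal K := by
  have h1 : ∑' x, (⨆ s ∈ S, ‖g s x‖ₑ) ^ (2 : ℝ) ≤ ENNReal.ofReal K ^ (2 : ℝ) := by
    calc ∑' x, (⨆ s ∈ S, ‖g s x‖ₑ) ^ (2 : ℝ) ≤ ∑' x, ∑ s ∈ S, ‖g s x‖ₑ ^ (2 : ℝ) := by
          refine ENNReal.tsum_le_tsum fun x => ?_
          rw [← ENNReal.le_rpow_inv_iff (by norm_num)]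
          refine iSup₂_le fun s hs => ?_
          rw [ENNReal.le_rpow_inv_iff (by norm_num)]
          exact Finset.single_le_sum (f := fun s => ‖g s x‖ₑ ^ (2 : ℝ)) (fun _ _ => bot_le) hs
      _ = ∑ s ∈ S, ∑' x, ‖g s x‖ₑ ^ (2 : ℝ) := Summable.tsum_finsetSum fun _ _ => ENNReal.summable
      _ = ∑ s ∈ S, ENNReal.ofReal (‖g s‖ ^ 2) := by
          refine Finset.sum_congr rfl fun s _ => ?_
          have := lpNormE_rpow (d := d) (r := 2) (by norm_num) (fun x => ‖g s x‖ₑ)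
          rw [lpNormE_two_enorm] at this
          rw [← this, ← ofReal_norm, ENNReal.ofReal_rpow_of_nonneg (norm_nonneg _) (by norm_num),
            Real.rpow_two]
      _ = ENNReal.ofReal (∑ s ∈ S, ‖g s‖ ^ 2) := by
          rw [ENNReal.ofReal_sum_of_nonneg fun s _ => by positivity]
      _ ≤ ENNReal.ofReal (K ^ 2) := ENNReal.ofReal_le_ofReal h
      _ = _ := by rw [ENNReal.ofReal_rpow_of_nonneg hK (by norm_num), Real.rpow_two]
  rw [lpNormE, one_div]
  exact (ENNReal.rpow_inv_le_iff (by norm_num)).2 h1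

theorem exists_nrm_sqKer_le {ε : ℝ} (h0 : 0 < ε) (h1 : ε < 1) : ∃ C : ℝ, 1 ≤ C ∧
    ∀ (d j M : ℕ) (γ : ℝ) (w : Fin d → ℤ), 4 * |γ| * (2 * M + 1) ≤ 1 →
      (j = 0 ∨ 2 ^ j ≤ (2 * M + 1) ^ 2 * |γ|) →
      nrm (sqKer w γ M) ≤ C * (2 * M + 1) * ((2 : ℝ) ^ j) ^ ((ε - 1) / 2) := by
  obtain ⟨C, hC, H⟩ := nrm_chirp_weyl h0 h1 (c₀ := 1) one_pos
  refine ⟨C + 1, by linarith, fun d j M γ w hγ hj => (nrm_sqKer_le_chirp w γ M).trans ?_⟩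
  have := H d (2 * M + 1) 1 0 γ (2 ^ j) (-2 * γ * M) w (by omega) le_rfl (by simp)
    (by push_cast; linarith) (by push_cast; linarith [(Nat.cast_nonneg M : (0 : ℝ) ≤ M)])
    (one_le_pow₀ (by norm_num)) (by
      rcases hj with h | h
      · left; simp [h]
      · right; push_cast; linarith)
  simp only [Nat.cast_zero, zero_div, zero_add, Nat.cast_one, one_mul] at this
  refine this.trans ?_
  push_cast
  gcongr
  linarith

theorem le_rpow_mul_rpow_of_le {x a b ε : ℝ} (h0 : 0 ≤ ε) (h1 : ε ≤ 1) (ha : x ≤ a)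
    (hb : x ≤ b) (ha0 : 0 ≤ a) (hb0 : 0 ≤ b) : x ≤ a ^ (1 - ε) * b ^ ε := by
  rcases le_total x 0 with hx | hx
  · exact hx.trans (by positivity)
  · calc x = x ^ (1 - ε) * x ^ ε := by
          rw [← Real.rpow_add_of_nonneg hx (by linarith) h0]; simp
      _ ≤ _ := mul_le_mul (Real.rpow_le_rpow hx ha (by linarith)) (Real.rpow_le_rpow hx hb h0)
          (by positivity) (by positivity)

theorem lpNormE_iSup_sqKer_step (d : ℕ) {η : ℝ} (hη : 0 < η) (hη1 : η < 1) : ∃ C : ℝ, 0 < C ∧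
    ∀ (q j : ℕ) (S : Finset ℕ) (M : ℕ → ℕ) (γ : ℕ → ℝ), 1 ≤ q → (∀ s ∈ S, M s ≤ 2 ^ (s + 1)) →
      (∀ s ∈ S, 4 * |γ s| * (2 * M s + 1) ≤ 1) → (∀ s ∈ S, |γ s| * M s ^ 2 ≤ 4 * 2 ^ j) →
      (∀ s ∈ S, j = 0 ∨ 2 ^ j ≤ (2 * (M s : ℝ) + 1) ^ 2 * |γ s|) → ∀ g : SqLat d,
      lpNormE d 2 (fun x => ⨆ s ∈ S, ‖act (∏ i, ((2 : ℂ) ^ s)⁻¹ •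
        sqKer (Pi.single i (q : ℤ)) (γ s) (M s)) g x‖ₑ) ≤
        ENNReal.ofReal (C * ((2 : ℝ) ^ j) ^ (η - d / 2)) * ‖g‖ₑ := by
  set ε := η / (d + 1) with hε
  have hd1 : (0 : ℝ) < d + 1 := by positivity
  have hε0 : 0 < ε := by positivity
  have hε1 : ε < 1 := by
    rw [hε, div_lt_one hd1]; linarith [(Nat.cast_nonneg d : (0 : ℝ) ≤ d)]
  obtain ⟨C₀, hC₀, hW⟩ := exists_nrm_sqKer_le hε0 hε1
  obtain ⟨Cs, hCs⟩ := lpNormE_iSup_smoothStep d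
  set C₁ := 5 * C₀ with hC₁
  have hC₁' : 0 < C₁ := by linarith
  set C₂ : ℝ := 5 ^ d * (d + 1) * 114 with hC₂
  have hC₂' : 0 < C₂ := by positivity
  set ρ : ℝ := (1 / 2 : ℝ) ^ ε with hρ
  have hρ1 : ρ < 1 := Real.rpow_lt_one (by norm_num) (by norm_num) hε0
  have hρh : 1 / 2 ≤ ρ := by
    have := Real.rpow_le_rpow_of_exponent_ge (x := (1 / 2 : ℝ)) (by norm_num) (by norm_num) hε1.le
    rwa [Real.rpow_one] at this
  set Kc : ℝ := (2 * C₁ ^ d) ^ (1 - ε) * C₂ ^ ε with hKc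
  have hKc0 : 0 < Kc := by positivity
  set A : ℝ := 58 * Kc / (1 - ρ) * (d + 1) with hA
  have h1ρ : 0 < 1 - ρ := by linarith
  have hA0 : 0 < A := by positivity
  refine ⟨A + Cs * C₁ ^ d, by positivity, fun q j S M γ hq hM hγ hγ2 hj g => ?_⟩
  set J : ℝ := 2 ^ j with hJ
  have hJ1 : 1 ≤ J := one_le_pow₀ (by norm_num)
  have hJ0 : 0 < J := by linarith
  set D : ℝ := (C₁ * J ^ ((ε - 1) / 2)) ^ d with hD
  have hD0 : 0 < D := by positivity
  have hDle : D ≤ C₁ ^ d * J ^ (η - d / 2) := by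
    rw [hD, mul_pow, ← Real.rpow_natCast (J ^ ((ε - 1) / 2)), ← Real.rpow_mul hJ0.le]
    refine mul_le_mul_of_nonneg_left (Real.rpow_le_rpow_of_exponent_le hJ1 ?_) (by positivity)
    have : ε * (d + 1) = η := by rw [hε]; field_simp
    nlinarith [(Nat.cast_nonneg d : (0 : ℝ) ≤ d)]
  have hexp : (2 * D) ^ (1 - ε) * (C₂ * J) ^ ε ≤ Kc * J ^ (η - d / 2) := by
    have e : (2 * D) ^ (1 - ε) * (C₂ * J) ^ ε =
        Kc * J ^ ((ε - 1) / 2 * d * (1 - ε) + ε) := by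
      rw [hD, mul_pow, ← Real.rpow_natCast (J ^ ((ε - 1) / 2)), ← Real.rpow_mul hJ0.le, ← mul_assoc,
        Real.mul_rpow (by positivity) (by positivity), Real.mul_rpow hC₂'.le hJ0.le,
        ← Real.rpow_mul hJ0.le, hKc, Real.rpow_add hJ0]
      ring
    rw [e]
    refine mul_le_mul_of_nonneg_left (Real.rpow_le_rpow_of_exponent_le hJ1 ?_) hKc0.le
    have : ε * (d + 1) = η := by rw [hε]; field_simp
    nlinarith [(Nat.cast_nonneg d : (0 : ℝ) ≤ d), mul_nonneg (Nat.cast_nonneg d : (0 : ℝ) ≤ d) (sq_nonneg ε)]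
  set k : ℕ → Fin d → ConvAlg d := fun s i =>
    ((2 : ℂ) ^ s)⁻¹ • sqKer (Pi.single i (q : ℤ)) (γ s) (M s) with hk
  set σ₁ : ℕ → ℂ := fun s => ((2 : ℂ) ^ s)⁻¹ * sqMass (γ s) (M s) with hσ₁
  have hMs : ∀ s ∈ S, (2 * M s + 1 : ℝ) ≤ 5 * 2 ^ s := fun s hs => by
    have h2 : (M s : ℝ) ≤ 2 ^ (s + 1) := by exact_mod_cast hM s hs
    have h3 : (1 : ℝ) ≤ 2 ^ s := one_le_pow₀ (by norm_num)
    rw [pow_succ] at h2; linarith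
  have hn2 : ∀ s : ℕ, ‖((2 : ℂ) ^ s)⁻¹‖ = ((2 : ℝ) ^ s)⁻¹ := fun s => by
    rw [norm_inv, norm_pow, Complex.norm_ofNat]
  have hkn : ∀ s ∈ S, ∀ i, nrm (k s i) ≤ C₁ * J ^ ((ε - 1) / 2) := fun s hs i => by
    rw [hk, nrm_smul, hn2, inv_mul_le_iff₀ (by positivity)]
    refine (hW d j (M s) (γ s) _ (hγ s hs) (hj s hs)).trans ?_
    have := mul_le_mul_of_nonneg_left (hMs s hs) (show 0 ≤ C₀ * J ^ ((ε - 1) / 2) by positivity)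
    rw [hC₁]; linarith
  have hσn : ∀ s ∈ S, ‖σ₁ s‖ ≤ C₁ * J ^ ((ε - 1) / 2) := fun s hs => by
    rw [hσ₁, norm_mul, hn2, inv_mul_le_iff₀ (by positivity)]
    refine (norm_sqMass_le_nrm _ _).trans ((hW 0 j (M s) (γ s) _ (hγ s hs) (hj s hs)).trans ?_)
    have := mul_le_mul_of_nonneg_left (hMs s hs) (show 0 ≤ C₀ * J ^ ((ε - 1) / 2) by positivity)
    rw [hC₁]; linarith
  have hk5 : ∀ s ∈ S, ∀ i, nrm (k s i) ≤ 5 := fun s hs i => by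
    rw [hk, nrm_smul, hn2, inv_mul_le_iff₀ (by positivity)]
    exact (nrm_sqKer_le _ _ _).trans (by linarith [hMs s hs])
  have hσ5 : ∀ s ∈ S, ‖σ₁ s‖ ≤ 5 := fun s hs => by
    rw [hσ₁, norm_mul, hn2, inv_mul_le_iff₀ (by positivity)]
    exact (norm_sqMass_le_nrm _ _).trans ((nrm_sqKer_le _ _ _).trans (by linarith [hMs s hs]))
  have hHD : ∀ s ∈ S, nrm (∏ i, k s i) ≤ D := fun s hs =>
    (nrm_prod_le _ _).trans ((Finset.prod_le_prod (fun _ _ => nrm_nonneg _)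
      fun i _ => hkn s hs i).trans (by simp [hD]))
  have hσD : ∀ s ∈ S, ‖σ₁ s ^ d‖ ≤ D := fun s hs => by
    rw [norm_pow]; exact pow_le_pow_left₀ (norm_nonneg _) (hσn s hs) d
  have hinterp : ∀ (x : ℝ) (m : ℕ), x ≤ 2 * D → x ≤ C₂ * J * (1 / 2) ^ m →
      x ≤ (Kc * J ^ (η - d / 2)) * ρ ^ m := fun x m hx1 hx2 => by
    refine (le_rpow_mul_rpow_of_le hε0.le hε1.le hx1 hx2 (by positivity) (by positivity)).trans ?_
    rw [Real.mul_rpow (x := C₂ * J) (by positivity) (by positivity), ← mul_assoc,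
      ← Real.rpow_natCast_mul (by norm_num), mul_comm (m : ℝ) ε, Real.rpow_mul_natCast (by norm_num)]
    exact mul_le_mul_of_nonneg_right hexp (by positivity)
  have hU : ∀ s ∈ S, ∀ l ≤ s, nrm ((∏ i, k s i) * (1 - boxAvg d q l)) ≤
      (Kc * J ^ (η - d / 2)) * ρ ^ (s - l) := by
    intro s hs l hl
    apply hinterp
    · have h1 : nrm (1 - boxAvg d q l) ≤ 2 :=
        (nrm_sub_le _ _).trans (by linarith [nrm_one_le (d := d), nrm_boxAvg_le d q l])
      have := nrm_mul_le_of_le (hHD s hs) h1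
      linarith
    · have h1 : ∀ i, nrm ((∏ i, k s i) * (1 - dyadicAvg q i l)) ≤
          5 ^ d * (114 * J * (1 / 2) ^ (s - l)) := fun i => by
        rw [← Finset.mul_prod_erase _ _ (Finset.mem_univ i), mul_comm (k s i), mul_assoc]
        refine nrm_mul_le_of_le ?_ ?_
        · refine (nrm_prod_le _ _).trans ((Finset.prod_le_prod (fun _ _ => nrm_nonneg _)
            fun i _ => hk5 s hs i).trans ?_)
          rw [Finset.prod_const]
          exact pow_le_pow_right₀ (by norm_num) ((Finset.card_le_univ _).trans (by simp))
        · refine (nrm_mul_one_sub_dyadicAvg_le _ _ _ _).trans ?_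
          rw [hk, smul_mul_assoc, nrm_smul, hn2]
          have h2 := nrm_sqKer_mul_one_sub_le q i (γ s) (M s)
          have h3 := hγ2 s hs
          have h4 : nrm (sqKer (Pi.single i (q : ℤ)) (γ s) (M s) * (1 - stepBy q i 1)) ≤ 114 * J := by
            linarith
          have h5 : (1 / 2 : ℝ) ^ (s - l) = 2 ^ l * ((2 : ℝ) ^ s)⁻¹ := by
            rw [one_div, inv_pow, pow_sub₀ _ two_ne_zero hl, mul_inv, inv_inv, mul_comm]
          rw [h5, ← mul_assoc, mul_comm (114 * J)]
          exact mul_le_mul_of_nonneg_left h4 (by positivity)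
      refine (nrm_mul_one_sub_prod_le _ (fun i => nrm_dyadicAvg_le q i l) _).trans
        ((Finset.sum_le_sum fun i _ => h1 i).trans ?_)
      rw [Finset.sum_const, Finset.card_univ, Fintype.card_fin, nsmul_eq_mul, hC₂]
      have : 0 ≤ (5 : ℝ) ^ d * (114 * J * (1 / 2) ^ (s - l)) := by positivity
      linarith
  have hV : ∀ s ∈ S, ∀ l, s ≤ l → nrm (((∏ i, k s i) - σ₁ s ^ d • 1) * boxAvg d q l) ≤
      (Kc * J ^ (η - d / 2)) * ρ ^ (l - s) := by
    intro s hs l hl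
    apply hinterp
    · have h1 : nrm ((∏ i, k s i) - σ₁ s ^ d • 1) ≤ 2 * D := by
        refine (nrm_sub_le _ _).trans ?_
        rw [nrm_smul]
        have := mul_le_mul (hσD s hs) (nrm_one_le (d := d)) (nrm_nonneg _) hD0.le
        linarith [hHD s hs]
      have := nrm_mul_le_of_le h1 (nrm_boxAvg_le d q l)
      linarith
    · have e : ((∏ i, k s i) - σ₁ s ^ d • 1) * boxAvg d q l =
          ∏ i, (k s i * dyadicAvg q i l) - ∏ i : Fin d, (σ₁ s • dyadicAvg q i l) := by
        rw [boxAvg, sub_mul, ← Finset.prod_mul_distrib]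
        simp_rw [Algebra.smul_def]
        rw [Finset.prod_mul_distrib (f := fun _ => algebraMap ℂ (ConvAlg d) (σ₁ s)), Finset.prod_const, map_pow]
        simp
      have h1 : ∀ i, nrm (k s i * dyadicAvg q i l - σ₁ s • dyadicAvg q i l) ≤
          20 * (1 / 2) ^ (l - s) := fun i => by
        have e2 : k s i * dyadicAvg q i l - σ₁ s • dyadicAvg q i l = ((2 : ℂ) ^ s)⁻¹ •
            ((sqKer (Pi.single i (q : ℤ)) (γ s) (M s) - sqMass (γ s) (M s) • 1) *
              dyadicAvg q i l) := by
          simp only [hk, hσ₁, Algebra.smul_def, map_mul]; ring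
        rw [e2, nrm_smul, hn2]
        have h2 := nrm_sqKer_sub_mass_mul_le q i (γ s) (M s) l
        have h3 : (M s : ℝ) ≤ 2 * 2 ^ s := by
          have : (M s : ℝ) ≤ 2 ^ (s + 1) := by exact_mod_cast hM s hs
          rw [pow_succ] at this; linarith
        have h4 : (2 * (M s : ℝ) + 1) * (M s * (2 / 2 ^ l)) ≤
            (5 * 2 ^ s) * ((2 * 2 ^ s) * (2 / 2 ^ l)) :=
          mul_le_mul (hMs s hs) (mul_le_mul_of_nonneg_right h3 (by positivity)) (by positivity)
            (by positivity)
        rw [inv_mul_le_iff₀ (by positivity)]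
        refine (h2.trans h4).trans (le_of_eq ?_)
        rw [one_div, inv_pow, pow_sub₀ _ two_ne_zero hl]
        field_simp
        norm_num
      rw [e]
      refine (nrm_prod_sub_prod_le _ (B := 5) (by norm_num) (fun i => ?_) (fun i => ?_)).trans ?_
      · have := nrm_mul_le_of_le (hk5 s hs i) (nrm_dyadicAvg_le q i l); linarith
      · rw [nrm_smul]
        have := mul_le_mul (hσ5 s hs) (nrm_dyadicAvg_le q i l) (nrm_nonneg _) (by norm_num)
        linarith
      · rw [Finset.card_univ, Fintype.card_fin, hC₂]
        have h2 := Finset.sum_le_sum fun (i : Fin d) (_ : i ∈ Finset.univ) => h1 i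
        rw [Finset.sum_const, Finset.card_univ, Fintype.card_fin, nsmul_eq_mul] at h2
        have h3 : (0 : ℝ) ≤ (1 / 2) ^ (l - s) := by positivity
        calc (5 : ℝ) ^ d * _ ≤ 5 ^ d * (d * (20 * (1 / 2) ^ (l - s))) :=
              mul_le_mul_of_nonneg_left h2 (by positivity)
          _ ≤ 5 ^ d * ((d + 1) * (114 * (1 / 2) ^ (l - s))) := by gcongr <;> linarith
          _ = 5 ^ d * (d + 1) * 114 * 1 * (1 / 2) ^ (l - s) := by ring
          _ ≤ 5 ^ d * (d + 1) * 114 * J * (1 / 2) ^ (l - s) := by gcongr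
  have hmain := sum_norm_sq_act_sub_le hρh hρ1 (by positivity) (boxAvg_zero d q) (nrm_boxAvg_le d q)
    (fun N g => sum_norm_sq_boxAvg_sub_le d q N g) S (fun s => ∏ i, k s i) (fun s => σ₁ s ^ d) hU hV g
  have hfirst := lpNormE_iSup_le_of_sum_sq S
    (fun s => act ((∏ i, k s i) - σ₁ s ^ d • smoothStep (boxAvg d q s)) g)
    (K := A * J ^ (η - d / 2) * ‖g‖) (by positivity) (by
      refine hmain.trans ?_
      rw [mul_pow]
      refine mul_le_mul_of_nonneg_right ?_ (sq_nonneg _)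
      have e : A * J ^ (η - d / 2) = 58 * (Kc * J ^ (η - d / 2)) / (1 - ρ) * (d + 1) := by
        rw [hA]; ring
      rw [e, mul_pow]
      refine mul_le_mul_of_nonneg_left ?_ (sq_nonneg _)
      nlinarith [(Nat.cast_nonneg d : (0 : ℝ) ≤ d)])
  have hpt : ∀ x, (⨆ s ∈ S, ‖act (∏ i, k s i) g x‖ₑ) ≤
      (⨆ s ∈ S, ‖act ((∏ i, k s i) - σ₁ s ^ d • smoothStep (boxAvg d q s)) g x‖ₑ) +
        ENNReal.ofReal D * ⨆ s ∈ S, ‖act (smoothStep (boxAvg d q s)) g x‖ₑ := fun x => by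
    refine iSup₂_le fun s hs => ?_
    have e : act (∏ i, k s i) g x =
        act ((∏ i, k s i) - σ₁ s ^ d • smoothStep (boxAvg d q s)) g x +
          σ₁ s ^ d * act (smoothStep (boxAvg d q s)) g x := by
      rw [← act_smul_apply, ← Pi.add_apply, ← lp.coeFn_add, ← add_apply, ← map_add, sub_add_cancel]
    rw [e]
    refine (enorm_add_le _ _).trans (add_le_add ?_ ?_)
    · exact le_iSup₂ (f := fun s (_ : s ∈ S) =>
        ‖act ((∏ i, k s i) - σ₁ s ^ d • smoothStep (boxAvg d q s)) g x‖ₑ) s hs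
    · rw [enorm_mul]
      refine mul_le_mul ?_ (le_iSup₂ (f := fun s (_ : s ∈ S) =>
        ‖act (smoothStep (boxAvg d q s)) g x‖ₑ) s hs) bot_le bot_le
      rw [← ofReal_norm]
      exact ENNReal.ofReal_le_ofReal (hσD s hs)
  refine (lpNormE_mono (by norm_num) hpt).trans ((lpNormE_add_le (by norm_num) _ _).trans ?_)
  rw [lpNormE_const_mul (by norm_num), add_mul, ENNReal.ofReal_add (by positivity) (by positivity),
    add_mul]
  refine add_le_add ?_ ?_
  · rw [ENNReal.ofReal_mul (by positivity), ofReal_norm] at hfirst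
    exact hfirst
  · calc ENNReal.ofReal D * _ ≤ ENNReal.ofReal (C₁ ^ d * J ^ (η - d / 2)) * (Cs * ‖g‖ₑ) :=
          mul_le_mul (ENNReal.ofReal_le_ofReal hDle) (hCs q S g hq) bot_le bot_le
      _ = _ := by
          rw [mul_assoc (Cs : ℝ), ENNReal.ofReal_mul Cs.coe_nonneg, ENNReal.ofReal_coe_nnreal]
          ring

/-- The frequency offset `β` lies at distance about `2^j / 4^k` from a fraction with
denominator `q`. -/
structure IsOffset (q j k : ℕ) (β : ℝ) : Prop where
  small : |β| * (8 * q * (2 ^ (k + 2) + 1)) ≤ 1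
  den : (q : ℝ) ≤ 16 * (2 ^ (k + 2) + 1)
  le : |β| * 4 ^ k ≤ 2 ^ j
  ge : j = 0 ∨ (2 : ℝ) ^ j ≤ 2 * 4 ^ k * |β|

/-- The normalized box kernel with quadratic phase `θ |v|²` at scale `2^k`. -/
def boxKer (d : ℕ) (θ : ℝ) (k : ℕ) : ConvAlg d :=
  ∏ i : Fin d, ((2 : ℂ) ^ k)⁻¹ • sqKer (Pi.single i (1 : ℤ)) θ (2 ^ (k + 1))

theorem norm_two_pow_inv (s : ℕ) : ‖((2 : ℂ) ^ s)⁻¹‖ = ((2 : ℝ) ^ s)⁻¹ := by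
  rw [norm_inv, norm_pow, Complex.norm_ofNat]

theorem exists_nrm_boxKer_le (d : ℕ) {η : ℝ} (hη : 0 < η) (hη1 : η < 1) : ∃ C : ℝ, 0 < C ∧
    ∀ (q a j k : ℕ) (β : ℝ), 1 ≤ q → Nat.Coprime a q → IsOffset q j k β →
      nrm (boxKer d ((a : ℝ) / q + β) k) ≤ C * ((q : ℝ) * 2 ^ j) ^ (η - d / 2) := by
  set ε := η / (d + 1) with hε
  have hd1 : (0 : ℝ) < d + 1 := by positivity
  have hd0 : (0 : ℝ) ≤ d := Nat.cast_nonneg d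
  have hε0 : 0 < ε := by positivity
  have hε1 : ε < 1 := by
    rw [hε, div_lt_one hd1]; linarith
  obtain ⟨C, hC, H⟩ := nrm_chirp_weyl hε0 hε1 (c₀ := 1) one_pos
  refine ⟨(5 * C) ^ d, by positivity, fun q a j k β hq ha hβ => ?_⟩
  set X : ℝ := q * 2 ^ j with hX
  have hq1 : (1 : ℝ) ≤ q := by exact_mod_cast hq
  have hJ1 : (1 : ℝ) ≤ 2 ^ j := one_le_pow₀ (by norm_num)
  have hX1 : 1 ≤ X := one_le_mul_of_one_le_of_one_le hq1 hJ1
  have h1 : ∀ i : Fin d, nrm (((2 : ℂ) ^ k)⁻¹ • sqKer (Pi.single i (1 : ℤ)) ((a : ℝ) / q + β)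
      (2 ^ (k + 1))) ≤ 5 * C * X ^ ((ε - 1) / 2) := fun i => by
    rw [nrm_smul, norm_two_pow_inv, inv_mul_le_iff₀ (by positivity)]
    refine (nrm_sqKer_le_chirp _ _ _).trans ?_
    have h2 : ((2 * 2 ^ (k + 1) + 1 : ℕ) : ℝ) = 2 ^ (k + 2) + 1 := by push_cast; ring
    have h4 : (1 : ℝ) ≤ 4 ^ k := one_le_pow₀ (by norm_num)
    have h5 : (2 : ℝ) ^ (k + 2) = 4 * 2 ^ k := by ring
    have h6 : (2 : ℝ) ^ k * 2 ^ k = 4 ^ k := by rw [← mul_pow]; norm_num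
    have h7 : (1 : ℝ) ≤ 2 ^ k := one_le_pow₀ (by norm_num)
    have := H d (2 * 2 ^ (k + 1) + 1) q a β (2 ^ j) (-2 * ((a : ℝ) / q + β) * (2 ^ (k + 1) : ℕ))
      (Pi.single i 1) (by omega) hq ha
      (by
        rw [h2]
        have := hβ.small
        have h3 : 0 ≤ |β| * (q * (2 ^ (k + 2) + 1)) := by positivity
        linarith)
      (by rw [h2]; exact hβ.den) hJ1 (by
        rcases hβ.ge with h | h
        · left; simp [h]
        · right
          rw [h2, h5]
          have : 2 * (4 : ℝ) ^ k ≤ 1 * (4 * 2 ^ k + 1) ^ 2 := by nlinarith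
          exact h.trans (mul_le_mul_of_nonneg_right this (abs_nonneg _)))
    refine this.trans ?_
    rw [h2, h5]
    have h8 : (0 : ℝ) ≤ C * X ^ ((ε - 1) / 2) := by positivity
    nlinarith
  refine (nrm_prod_le _ _).trans ((Finset.prod_le_prod (fun _ _ => nrm_nonneg _)
      fun i _ => h1 i).trans ?_)
  rw [Finset.prod_const, Finset.card_univ, Fintype.card_fin, mul_pow,
    ← Real.rpow_natCast (X ^ ((ε - 1) / 2)), ← Real.rpow_mul (by linarith)]
  refine mul_le_mul_of_nonneg_left (Real.rpow_le_rpow_of_exponent_le hX1 ?_) (by positivity)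
  have : ε * (d + 1) = η := by rw [hε]; field_simp
  nlinarith

theorem sum_range_mul_eq {A : Type*} [AddCommMonoid A] (f : ℕ → A) (m q : ℕ) :
    ∑ n ∈ Finset.range (m * q), f n = ∑ i ∈ Finset.range m, ∑ b ∈ Finset.range q, f (i * q + b) := by
  induction m with
  | zero => simp
  | succ m ih => rw [Finset.sum_range_succ, ← ih, add_mul, one_mul, Finset.sum_range_add]

theorem expi_div_add_sq {q : ℕ} (hq : 1 ≤ q) (a : ℕ) (m b : ℤ) :
    expi ((a : ℝ) / q * (m * q + b) ^ 2) = expi ((a : ℝ) / q * b ^ 2) := by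
  have hq0 : (q : ℝ) ≠ 0 := by positivity
  have e : (a : ℝ) / q * (m * q + b) ^ 2 = (a : ℝ) / q * b ^ 2 + ((a * (m ^ 2 * q + 2 * m * b) : ℤ) : ℝ) := by
    push_cast; field_simp; ring
  rw [e, expi_add_int]

theorem nrm_sqKer_sub_mul_gauss_le {d : ℕ} (i : Fin d) {q j k : ℕ} (a : ℕ) {β : ℝ} (hq : 1 ≤ q)
    (hqk : q ≤ 2 ^ k) (hβ : |β| * 4 ^ k ≤ 2 ^ j) :
    nrm (sqKer (Pi.single i (1 : ℤ)) ((a : ℝ) / q + β) (2 ^ (k + 1)) -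
      sqKer (Pi.single i (q : ℤ)) (β * q ^ 2) (2 ^ (k + 1) / q) *
        chirp ((a : ℝ) / q) 0 (Pi.single i (1 : ℤ)) q) ≤ 254 * (q * 2 ^ j) := by
  set R := 2 ^ (k + 1) with hR
  set M := R / q with hM
  set θ := (a : ℝ) / q + β with hθ
  set w : Fin d → ℤ := Pi.single i 1 with hw
  have hqR : q ≤ R := hqk.trans (Nat.pow_le_pow_right (by norm_num) (Nat.le_succ _))
  have hMR : M * q ≤ R := Nat.div_mul_le_self _ _
  have hMR2 : R < M * q + q := by
    have := Nat.lt_div_mul_add (a := R) (b := q) (by omega)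
    exact this
  set f : ℤ → ConvAlg d := fun v => AddMonoidAlgebra.single (v • w) (expi (θ * (v : ℝ) ^ 2)) with hf
  have hfn : ∀ v, nrm (f v) ≤ 1 := fun v => (nrm_single_le _ _).trans (norm_expi _).le
  obtain ⟨δ, hδ⟩ : ∃ δ, R = M * q + δ := ⟨R - M * q, by omega⟩
  obtain ⟨t, ht⟩ : ∃ t, (2 * M + 1) * q = (2 * R + 1 - δ) + t :=
    ⟨(2 * M + 1) * q - (2 * R + 1 - δ), by ring_nf; ring_nf at hδ hMR2; omega⟩
  have hδt : δ + t ≤ 2 * q := by ring_nf at ht hδ hMR2 ⊢; omega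
  set G : ConvAlg d := ∑ n ∈ Finset.range ((2 * M + 1) * q), f ((n : ℤ) - M * q) with hG
  have hAG : nrm (sqKer w θ R - G) ≤ 2 * q := by
    have e1 : sqKer w θ R = ∑ n ∈ Finset.range δ, f ((n : ℤ) - R) +
        ∑ n ∈ Finset.range (2 * R + 1 - δ), f ((n : ℤ) - M * q) := by
      have : sqKer w θ R = ∑ n ∈ Finset.range (2 * R + 1), f ((n : ℤ) - R) := by
        rw [sqKer]
        refine Finset.sum_congr rfl fun n _ => ?_
        simp only [hf]
        push_cast
        rfl
      rw [this, show 2 * R + 1 = δ + (2 * R + 1 - δ) by omega, Finset.sum_range_add]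
      congr 1
      rw [show δ + (2 * R + 1 - δ) - δ = 2 * R + 1 - δ by omega]
      refine Finset.sum_congr rfl fun n _ => ?_
      congr 1
      have : (R : ℤ) = M * q + δ := by exact_mod_cast hδ
      push_cast
      rw [this]; ring
    have e2 : G = ∑ n ∈ Finset.range (2 * R + 1 - δ), f ((n : ℤ) - M * q) +
        ∑ n ∈ Finset.range t, f (((2 * R + 1 - δ + n : ℕ) : ℤ) - M * q) := by
      rw [hG, ht, Finset.sum_range_add]
    have e3 : sqKer w θ R - G = ∑ n ∈ Finset.range δ, f ((n : ℤ) - R) -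
        ∑ n ∈ Finset.range t, f (((2 * R + 1 - δ + n : ℕ) : ℤ) - M * q) := by
      rw [e1, e2]; ring
    have h1 : nrm (∑ n ∈ Finset.range δ, f ((n : ℤ) - R)) ≤ δ :=
      (nrm_sum_le _ _).trans ((Finset.sum_le_sum fun n _ => hfn _).trans (by simp))
    have h2 : nrm (∑ n ∈ Finset.range t, f (((2 * R + 1 - δ + n : ℕ) : ℤ) - M * q)) ≤ t :=
      (nrm_sum_le _ _).trans ((Finset.sum_le_sum fun n _ => hfn _).trans (by simp))
    rw [e3]
    have h3 : (δ : ℝ) + t ≤ 2 * q := by exact_mod_cast hδt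
    exact (nrm_sub_le _ _).trans (by linarith)
  have hq0 : (1 : ℝ) ≤ q := by exact_mod_cast hq
  have hGB : nrm (G - sqKer (Pi.single i (q : ℤ)) (β * q ^ 2) M *
      chirp ((a : ℝ) / q) 0 w q) ≤ 252 * (q * 2 ^ j) := by
    have e1 : G = ∑ m ∈ Finset.range (2 * M + 1), ∑ b ∈ Finset.range q,
        AddMonoidAlgebra.single ((((m : ℤ) - M) * q + b) • w)
          (expi ((a : ℝ) / q * b ^ 2) * expi (β * (((m : ℝ) - M) * q + b) ^ 2)) := by
      rw [hG, sum_range_mul_eq]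
      refine Finset.sum_congr rfl fun m _ => Finset.sum_congr rfl fun b _ => ?_
      have e : ((m * q + b : ℕ) : ℤ) - M * q = ((m : ℤ) - M) * q + b := by push_cast; ring
      simp only [e, hf]
      congr 1
      rw [hθ, add_mul, expi_add]
      have := expi_div_add_sq hq a ((m : ℤ) - M) b
      push_cast at this ⊢
      rw [this]
    have e2 : sqKer (Pi.single i (q : ℤ)) (β * q ^ 2) M * chirp ((a : ℝ) / q) 0 w q =
        ∑ m ∈ Finset.range (2 * M + 1), ∑ b ∈ Finset.range q,
        AddMonoidAlgebra.single ((((m : ℤ) - M) * q + b) • w)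
          (expi ((a : ℝ) / q * b ^ 2) * expi (β * (((m : ℝ) - M) * q) ^ 2)) := by
      rw [sqKer, chirp, Finset.sum_mul_sum]
      refine Finset.sum_congr rfl fun m _ => Finset.sum_congr rfl fun b _ => ?_
      rw [AddMonoidAlgebra.single_mul_single]
      congr 1
      · rw [add_smul, mul_smul]
        congr 2
        simp [hw, ← Pi.single_smul]
      · rw [mul_comm]
        congr 2 <;> ring
    rw [e1, e2, ← Finset.sum_sub_distrib]
    simp_rw [← Finset.sum_sub_distrib, ← AddMonoidAlgebra.single_sub, ← mul_sub]
    have hMq : ((M : ℝ)) * q ≤ R := by exact_mod_cast hMR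
    have hqR' : (q : ℝ) ≤ R := by exact_mod_cast hqR
    have hM0 : (0 : ℝ) ≤ M := Nat.cast_nonneg _
    have hterm : ∀ m ∈ Finset.range (2 * M + 1), ∀ b ∈ Finset.range q,
        nrm (AddMonoidAlgebra.single ((((m : ℤ) - M) * q + b) • w)
          (expi ((a : ℝ) / q * b ^ 2) * (expi (β * (((m : ℝ) - M) * q + b) ^ 2) -
            expi (β * (((m : ℝ) - M) * q) ^ 2)))) ≤ 7 * |β| * (q * (q * (2 * M + 1))) := by
      intro m hm b hb
      refine (nrm_single_le _ _).trans ?_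
      rw [norm_mul, norm_expi, one_mul]
      refine (norm_expi_sub_expi_le _ _).trans ?_
      rw [← mul_sub, abs_mul, mul_assoc]
      refine mul_le_mul_of_nonneg_left (mul_le_mul_of_nonneg_left ?_ (abs_nonneg _)) (by norm_num)
      have hm2 : m ≤ 2 * M := by have := Finset.mem_range.1 hm; omega
      have hm1 : (m : ℝ) ≤ 2 * M := by exact_mod_cast hm2
      have hb1 : (b : ℝ) ≤ q := by exact_mod_cast (Finset.mem_range.1 hb).le
      have hb0 : (0 : ℝ) ≤ b := Nat.cast_nonneg _
      have hm0 : (0 : ℝ) ≤ m := Nat.cast_nonneg _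
      have e : (((m : ℝ) - M) * q + b) ^ 2 - (((m : ℝ) - M) * q) ^ 2 = b * (2 * ((m - M) * q) + b) := by
        ring
      rw [e, abs_mul, abs_of_nonneg hb0]
      refine mul_le_mul hb1 ?_ (abs_nonneg _) (by linarith)
      have hd : |(m : ℝ) - M| ≤ M := by rw [abs_le]; constructor <;> linarith
      calc |2 * (((m : ℝ) - M) * q) + b| ≤ |2 * (((m : ℝ) - M) * q)| + |(b : ℝ)| := abs_add_le _ _
        _ = 2 * (|(m : ℝ) - M| * q) + b := by
          rw [abs_mul, abs_mul, abs_of_nonneg hb0, abs_of_nonneg (by linarith : (0 : ℝ) ≤ q), abs_two]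
        _ ≤ 2 * (M * q) + q := by gcongr
        _ = _ := by ring
    have hsum : ∑ m ∈ Finset.range (2 * M + 1), ∑ b ∈ Finset.range q,
        nrm (AddMonoidAlgebra.single ((((m : ℤ) - M) * q + b) • w)
          (expi ((a : ℝ) / q * b ^ 2) * (expi (β * (((m : ℝ) - M) * q + b) ^ 2) -
            expi (β * (((m : ℝ) - M) * q) ^ 2)))) ≤
        (2 * M + 1) * (q * (7 * |β| * (q * (q * (2 * M + 1))))) := by
      refine (Finset.sum_le_sum fun m hm => Finset.sum_le_sum fun b hb => hterm m hm b hb).trans ?_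
      simp
    refine ((nrm_sum_le _ _).trans (Finset.sum_le_sum fun m _ => nrm_sum_le _ _)).trans
      (hsum.trans ?_)
    have h3 : (q : ℝ) * (2 * M + 1) ≤ 3 * R := by linarith
    have h4 : ((q : ℝ) * (2 * M + 1)) ^ 2 ≤ (3 * R) ^ 2 := pow_le_pow_left₀ (by positivity) h3 2
    have h5 : (R : ℝ) ^ 2 = 4 * 4 ^ k := by
      rw [hR]; push_cast
      rw [← pow_mul, show (4 : ℝ) = 2 ^ 2 by norm_num, ← pow_mul, ← pow_add]; congr 1; ring
    have h6 : |β| * ((q : ℝ) * (2 * M + 1)) ^ 2 ≤ 36 * 2 ^ j := by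
      have := mul_le_mul_of_nonneg_left h4 (abs_nonneg β)
      rw [mul_pow 3 (R : ℝ) 2, h5] at this
      linarith
    have h7 := mul_le_mul_of_nonneg_left h6 (by positivity : (0 : ℝ) ≤ 7 * q)
    linarith
  have e : sqKer w θ R - sqKer (Pi.single i (q : ℤ)) (β * q ^ 2) M * chirp ((a : ℝ) / q) 0 w q =
      (sqKer w θ R - G) + (G - sqKer (Pi.single i (q : ℤ)) (β * q ^ 2) M *
        chirp ((a : ℝ) / q) 0 w q) := by ring
  rw [e]
  refine (nrm_add_le _ _).trans ?_
  have : (q : ℝ) * 1 ≤ q * 2 ^ j :=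
    mul_le_mul_of_nonneg_left (one_le_pow₀ (by norm_num)) (by linarith)
  linarith

theorem lpNormE_iSup_act_le {d : ℕ} (S : Finset ℕ) (K : ℕ → ConvAlg d) {D : ℝ} (hD : 0 ≤ D)
    (h : ∑ k ∈ S, nrm (K k) ^ 2 ≤ D ^ 2) (g : SqLat d) :
    lpNormE d 2 (fun x => ⨆ k ∈ S, ‖act (K k) g x‖ₑ) ≤ ENNReal.ofReal D * ‖g‖ₑ := by
  rw [← ofReal_norm, ← ENNReal.ofReal_mul hD]
  refine lpNormE_iSup_le_of_sum_sq S (fun k => act (K k) g) (by positivity) ?_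
  rw [mul_pow]
  refine le_trans (Finset.sum_le_sum fun k _ => ?_)
    ((Finset.sum_mul S _ _).symm.le.trans (mul_le_mul_of_nonneg_right h (sq_nonneg ‖g‖)))
  rw [← mul_pow]
  exact pow_le_pow_left₀ (norm_nonneg _) (norm_act_le _ _) 2

theorem sum_pow_le_inv_one_sub {r : ℝ} (h0 : 0 ≤ r) (h1 : r < 1) (S : Finset ℕ) :
    ∑ k ∈ S, r ^ k ≤ (1 - r)⁻¹ := by
  rw [← tsum_geometric_of_lt_one h0 h1]
  exact (summable_geometric_of_lt_one h0 h1).sum_le_tsum _ fun _ _ => by positivity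

theorem exists_lpNormE_iSup_boxKer_small_le (d : ℕ) {η : ℝ} (hη : 0 < η) (hη1 : η < 1) :
    ∃ C : ℝ, 0 < C ∧
    ∀ (q a j : ℕ) (S : Finset ℕ) (β : ℕ → ℝ), 1 ≤ q → Nat.Coprime a q →
      (∀ k ∈ S, IsOffset q j k (β k)) → (∀ k ∈ S, (2 : ℝ) ^ k ≤ ((q : ℝ) * 2 ^ j) ^ (d + 2)) →
      ∀ g : SqLat d,
      lpNormE d 2 (fun x => ⨆ k ∈ S, ‖act (boxKer d ((a : ℝ) / q + β k) k) g x‖ₑ) ≤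
        ENNReal.ofReal (C * ((q : ℝ) * 2 ^ j) ^ (η - d / 2)) * ‖g‖ₑ := by
  obtain ⟨C, hC, H⟩ := exists_nrm_boxKer_le d (half_pos hη) (by linarith)
  set ε := η / (d + 2) with hε
  have hε0 : 0 < ε := by positivity
  set r : ℝ := (1 / 2 : ℝ) ^ ε with hr
  have hr0 : 0 ≤ r := by positivity
  have hr1 : r < 1 := Real.rpow_lt_one (by norm_num) (by norm_num) hε0
  have hr2 : 0 < (1 - r)⁻¹ := inv_pos.2 (by linarith)
  refine ⟨C * √(1 - r)⁻¹, by positivity, fun q a j S β hq ha hβ hS g => ?_⟩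
  set X : ℝ := q * 2 ^ j with hX
  have hq1 : (1 : ℝ) ≤ q := by exact_mod_cast hq
  have hJ1 : (1 : ℝ) ≤ 2 ^ j := one_le_pow₀ (by norm_num)
  have hX1 : 1 ≤ X := one_le_mul_of_one_le_of_one_le hq1 hJ1
  have hX0 : 0 < X := by linarith
  refine lpNormE_iSup_act_le S _ (by positivity) ?_ g
  have h1 : ∀ k ∈ S, nrm (boxKer d ((a : ℝ) / q + β k) k) ^ 2 ≤
      (C * X ^ (η / 2 - d / 2)) ^ 2 * (X ^ η * r ^ k) := fun k hk => by
    refine (pow_le_pow_left₀ (nrm_nonneg _) (H q a j k (β k) hq ha (hβ k hk)) 2).trans ?_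
    refine le_mul_of_one_le_right (by positivity) ?_
    have h2 : X ^ η = (X ^ (d + 2)) ^ ε := by
      rw [← Real.rpow_natCast X, ← Real.rpow_mul hX0.le]
      congr 1
      rw [hε]; push_cast; field_simp
    have h3 : r ^ k = ((1 / 2 : ℝ) ^ k) ^ ε := by
      rw [hr, ← Real.rpow_natCast, ← Real.rpow_natCast, ← Real.rpow_mul (by norm_num),
        ← Real.rpow_mul (by norm_num), mul_comm]
    rw [h2, h3, ← Real.mul_rpow (by positivity) (by positivity)]
    refine Real.one_le_rpow ?_ hε0.le
    rw [one_div, inv_pow, ← div_eq_mul_inv, one_le_div (by positivity)]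
    exact hS k hk
  refine (Finset.sum_le_sum h1).trans ?_
  rw [← Finset.mul_sum, ← Finset.mul_sum]
  have h4 : (C * √(1 - r)⁻¹ * X ^ (η - d / 2)) ^ 2 =
      (C * X ^ (η / 2 - d / 2)) ^ 2 * (X ^ η * (1 - r)⁻¹) := by
    rw [mul_pow, mul_pow, mul_pow, Real.sq_sqrt hr2.le]
    have : (X ^ (η - d / 2)) ^ 2 = (X ^ (η / 2 - d / 2)) ^ 2 * X ^ η := by
      rw [← Real.rpow_natCast, ← Real.rpow_natCast, ← Real.rpow_mul hX0.le,
        ← Real.rpow_mul hX0.le, ← Real.rpow_add hX0]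
      congr 1; push_cast; ring
    rw [this]; ring
  rw [h4]
  exact mul_le_mul_of_nonneg_left (mul_le_mul_of_nonneg_left
    (sum_pow_le_inv_one_sub hr0 hr1 S) (by positivity)) (by positivity)

/-- The kernel approximating `boxKer` near a fraction with small denominator: a smooth
oscillatory part along `q ℤ^d` convolved with normalized Gauss sums. -/
def gaussKer (d : ℕ) (a q : ℕ) (β : ℝ) (k : ℕ) : ConvAlg d :=
  ∏ i : Fin d, ((2 : ℂ) ^ k)⁻¹ • (sqKer (Pi.single i (q : ℤ)) (β * q ^ 2) (2 ^ (k + 1) / q) *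
    chirp ((a : ℝ) / q) 0 (Pi.single i (1 : ℤ)) q)

theorem nrm_boxKer_sub_gaussKer_le (d : ℕ) {q j k : ℕ} (a : ℕ) {β : ℝ} (hq : 1 ≤ q)
    (hk : (q : ℝ) * 2 ^ j ≤ 2 ^ k) (hβ : |β| * 4 ^ k ≤ 2 ^ j) :
    nrm (boxKer d ((a : ℝ) / q + β) k - gaussKer d a q β k) ≤
      259 ^ d * d * 254 * (q * 2 ^ j) / 2 ^ k := by
  have hJ1 : (1 : ℝ) ≤ 2 ^ j := one_le_pow₀ (by norm_num)
  have hK : (0 : ℝ) < 2 ^ k := by positivity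
  have hK1 : (1 : ℝ) ≤ 2 ^ k := one_le_pow₀ (by norm_num)
  have hqk : q ≤ 2 ^ k := by
    have : (q : ℝ) * 1 ≤ q * 2 ^ j := mul_le_mul_of_nonneg_left hJ1 (Nat.cast_nonneg q)
    have : (q : ℝ) ≤ 2 ^ k := by linarith
    exact_mod_cast this
  have hdiff : ∀ i : Fin d, nrm (((2 : ℂ) ^ k)⁻¹ • sqKer (Pi.single i (1 : ℤ))
      ((a : ℝ) / q + β) (2 ^ (k + 1)) - ((2 : ℂ) ^ k)⁻¹ • (sqKer (Pi.single i (q : ℤ))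
      (β * q ^ 2) (2 ^ (k + 1) / q) * chirp ((a : ℝ) / q) 0 (Pi.single i (1 : ℤ)) q)) ≤
      254 * (q * 2 ^ j) / 2 ^ k := fun i => by
    rw [← smul_sub, nrm_smul, norm_two_pow_inv, ← div_eq_inv_mul]
    exact div_le_div_of_nonneg_right (nrm_sqKer_sub_mul_gauss_le i a hq hqk hβ) hK.le
  have ha : ∀ i : Fin d, nrm (((2 : ℂ) ^ k)⁻¹ • sqKer (Pi.single i (1 : ℤ))
      ((a : ℝ) / q + β) (2 ^ (k + 1))) ≤ 5 := fun i => by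
    rw [nrm_smul, norm_two_pow_inv, inv_mul_le_iff₀ hK]
    refine (nrm_sqKer_le _ _ _).trans ?_
    push_cast
    rw [pow_succ]; linarith
  have hb : ∀ i : Fin d, nrm (((2 : ℂ) ^ k)⁻¹ • (sqKer (Pi.single i (q : ℤ))
      (β * q ^ 2) (2 ^ (k + 1) / q) * chirp ((a : ℝ) / q) 0 (Pi.single i (1 : ℤ)) q)) ≤
      259 := fun i => by
    have h1 := nrm_sub_le (((2 : ℂ) ^ k)⁻¹ • sqKer (Pi.single i (1 : ℤ))
      ((a : ℝ) / q + β) (2 ^ (k + 1))) (((2 : ℂ) ^ k)⁻¹ • sqKer (Pi.single i (1 : ℤ))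
      ((a : ℝ) / q + β) (2 ^ (k + 1)) - ((2 : ℂ) ^ k)⁻¹ • (sqKer (Pi.single i (q : ℤ))
      (β * q ^ 2) (2 ^ (k + 1) / q) * chirp ((a : ℝ) / q) 0 (Pi.single i (1 : ℤ)) q))
    rw [sub_sub_cancel] at h1
    have h2 : 254 * ((q : ℝ) * 2 ^ j) / 2 ^ k ≤ 254 := by
      rw [div_le_iff₀ hK]; linarith
    linarith [ha i, hdiff i]
  refine (nrm_prod_sub_prod_le Finset.univ (B := 259) (by norm_num)
    (fun i => (ha i).trans (by norm_num)) hb).trans ?_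
  rw [Finset.card_univ, Fintype.card_fin]
  refine (mul_le_mul_of_nonneg_left (Finset.sum_le_sum fun i _ => hdiff i)
    (by positivity)).trans (le_of_eq ?_)
  simp
  ring

theorem exists_lpNormE_iSup_gaussKer_le (d : ℕ) {η : ℝ} (hη : 0 < η) (hη1 : η < 1) :
    ∃ C : ℝ, 0 < C ∧
    ∀ (q a j : ℕ) (S : Finset ℕ) (β : ℕ → ℝ), 1 ≤ q → Nat.Coprime a q →
      (∀ k ∈ S, IsOffset q j k (β k)) → (∀ k ∈ S, q ≤ 2 ^ k) → ∀ g : SqLat d,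
      lpNormE d 2 (fun x => ⨆ k ∈ S, ‖act (gaussKer d a q (β k) k) g x‖ₑ) ≤
        ENNReal.ofReal (C * ((q : ℝ) * 2 ^ j) ^ (η - d / 2)) * ‖g‖ₑ := by
  set ε := η / (d + 1) with hε
  have hd1 : (0 : ℝ) < d + 1 := by positivity
  have hd0 : (0 : ℝ) ≤ d := Nat.cast_nonneg d
  have hε0 : 0 < ε := by positivity
  have hε1 : ε < 1 := by
    rw [hε, div_lt_one hd1]; linarith
  obtain ⟨C₁, hC₁, H₁⟩ := lpNormE_iSup_sqKer_step d hη hη1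
  obtain ⟨C₂, hC₂, H₂⟩ := nrm_chirp_weyl hε0 hε1 (c₀ := 1) one_pos
  refine ⟨C₁ * (2 * C₂) ^ d, by positivity, fun q a j S β hq ha hβ hS g => ?_⟩
  have hq1 : (1 : ℝ) ≤ q := by exact_mod_cast hq
  set e := Nat.log 2 q with he
  have he1 : 2 ^ e ≤ q := Nat.pow_log_le_self 2 (by omega)
  have he2 : q < 2 ^ (e + 1) := Nat.lt_pow_succ_log_self (by norm_num) q
  have hek : ∀ k ∈ S, e ≤ k := fun k hk => by
    have := he1.trans (hS k hk)
    exact (Nat.pow_le_pow_iff_right (by norm_num)).1 this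
  set W : ConvAlg d := ∏ i : Fin d, ((2 : ℂ) ^ e)⁻¹ •
    chirp ((a : ℝ) / q) 0 (Pi.single i (1 : ℤ)) q with hW
  have hWn : nrm W ≤ (2 * C₂) ^ d * (q : ℝ) ^ (η - d / 2) := by
    have h1 : ∀ i : Fin d, nrm (((2 : ℂ) ^ e)⁻¹ • chirp ((a : ℝ) / q) 0 (Pi.single i (1 : ℤ)) q) ≤
        2 * C₂ * (q : ℝ) ^ ((ε - 1) / 2) := fun i => by
      rw [nrm_smul, norm_two_pow_inv, inv_mul_le_iff₀ (by positivity)]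
      have := H₂ d q q a 0 1 0 (Pi.single i 1) hq hq ha (by simp) (by linarith) le_rfl
        (Or.inl rfl)
      rw [add_zero, mul_one] at this
      refine this.trans ?_
      have h3 : (q : ℝ) ≤ 2 ^ e * 2 := by exact_mod_cast (pow_succ 2 e ▸ he2.le : q ≤ 2 ^ e * 2)
      have h4 : (0 : ℝ) ≤ C₂ * (q : ℝ) ^ ((ε - 1) / 2) := by positivity
      nlinarith
    refine (nrm_prod_le _ _).trans ((Finset.prod_le_prod (fun _ _ => nrm_nonneg _)
      fun i _ => h1 i).trans ?_)
    rw [Finset.prod_const, Finset.card_univ, Fintype.card_fin, mul_pow,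
      ← Real.rpow_natCast ((q : ℝ) ^ ((ε - 1) / 2)), ← Real.rpow_mul (by linarith)]
    refine mul_le_mul_of_nonneg_left (Real.rpow_le_rpow_of_exponent_le hq1 ?_) (by positivity)
    have : ε * (d + 1) = η := by rw [hε]; field_simp
    nlinarith
  have hfac : ∀ k ∈ S, gaussKer d a q (β k) k = (∏ i : Fin d, ((2 : ℂ) ^ (k - e))⁻¹ •
      sqKer (Pi.single i (q : ℤ)) (β k * q ^ 2) (2 ^ (k + 1) / q)) * W := fun k hk => by
    rw [gaussKer, hW, ← Finset.prod_mul_distrib]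
    refine Finset.prod_congr rfl fun i _ => ?_
    rw [smul_mul_smul_comm, ← mul_inv, ← pow_add, Nat.sub_add_cancel (hek k hk)]
  set S' := S.image (fun k => k - e) with hS'
  have hmem : ∀ s ∈ S', s + e ∈ S := fun s hs => by
    obtain ⟨k, hk, rfl⟩ := Finset.mem_image.1 hs
    rwa [Nat.sub_add_cancel (hek k hk)]
  have hmain := H₁ q j S' (fun s => 2 ^ (s + e + 1) / q) (fun s => β (s + e) * q ^ 2) hq
    (fun s _ => by
      refine (Nat.div_le_div_left he1 (by positivity)).trans (le_of_eq ?_)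
      rw [show s + e + 1 = (s + 1) + e by ring, pow_add 2 (s + 1) e, Nat.mul_div_cancel _ (by positivity)])
    (fun s hs => by
      have h := hβ _ (hmem s hs)
      have hqk := hS _ (hmem s hs)
      set k := s + e
      have h1 : ((2 ^ (k + 1) / q : ℕ) : ℝ) * q ≤ 2 ^ (k + 1) := by
        exact_mod_cast Nat.div_mul_le_self _ _
      have h2 : (q : ℝ) ≤ 2 ^ k := by exact_mod_cast hqk
      rw [abs_mul, abs_of_nonneg (by positivity : (0 : ℝ) ≤ (q : ℝ) ^ 2)]
      refine le_trans ?_ h.small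
      have h3 : (q : ℝ) * (2 * ((2 ^ (k + 1) / q : ℕ) : ℝ) + 1) ≤ 2 * (2 ^ (k + 2) + 1) := by
        have : (2 : ℝ) ^ (k + 2) = 4 * 2 ^ k := by ring
        have : (2 : ℝ) ^ (k + 1) = 2 * 2 ^ k := by ring
        nlinarith
      have := mul_le_mul_of_nonneg_left h3 (by positivity : 0 ≤ 4 * |β k| * q)
      linarith)
    (fun s hs => by
      have h := hβ _ (hmem s hs)
      set k := s + e
      have h1 : ((2 ^ (k + 1) / q : ℕ) : ℝ) * q ≤ 2 ^ (k + 1) := by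
        exact_mod_cast Nat.div_mul_le_self _ _
      rw [abs_mul, abs_of_nonneg (by positivity : (0 : ℝ) ≤ (q : ℝ) ^ 2)]
      have h2 := pow_le_pow_left₀ (by positivity) h1 2
      have h5 : ((2 : ℝ) ^ (k + 1)) ^ 2 = 4 * 4 ^ k := by
        rw [show (4 : ℝ) = 2 ^ 2 by norm_num, ← pow_mul, ← pow_mul, ← pow_add]; congr 1; ring
      rw [h5] at h2
      have := mul_le_mul_of_nonneg_left h2 (abs_nonneg (β k))
      have := h.le
      linarith)
    (fun s hs => by
      have h := hβ _ (hmem s hs)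
      set k := s + e
      refine h.ge.imp id fun h => h.trans ?_
      rw [abs_mul, abs_of_nonneg (by positivity : (0 : ℝ) ≤ (q : ℝ) ^ 2)]
      have h1 : (2 : ℝ) ^ (k + 1) ≤ (2 * ((2 ^ (k + 1) / q : ℕ) : ℝ) + 1) * q := by
        have : 2 ^ (k + 1) < 2 ^ (k + 1) / q * q + q := Nat.lt_div_mul_add (by omega)
        have h2 : (2 ^ (k + 1) : ℕ) ≤ (2 * (2 ^ (k + 1) / q) + 1) * q := by
          have e : (2 * (2 ^ (k + 1) / q) + 1) * q =
            2 ^ (k + 1) / q * q + (2 ^ (k + 1) / q * q + q) := by ring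
          rw [e]
          exact this.le.trans (Nat.le_add_left _ _)
        exact_mod_cast h2
      have h2 := pow_le_pow_left₀ (by positivity) h1 2
      have h5 : ((2 : ℝ) ^ (k + 1)) ^ 2 = 4 * 4 ^ k := by
        rw [show (4 : ℝ) = 2 ^ 2 by norm_num, ← pow_mul, ← pow_mul, ← pow_add]; congr 1; ring
      rw [h5] at h2
      have h6 := mul_le_mul_of_nonneg_left h2 (abs_nonneg (β k))
      have : 0 ≤ (4 : ℝ) ^ k * |β k| := by positivity
      linarith)
    (act W g)
  have hle : lpNormE d 2 (fun x => ⨆ k ∈ S, ‖act (gaussKer d a q (β k) k) g x‖ₑ) ≤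
      ENNReal.ofReal (C₁ * ((2 : ℝ) ^ j) ^ (η - d / 2)) * ‖act W g‖ₑ := by
    refine le_trans (lpNormE_mono (by norm_num) fun x => iSup₂_le fun k hk => ?_) hmain
    rw [hfac k hk, act_mul_apply]
    have := le_iSup₂ (f := fun s (_ : s ∈ S') => ‖act (∏ i : Fin d, ((2 : ℂ) ^ s)⁻¹ •
      sqKer (Pi.single i (q : ℤ)) (β (s + e) * q ^ 2) (2 ^ (s + e + 1) / q)) (act W g) x‖ₑ)
      (k - e) (Finset.mem_image_of_mem _ hk)
    simp only [Nat.sub_add_cancel (hek k hk)] at this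
    exact this
  refine hle.trans ?_
  rw [← ofReal_norm, ← ofReal_norm, ← ENNReal.ofReal_mul (by positivity),
    ← ENNReal.ofReal_mul (by positivity)]
  refine ENNReal.ofReal_le_ofReal ?_
  have h1 : ‖act W g‖ ≤ (2 * C₂) ^ d * (q : ℝ) ^ (η - d / 2) * ‖g‖ :=
    (norm_act_le _ _).trans (mul_le_mul_of_nonneg_right hWn (norm_nonneg _))
  refine (mul_le_mul_of_nonneg_left h1 (by positivity)).trans (le_of_eq ?_)
  rw [Real.mul_rpow (by positivity) (by positivity)]
  ring

/-- Maximal estimate on square-summable functions for box kernels whose frequencies approach a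
fixed fraction. -/
theorem lpNormE_iSup_boxKer (d : ℕ) {η : ℝ} (hη : 0 < η) (hη1 : η < 1) : ∃ C : ℝ, 0 < C ∧
    ∀ (q a j : ℕ) (S : Finset ℕ) (β : ℕ → ℝ), 1 ≤ q → Nat.Coprime a q →
      (∀ k ∈ S, IsOffset q j k (β k)) → ∀ g : SqLat d,
      lpNormE d 2 (fun x => ⨆ k ∈ S, ‖act (boxKer d ((a : ℝ) / q + β k) k) g x‖ₑ) ≤
        ENNReal.ofReal (C * ((q : ℝ) * 2 ^ j) ^ (η - d / 2)) * ‖g‖ₑ := by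
  obtain ⟨C₁, hC₁, H₁⟩ := exists_lpNormE_iSup_boxKer_small_le d hη hη1
  obtain ⟨C₂, hC₂, H₂⟩ := exists_lpNormE_iSup_gaussKer_le d hη hη1
  set E : ℝ := 259 ^ d * d * 254 with hE
  refine ⟨C₁ + (C₂ + 2 * E), by positivity, fun q a j S β hq ha hβ g => ?_⟩
  set X : ℝ := q * 2 ^ j with hX
  have hq1 : (1 : ℝ) ≤ q := by exact_mod_cast hq
  have hJ1 : (1 : ℝ) ≤ 2 ^ j := one_le_pow₀ (by norm_num)
  have hX1 : 1 ≤ X := one_le_mul_of_one_le_of_one_le hq1 hJ1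
  have hX0 : 0 < X := by linarith
  set S₁ := S.filter (fun k => (2 : ℝ) ^ k ≤ X ^ (d + 2)) with hS₁
  set S₂ := S.filter (fun k => ¬ (2 : ℝ) ^ k ≤ X ^ (d + 2)) with hS₂
  have hXk : ∀ k ∈ S₂, X ^ (d + 2) ≤ 2 ^ k := fun k hk =>
    (not_le.1 (Finset.mem_filter.1 hk).2).le
  have hXk' : ∀ k ∈ S₂, X ≤ 2 ^ k := fun k hk =>
    (le_self_pow₀ hX1 (by omega)).trans (hXk k hk)
  have b₁ := H₁ q a j S₁ β hq ha (fun k hk => hβ k (Finset.mem_filter.1 hk).1)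
    (fun k hk => (Finset.mem_filter.1 hk).2) g
  have b₂ := H₂ q a j S₂ β hq ha (fun k hk => hβ k (Finset.mem_filter.1 hk).1)
    (fun k hk => by
      have h1 : (q : ℝ) * 1 ≤ X := mul_le_mul_of_nonneg_left hJ1 (by linarith)
      have : (q : ℝ) ≤ 2 ^ k := by linarith [hXk' k hk]
      exact_mod_cast this) g
  have b₃ : lpNormE d 2 (fun x => ⨆ k ∈ S₂,
      ‖act (boxKer d ((a : ℝ) / q + β k) k - gaussKer d a q (β k) k) g x‖ₑ) ≤
      ENNReal.ofReal (2 * E * X ^ (η - d / 2)) * ‖g‖ₑ := by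
    refine lpNormE_iSup_act_le S₂ _ (by positivity) ?_ g
    have h1 : ∀ k ∈ S₂, nrm (boxKer d ((a : ℝ) / q + β k) k - gaussKer d a q (β k) k) ^ 2 ≤
        (E * X ^ (η - d / 2)) ^ 2 * (1 / 2 : ℝ) ^ k := fun k hk => by
      have h0 : nrm (boxKer d ((a : ℝ) / q + β k) k - gaussKer d a q (β k) k) ≤ E * (X / 2 ^ k) :=
        (nrm_boxKer_sub_gaussKer_le d a hq (hXk' k hk) (hβ k (Finset.mem_filter.1 hk).1).le).trans
          (le_of_eq (mul_div_assoc _ _ _))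
      refine (pow_le_pow_left₀ (nrm_nonneg _) h0 2).trans ?_
      rw [mul_pow E, mul_pow E, mul_assoc]
      refine mul_le_mul_of_nonneg_left ?_ (by positivity)
      have h2 : X ^ (-(d : ℝ)) ≤ (X ^ (η - d / 2)) ^ 2 := by
        rw [← Real.rpow_natCast (X ^ (η - d / 2)), ← Real.rpow_mul hX0.le]
        refine Real.rpow_le_rpow_of_exponent_le hX1 ?_
        push_cast; linarith
      refine le_trans ?_ (mul_le_mul_of_nonneg_right h2 (by positivity))
      rw [Real.rpow_neg hX0.le, Real.rpow_natCast, one_div, inv_pow, ← mul_inv, div_pow,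
        div_le_iff₀ (by positivity), ← div_eq_inv_mul, le_div_iff₀ (by positivity)]
      have h3 := mul_le_mul_of_nonneg_right (hXk k hk) (by positivity : (0 : ℝ) ≤ 2 ^ k)
      calc X ^ 2 * (X ^ d * 2 ^ k) = X ^ (d + 2) * 2 ^ k := by ring
        _ ≤ 2 ^ k * 2 ^ k := h3
        _ = _ := by ring
    refine (Finset.sum_le_sum h1).trans ?_
    rw [← Finset.mul_sum]
    have h4 := sum_pow_le_inv_one_sub (r := 1 / 2) (by norm_num) (by norm_num) S₂
    have h5 := mul_le_mul_of_nonneg_left h4 (sq_nonneg (E * X ^ (η - d / 2)))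
    norm_num at h5 ⊢
    nlinarith [sq_nonneg (E * X ^ (η - d / 2))]
  have hpt : ∀ x, (⨆ k ∈ S, ‖act (boxKer d ((a : ℝ) / q + β k) k) g x‖ₑ) ≤
      (⨆ k ∈ S₁, ‖act (boxKer d ((a : ℝ) / q + β k) k) g x‖ₑ) +
      ((⨆ k ∈ S₂, ‖act (gaussKer d a q (β k) k) g x‖ₑ) + ⨆ k ∈ S₂,
      ‖act (boxKer d ((a : ℝ) / q + β k) k - gaussKer d a q (β k) k) g x‖ₑ) := fun x => by
    refine iSup₂_le fun k hk => ?_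
    by_cases h : (2 : ℝ) ^ k ≤ X ^ (d + 2)
    · refine le_add_right ?_
      exact le_iSup₂ (f := fun k _ => ‖act (boxKer d ((a : ℝ) / q + β k) k) g x‖ₑ) k
        (Finset.mem_filter.2 ⟨hk, h⟩)
    · refine le_add_left ?_
      have hk2 : k ∈ S₂ := Finset.mem_filter.2 ⟨hk, h⟩
      have e : act (boxKer d ((a : ℝ) / q + β k) k) g x = act (gaussKer d a q (β k) k) g x +
          act (boxKer d ((a : ℝ) / q + β k) k - gaussKer d a q (β k) k) g x := by
        rw [map_sub, sub_apply, lp.coeFn_sub, Pi.sub_apply]; ring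
      rw [e]
      refine (enorm_add_le _ _).trans (add_le_add
        (le_iSup₂ (f := fun k _ => ‖act (gaussKer d a q (β k) k) g x‖ₑ) k hk2)
        (le_iSup₂ (f := fun k _ => ‖act (boxKer d ((a : ℝ) / q + β k) k -
          gaussKer d a q (β k) k) g x‖ₑ) k hk2))
  refine (lpNormE_mono (by norm_num) hpt).trans ((lpNormE_add_le (by norm_num) _ _).trans
    ((add_le_add b₁ ((lpNormE_add_le (by norm_num) _ _).trans (add_le_add b₂ b₃))).trans ?_))
  rw [← add_mul, ← add_mul, ← ENNReal.ofReal_add (by positivity) (by positivity),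
    ← ENNReal.ofReal_add (by positivity) (by positivity)]
  refine le_of_eq ?_
  congr 2
  ring

/-- The average over the box of side about `2^k` with quadratic phase `θ |v|²`. -/
def boxSum (d : ℕ) (θ : ℝ) (k : ℕ) (h : (Fin d → ℤ) → ℝ) (x : Fin d → ℤ) : ℂ :=
  ((2 : ℂ) ^ (k * d))⁻¹ *
    ∑ v ∈ latticeBox d (2 ^ (k + 1)), expi (θ * normSq v) * (h (x - v) : ℂ)

theorem sqKer_eq_sum_Icc {d : ℕ} (w : Fin d → ℤ) (γ : ℝ) (M : ℕ) :
    sqKer w γ M = ∑ n ∈ Finset.Icc (-(M : ℤ)) M,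
      AddMonoidAlgebra.single (n • w) (expi (γ * (n : ℝ) ^ 2)) := by
  rw [sqKer]
  refine Finset.sum_bij (fun n _ => (n : ℤ) - M) ?_ ?_ ?_ ?_
  · intro n hn
    have := Finset.mem_range.1 hn
    rw [Finset.mem_Icc]; omega
  · intro a _ b _ h
    omega
  · intro b hb
    rw [Finset.mem_Icc] at hb
    exact ⟨(b + M).toNat, Finset.mem_range.2 (by omega), by omega⟩
  · intro n _
    push_cast
    rfl

theorem act_boxKer_apply (d : ℕ) (θ : ℝ) (k : ℕ) (g : SqLat d) {h : (Fin d → ℤ) → ℝ}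
    (hg : ∀ y, g y = h y) (x : Fin d → ℤ) : act (boxKer d θ k) g x = boxSum d θ k h x := by
  classical
  rw [boxKer, Finset.prod_smul, act_smul_apply, boxSum]
  simp_rw [sqKer_eq_sum_Icc]
  rw [prod_sum_single, act_sum_single_apply, Finset.prod_const, Finset.card_univ,
    Fintype.card_fin, inv_pow, ← pow_mul]
  congr 1
  refine Finset.sum_congr rfl fun v _ => ?_
  rw [sum_smul_piSingle, ← expi_sum, hg]
  simp only [mul_one]
  rw [← Finset.mul_sum, normSq]
  push_cast
  rfl

theorem boxSum_add {d : ℕ} (θ : ℝ) (k : ℕ) (h₁ h₂ : (Fin d → ℤ) → ℝ) (x : Fin d → ℤ) :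
    boxSum d θ k (fun y => h₁ y + h₂ y) x = boxSum d θ k h₁ x + boxSum d θ k h₂ x := by
  simp only [boxSum, Complex.ofReal_add, mul_add, Finset.sum_add_distrib]

theorem enorm_boxSum_le {d : ℕ} (θ : ℝ) (k : ℕ) {h : (Fin d → ℤ) → ℝ} (h0 : ∀ y, 0 ≤ h y)
    (x : Fin d → ℤ) : ‖boxSum d θ k h x‖ₑ ≤
      ((2 : ℝ≥0∞) ^ (k * d))⁻¹ * ∑ v ∈ latticeBox d (2 ^ (k + 1)), ENNReal.ofReal (h (x - v)) := by
  rw [boxSum, enorm_mul]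
  have h1 : ‖((2 : ℂ) ^ (k * d))⁻¹‖ₑ = ((2 : ℝ≥0∞) ^ (k * d))⁻¹ := by
    rw [← ofReal_norm, norm_two_pow_inv, ENNReal.ofReal_inv_of_pos (by positivity),
      ENNReal.ofReal_pow (by norm_num)]
    norm_num
  rw [h1]
  refine mul_le_mul le_rfl ((enorm_sum_le _ _).trans (Finset.sum_le_sum fun v _ => ?_)) bot_le bot_le
  rw [enorm_mul, ← ofReal_norm, ← ofReal_norm, norm_expi, Complex.norm_real, Real.norm_eq_abs,
    abs_of_nonneg (h0 _)]
  simp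

/-- The maximal function of `boxSum` over a set of scales, with scale-dependent frequencies. -/
def boxSup (d : ℕ) (S : Finset ℕ) (θ : ℕ → ℝ) (h : (Fin d → ℤ) → ℝ) (x : Fin d → ℤ) : ℝ≥0∞ :=
  ⨆ k ∈ S, ‖boxSum d (θ k) k h x‖ₑ

theorem boxSup_add_le {d : ℕ} (S : Finset ℕ) (θ : ℕ → ℝ) (h₁ h₂ : (Fin d → ℤ) → ℝ)
    (x : Fin d → ℤ) : boxSup d S θ (fun y => h₁ y + h₂ y) x ≤ boxSup d S θ h₁ x + boxSup d S θ h₂ x := by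
  refine iSup₂_le fun k hk => ?_
  rw [boxSum_add]
  exact (enorm_add_le _ _).trans (add_le_add
    (le_iSup₂ (f := fun k (_ : k ∈ S) => ‖boxSum d (θ k) k h₁ x‖ₑ) k hk)
    (le_iSup₂ (f := fun k (_ : k ∈ S) => ‖boxSum d (θ k) k h₂ x‖ₑ) k hk))

theorem exists_boxSup_le_hlMax {d : ℕ} (S : Finset ℕ) : ∃ L, ∀ (θ : ℕ → ℝ)
    (h : (Fin d → ℤ) → ℝ), (∀ y, 0 ≤ h y) → ∀ x,
    boxSup d S θ h x ≤ hlMax d L (fun y => ENNReal.ofReal (h y)) x := by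
  refine ⟨S.sup id + 1, fun θ h h0 x => iSup₂_le fun k hk => ?_⟩
  exact (enorm_boxSum_le _ _ h0 x).trans
    (sum_latticeBox_le_hlMax (Nat.lt_succ_of_le (Finset.le_sup (f := id) hk)) _ x)

theorem mul_count_lt_le {d : ℕ} (U : (Fin d → ℤ) → ℝ≥0∞) (t : ℝ≥0∞) :
    t ^ 2 * MeasureTheory.Measure.count {x | t < U x} ≤ ∑' x, U x ^ 2 := by
  rw [← MeasureTheory.lintegral_count]
  refine le_trans (mul_le_mul le_rfl (MeasureTheory.measure_mono ?_) bot_le bot_le)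
    (MeasureTheory.mul_meas_ge_le_lintegral (f := fun x => U x ^ 2) Measurable.of_discrete (t ^ 2))
  intro x hx
  have hx' : t < U x := hx
  exact pow_le_pow_left' hx'.le 2

theorem boxSup_tsum_sq_le {d q a : ℕ} {S : Finset ℕ} {β : ℕ → ℝ} {K : ℝ} (hK : 0 < K)
    (H : ∀ g : SqLat d,
      lpNormE d 2 (fun x => ⨆ k ∈ S, ‖act (boxKer d ((a : ℝ) / q + β k) k) g x‖ₑ) ≤
        ENNReal.ofReal K * ‖g‖ₑ) {h : (Fin d → ℤ) → ℝ} :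
    ∑' x, boxSup d S (fun k => (a : ℝ) / q + β k) h x ^ 2 ≤
      ENNReal.ofReal (K ^ 2) * ∑' x, ENNReal.ofReal (h x ^ 2) := by
  by_cases hs : Summable fun x => h x ^ 2
  · have hs' : Summable fun x => ‖(h x : ℂ)‖ ^ 2 := by simpa using hs
    set g : SqLat d := ⟨fun x => (h x : ℂ), memℓp_two_iff.2 hs'⟩ with hg
    have hgx : ∀ y, g y = h y := fun y => rfl
    have h1 : (fun x => ⨆ k ∈ S, ‖act (boxKer d ((a : ℝ) / q + β k) k) g x‖ₑ) =
        boxSup d S (fun k => (a : ℝ) / q + β k) h := by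
      ext x
      simp only [boxSup, act_boxKer_apply d _ _ g hgx]
    have h2 := ENNReal.rpow_le_rpow (H g) (by norm_num : (0 : ℝ) ≤ 2)
    rw [h1, lpNormE_rpow (by norm_num), ENNReal.mul_rpow_of_nonneg _ _ (by norm_num)] at h2
    simp only [ENNReal.rpow_two] at h2
    refine h2.trans (le_of_eq ?_)
    rw [ENNReal.ofReal_pow hK.le, ← ofReal_norm, ← ENNReal.ofReal_pow (norm_nonneg _),
      norm_sq_eq_tsum, ENNReal.ofReal_tsum_of_nonneg (fun x => by positivity) hs']
    simp
  · have : ∑' x, ENNReal.ofReal (h x ^ 2) = ⊤ := by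
      by_contra hc
      exact hs (by
        have := ENNReal.summable_toReal hc
        simpa [ENNReal.toReal_ofReal (sq_nonneg _)] using this)
    rw [this, ENNReal.mul_top]
    · exact le_top
    · simp only [ne_eq, ENNReal.ofReal_eq_zero, not_le]; positivity

theorem boxSup_tsum_rpow_le {d q a : ℕ} {p : ℝ} (hp : 1 < p) (hp2 : p < 2) {S : Finset ℕ}
    {β : ℕ → ℝ} {K : ℝ} (hK : 0 < K)
    (H : ∀ g : SqLat d,
      lpNormE d 2 (fun x => ⨆ k ∈ S, ‖act (boxKer d ((a : ℝ) / q + β k) k) g x‖ₑ) ≤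
        ENNReal.ofReal K * ‖g‖ₑ) {h : (Fin d → ℤ) → ℝ} (h0 : ∀ y, 0 ≤ h y) :
    lpNormE d p (boxSup d S (fun k => (a : ℝ) / q + β k) h) ≤
      ENNReal.ofReal ((p * (2 * 21 ^ d / (p - 1) + 4 / (2 - p))) ^ (1 / p) *
        K ^ (2 * (p - 1) / p)) * lpNormE d p (fun x => ENNReal.ofReal (h x)) := by
  have hp0 : 0 < p := by linarith
  have hp1 : 0 < p - 1 := by linarith
  have hp3 : 0 < 2 - p := by linarith
  set θ : ℕ → ℝ := fun k => (a : ℝ) / q + β k with hθ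
  obtain ⟨L, hL⟩ := exists_boxSup_le_hlMax (d := d) S
  have hfin : ∀ x, boxSup d S θ h x ≠ ⊤ := fun x =>
    ((hL θ h h0 x).trans_lt (hlMax_ne_top (fun y => ENNReal.ofReal_ne_top) x).lt_top).ne
  have hc : ENNReal.ofReal ((p * (2 * 21 ^ d / (p - 1) + 4 / (2 - p))) ^ (1 / p) *
        K ^ (2 * (p - 1) / p)) = ENNReal.ofReal (p * (2 * 21 ^ d * (K ^ (-2 : ℝ)) ^ (1 - p) / (p - 1) +
          4 * K ^ 2 * (K ^ (-2 : ℝ)) ^ (2 - p) / (2 - p))) ^ (1 / p) := by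
    rw [ENNReal.ofReal_rpow_of_pos (by positivity)]
    congr 1
    have e1 : (K ^ (-2 : ℝ)) ^ (1 - p) = K ^ (2 * (p - 1)) := by
      rw [← Real.rpow_mul hK.le]; congr 1; ring
    have e2 : K ^ 2 * (K ^ (-2 : ℝ)) ^ (2 - p) = K ^ (2 * (p - 1)) := by
      rw [← Real.rpow_mul hK.le, ← Real.rpow_natCast, ← Real.rpow_add hK]; congr 1
      push_cast; ring
    rw [e1, mul_assoc 4, e2, Real.rpow_def_of_pos hK (2 * (p - 1) / p),
      show Real.log K * (2 * (p - 1) / p) = Real.log K * (2 * (p - 1)) * (1 / p) by ring,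
      Real.exp_mul, ← Real.rpow_def_of_pos hK, ← Real.mul_rpow (by positivity) (by positivity)]
    congr 1
    ring
  rw [hc]
  refine lpNormE_le_of_tsum_le hp0 hfin (fun x => ENNReal.ofReal_ne_top) ?_
  simp only [ENNReal.toReal_ofReal (h0 _)]
  refine marcinkiewicz_low hp hp2 (by positivity) (by positivity) (by positivity)
    (fun _ => ENNReal.toReal_nonneg) h0 fun t ht => ?_
  set κ := K ^ (-2 : ℝ) with hκ
  set hi : (Fin d → ℤ) → ℝ := fun x => if κ * t < h x then h x else 0 with hhi
  set lo : (Fin d → ℤ) → ℝ := fun x => if h x ≤ κ * t then h x else 0 with hlo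
  have hhi0 : ∀ x, 0 ≤ hi x := fun x => by
    simp only [hhi]; split_ifs <;> simp [h0]
  have hsplit : h = fun x => hi x + lo x := by
    ext x
    simp only [hhi, hlo]
    rcases le_or_gt (h x) (κ * t) with h' | h'
    · rw [if_neg (not_lt.2 h'), if_pos h', zero_add]
    · rw [if_pos h', if_neg (not_le.2 h'), add_zero]
  have ht2 : ENNReal.ofReal (t / 2) ≠ 0 := by
    simp only [ne_eq, ENNReal.ofReal_eq_zero, not_le]; positivity
  have hsub : {x | t < (boxSup d S θ h x).toReal} ⊆
      {x | ENNReal.ofReal (t / 2) < hlMax d L (fun y => ENNReal.ofReal (hi y)) x} ∪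
        {x | ENNReal.ofReal (t / 2) < boxSup d S θ lo x} := by
    intro x hx
    by_contra hn
    rw [Set.mem_union, not_or] at hn
    have h1 : hlMax d L (fun y => ENNReal.ofReal (hi y)) x ≤ ENNReal.ofReal (t / 2) :=
      not_lt.1 hn.1
    have h2 : boxSup d S θ lo x ≤ ENNReal.ofReal (t / 2) := not_lt.1 hn.2
    have h3 : boxSup d S θ h x ≤ ENNReal.ofReal t := by
      calc boxSup d S θ h x = boxSup d S θ (fun x => hi x + lo x) x := by rw [← hsplit]
        _ ≤ boxSup d S θ hi x + boxSup d S θ lo x := boxSup_add_le S θ hi lo x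
        _ ≤ ENNReal.ofReal (t / 2) + ENNReal.ofReal (t / 2) :=
          add_le_add ((hL θ hi hhi0 x).trans h1) h2
        _ = ENNReal.ofReal t := by
          rw [← ENNReal.ofReal_add (by positivity) (by positivity)]; congr 1; ring
    exact absurd (ENNReal.toReal_le_of_le_ofReal ht.le h3) (not_le.2 hx)
  have hA : MeasureTheory.Measure.count
      {x | ENNReal.ofReal (t / 2) < hlMax d L (fun y => ENNReal.ofReal (hi y)) x} ≤
      ENNReal.ofReal (2 * 21 ^ d / t) *
        ∑' x, if κ * t < h x then ENNReal.ofReal (h x) else 0 := by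
    have h1 := hlMax_weak d L (fun y => ENNReal.ofReal (hi y)) (ENNReal.ofReal (t / 2))
    have h2 : ∑' x, ENNReal.ofReal (hi x) =
        ∑' x, if κ * t < h x then ENNReal.ofReal (h x) else 0 := by
      refine tsum_congr fun x => ?_
      simp only [hhi]; split_ifs <;> simp
    rw [h2, mul_comm, ← ENNReal.le_div_iff_mul_le (Or.inl ht2) (Or.inl ENNReal.ofReal_ne_top)] at h1
    refine h1.trans (le_of_eq ?_)
    rw [ENNReal.div_eq_inv_mul, ← mul_assoc]
    congr 1
    rw [← ENNReal.ofReal_inv_of_pos (by positivity),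
      show (21 : ℝ≥0∞) ^ d = ENNReal.ofReal (21 ^ d) by
        rw [ENNReal.ofReal_pow (by norm_num)]; norm_num, ← ENNReal.ofReal_mul (by positivity)]
    congr 1
    field_simp
  have hB : MeasureTheory.Measure.count {x | ENNReal.ofReal (t / 2) < boxSup d S θ lo x} ≤
      ENNReal.ofReal (4 * K ^ 2 / t ^ 2) *
        ∑' x, if h x ≤ κ * t then ENNReal.ofReal (h x ^ 2) else 0 := by
    have h1 := (mul_count_lt_le (boxSup d S θ lo) (ENNReal.ofReal (t / 2))).trans
      (boxSup_tsum_sq_le hK H)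
    have h2 : ∑' x, ENNReal.ofReal (lo x ^ 2) =
        ∑' x, if h x ≤ κ * t then ENNReal.ofReal (h x ^ 2) else 0 := by
      refine tsum_congr fun x => ?_
      simp only [hlo]; split_ifs <;> simp
    rw [h2, mul_comm, ← ENNReal.le_div_iff_mul_le (Or.inl (pow_ne_zero 2 ht2))
      (Or.inl (ENNReal.pow_ne_top ENNReal.ofReal_ne_top))] at h1
    refine h1.trans (le_of_eq ?_)
    rw [ENNReal.div_eq_inv_mul, ← mul_assoc]
    congr 1
    rw [← ENNReal.ofReal_pow (by positivity), ← ENNReal.ofReal_inv_of_pos (by positivity),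
      ← ENNReal.ofReal_mul (by positivity)]
    congr 1
    field_simp
    norm_num
  exact (MeasureTheory.measure_mono hsub).trans ((MeasureTheory.measure_union_le _ _).trans
    (add_le_add hA hB))

/-- Interpolated maximal bound with enough decay to sum over all fractions. -/
theorem exists_lpNormE_boxSup_le {d : ℕ} (hd : 5 ≤ d) {p : ℝ} (hp : (d : ℝ) / (d - 2) < p)
    (hp2 : p < 2) : ∃ C δ : ℝ, 0 < C ∧ 0 < δ ∧
    ∀ (q a j : ℕ) (S : Finset ℕ) (β : ℕ → ℝ), 1 ≤ q → Nat.Coprime a q →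
      (∀ k ∈ S, IsOffset q j k (β k)) → ∀ h : (Fin d → ℤ) → ℝ, (∀ y, 0 ≤ h y) →
      lpNormE d p (boxSup d S (fun k => (a : ℝ) / q + β k) h) ≤
        ENNReal.ofReal (C * ((q : ℝ) * 2 ^ j) ^ (-(2 + δ))) *
          lpNormE d p (fun x => ENNReal.ofReal (h x)) := by
  have hd5 : (5 : ℝ) ≤ d := by exact_mod_cast hd
  have hd2 : (0 : ℝ) < d - 2 := by linarith
  have hp1 : 1 < p := lt_trans (by rw [one_lt_div hd2]; linarith) hp
  have hp0 : 0 < p := by linarith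
  have hp3 : 0 < 2 - p := by linarith
  have hp4 : 0 < p - 1 := by linarith
  rw [div_lt_iff₀ hd2] at hp
  set δ := (d * (p - 1) / p - 2) / 2 with hδ
  have hδ0 : 0 < δ := by
    have : 2 < d * (p - 1) / p := by rw [lt_div_iff₀ hp0]; linarith
    rw [hδ]; linarith
  set η := min (1 / 2) (δ / 2) with hη
  have hη0 : 0 < η := lt_min (by norm_num) (by linarith)
  have hη1 : η < 1 := (min_le_left _ _).trans_lt (by norm_num)
  obtain ⟨C, hC, H⟩ := lpNormE_iSup_boxKer d hη0 hη1
  set C' := (p * (2 * 21 ^ d / (p - 1) + 4 / (2 - p))) ^ (1 / p) with hC'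
  refine ⟨C' * C ^ (2 * (p - 1) / p), δ, by positivity, hδ0, fun q a j S β hq ha hβ h h0 => ?_⟩
  have hq1 : (1 : ℝ) ≤ q := by exact_mod_cast hq
  set X : ℝ := q * 2 ^ j with hX
  have hX1 : 1 ≤ X := one_le_mul_of_one_le_of_one_le hq1 (one_le_pow₀ (by norm_num))
  have hX0 : 0 < X := by linarith
  refine (boxSup_tsum_rpow_le hp1 hp2 (by positivity) (H q a j S β hq ha hβ) h0).trans ?_
  refine mul_le_mul (ENNReal.ofReal_le_ofReal ?_) le_rfl bot_le bot_le
  rw [mul_assoc]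
  refine mul_le_mul_of_nonneg_left ?_ (by positivity)
  rw [Real.mul_rpow (by positivity) (by positivity), ← Real.rpow_mul hX0.le]
  refine mul_le_mul_of_nonneg_left (Real.rpow_le_rpow_of_exponent_le hX1 ?_) (by positivity)
  have e : (η - d / 2) * (2 * (p - 1) / p) = 2 * η * ((p - 1) / p) - d * (p - 1) / p := by ring
  have h1 : (p - 1) / p ≤ 1 := by rw [div_le_one hp0]; linarith
  have h2 : 2 * η ≤ δ := by linarith [min_le_right (1 / 2) (δ / 2)]
  have h3 : 2 * η * ((p - 1) / p) ≤ 2 * η := mul_le_of_le_one_right (by positivity) h1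
  rw [e]
  have : d * (p - 1) / p = 2 * δ + 2 := by rw [hδ]; ring
  linarith

theorem exists_isOffset (k : ℕ) {θ : ℝ} (h0 : 0 ≤ θ) (h1 : θ < 1) : ∃ q a j : ℕ, 1 ≤ q ∧
    Nat.Coprime a q ∧ a ≤ q ∧ IsOffset q j k (θ - a / q) := by
  set L : ℕ := 2 ^ (k + 2) + 1 with hL
  have hLr : (L : ℝ) = 2 ^ (k + 2) + 1 := by rw [hL]; push_cast; ring
  have hL1 : 1 ≤ L := by rw [hL]; exact Nat.le_add_left _ _
  obtain ⟨r, hr, hrd⟩ := Real.exists_rat_abs_sub_le_and_den_le θ (n := 8 * L) (by omega)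
  have hq1 : 1 ≤ r.den := r.pos
  have hq0 : (0 : ℝ) < r.den := by exact_mod_cast r.pos
  have hn0 : (0 : ℝ) < ((8 * L : ℕ) : ℝ) + 1 := by positivity
  have hnum : (r : ℝ) = r.num / r.den := by exact_mod_cast (Rat.num_div_den r).symm
  have hr' : |θ * r.den - r.num| * (((8 * L : ℕ) : ℝ) + 1) ≤ 1 := by
    rw [le_div_iff₀ (by positivity)] at hr
    have e : θ * r.den - r.num = (θ - r) * r.den := by rw [hnum]; field_simp
    rw [e, abs_mul, abs_of_pos hq0]
    linarith
  have hlt : |θ * r.den - r.num| < 1 := by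
    have h8 : (1 : ℝ) ≤ ((8 * L : ℕ) : ℝ) := by
      have : 1 ≤ 8 * L := by omega
      exact_mod_cast this
    nlinarith [abs_nonneg (θ * r.den - r.num)]
  rw [abs_lt] at hlt
  have hnum0 : 0 ≤ r.num := by
    have h2 : 0 ≤ θ * r.den := by positivity
    have : (-1 : ℝ) < r.num := by linarith
    have : (-1 : ℤ) < r.num := by exact_mod_cast this
    omega
  have hnumq : r.num ≤ r.den := by
    have h2 : θ * r.den ≤ 1 * r.den := mul_le_mul_of_nonneg_right h1.le hq0.le
    have : (r.num : ℝ) < r.den + 1 := by linarith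
    have : r.num < r.den + 1 := by exact_mod_cast this
    omega
  have ha : ((r.num.toNat : ℕ) : ℤ) = r.num := Int.toNat_of_nonneg hnum0
  have ha' : ((r.num.toNat : ℕ) : ℝ) = r.num := by exact_mod_cast ha
  have hβ : θ - (r.num.toNat : ℕ) / r.den = θ - r := by rw [ha', hnum]
  have hsmall : |θ - r| * (8 * r.den * (2 ^ (k + 2) + 1)) ≤ 1 := by
    rw [le_div_iff₀ (by positivity)] at hr
    push_cast at hr
    rw [hLr] at hr
    have : 0 ≤ |θ - r| * r.den := by positivity
    linarith
  have hden : (r.den : ℝ) ≤ 16 * (2 ^ (k + 2) + 1) := by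
    have : (r.den : ℝ) ≤ ((8 * L : ℕ) : ℝ) := by exact_mod_cast hrd
    push_cast at this
    rw [hLr] at this
    have h3 : (0 : ℝ) < 2 ^ (k + 2) := by positivity
    linarith
  have hcop : Nat.Coprime r.num.toNat r.den := by
    have := r.reduced
    rwa [show r.num.natAbs = r.num.toNat by omega] at this
  have haq : r.num.toNat ≤ r.den := by omega
  rcases le_or_gt (|θ - r| * 4 ^ k) 1 with h | h
  · refine ⟨r.den, r.num.toNat, 0, hq1, hcop, haq, ?_⟩
    rw [hβ]
    exact ⟨hsmall, hden, by simpa using h, Or.inl rfl⟩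
  · obtain ⟨n, hn1, hn2⟩ := exists_nat_pow_near h.le (one_lt_two (α := ℝ))
    refine ⟨r.den, r.num.toNat, n + 1, hq1, hcop, haq, ?_⟩
    rw [hβ]
    refine ⟨hsmall, hden, hn2.le, Or.inr ?_⟩
    rw [pow_succ]; linarith

/-- The number of equally spaced frequencies used at scale `2^k`. -/
def freqCount (d k : ℕ) : ℕ := (d + 1) * 4 ^ (k + 1)

/-- The offset from `a / q` of the `i`-th frequency, counted from the left end of a window of
`2 N + 1` frequencies around `a / q`. -/
def freqOffset (d q a N i k : ℕ) : ℝ :=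
  ((⌊(freqCount d k : ℝ) * (a / q)⌋ : ℝ) - N + i) / freqCount d k - a / q

theorem exists_freqOffset (d k t : ℕ) (ht : t < freqCount d k) : ∃ q a j i : ℕ, 1 ≤ q ∧
    Nat.Coprime a q ∧ a ≤ q ∧ i < 2 * (4 * (d + 1) * 2 ^ j) + 1 ∧
    (t : ℝ) / freqCount d k = a / q + freqOffset d q a (4 * (d + 1) * 2 ^ j) i k ∧
    IsOffset q j k (freqOffset d q a (4 * (d + 1) * 2 ^ j) i k) := by
  set P := freqCount d k with hP
  have hP0 : (0 : ℝ) < P := by exact_mod_cast (by omega : 0 < P)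
  obtain ⟨q, a, j, hq, hcop, haq, hoff⟩ := exists_isOffset k (θ := (t : ℝ) / P) (by positivity)
    (by rw [div_lt_one hP0]; exact_mod_cast ht)
  set N := 4 * (d + 1) * 2 ^ j with hN
  set y : ℝ := P * (a / q) with hy
  have hty : |(t : ℝ) - y| ≤ N := by
    have e : (t : ℝ) - y = ((t : ℝ) / P - a / q) * P := by rw [hy]; field_simp
    rw [e, abs_mul, abs_of_pos hP0]
    have hPr : (P : ℝ) = 4 * (d + 1) * 4 ^ k := by
      rw [hP, freqCount]; push_cast; ring
    have := mul_le_mul_of_nonneg_left hoff.le (by positivity : (0 : ℝ) ≤ 4 * (d + 1))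
    have hNr : (N : ℝ) = 4 * (d + 1) * 2 ^ j := by rw [hN]; push_cast; ring
    calc |(t : ℝ) / P - a / q| * (P : ℝ) = |(t : ℝ) / P - a / q| * (4 * (d + 1) * 4 ^ k) :=
          congrArg _ hPr
      _ ≤ N := by rw [hNr]; linarith
  rw [abs_le] at hty
  have hz1 := Int.floor_le y
  have hz2 := Int.lt_floor_add_one y
  have hi0 : 0 ≤ (t : ℤ) - ⌊y⌋ + N := by
    have : (0 : ℝ) ≤ ((t : ℤ) - ⌊y⌋ + N : ℤ) := by push_cast; linarith
    exact_mod_cast this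
  have hi1 : (t : ℤ) - ⌊y⌋ + N < 2 * N + 1 := by
    have : (((t : ℤ) - ⌊y⌋ + N : ℤ) : ℝ) < (2 * N + 1 : ℤ) := by push_cast; linarith
    exact_mod_cast this
  have hi : ((((t : ℤ) - ⌊y⌋ + N).toNat : ℕ) : ℝ) = (t : ℝ) - ⌊y⌋ + N := by
    have : ((((t : ℤ) - ⌊y⌋ + N).toNat : ℕ) : ℤ) = (t : ℤ) - ⌊y⌋ + N := Int.toNat_of_nonneg hi0
    exact_mod_cast this
  have hf : freqOffset d q a N ((t : ℤ) - ⌊y⌋ + N).toNat k = (t : ℝ) / P - a / q := by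
    rw [freqOffset, hi, ← hP, ← hy]
    congr 2; ring
  refine ⟨q, a, j, ((t : ℤ) - ⌊y⌋ + N).toNat, hq, hcop, haq, by omega, ?_, ?_⟩
  · rw [hf]; ring
  · rw [hf]; exact hoff

theorem tsum_frac_weight_ne_top {δ : ℝ} (hδ : 0 < δ) :
    ∑' c : ℕ × ℕ, (if c.2 ≤ c.1 then ENNReal.ofReal ((c.1 : ℝ) ^ (-(2 + δ))) else 0) ≠ ⊤ := by
  rw [ENNReal.tsum_prod']
  have h1 : ∀ q : ℕ, ∑' a : ℕ, (if a ≤ q then ENNReal.ofReal ((q : ℝ) ^ (-(2 + δ))) else 0) ≤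
      ENNReal.ofReal (2 * (q : ℝ) ^ (-(1 + δ))) := fun q => by
    rw [tsum_eq_sum (s := Finset.range (q + 1)) (fun a ha => by
      rw [if_neg]; simpa [Nat.lt_succ_iff] using ha)]
    rw [Finset.sum_congr rfl (g := fun _ => ENNReal.ofReal ((q : ℝ) ^ (-(2 + δ))))
      (fun a ha => if_pos (Nat.lt_succ_iff.1 (Finset.mem_range.1 ha))), Finset.sum_const,
      Finset.card_range, nsmul_eq_mul, ← ENNReal.ofReal_natCast, ← ENNReal.ofReal_mul (by positivity)]
    refine ENNReal.ofReal_le_ofReal ?_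
    rcases Nat.eq_zero_or_pos q with h | h
    · subst h
      rw [Nat.cast_zero, Real.zero_rpow (by linarith)]
      simp
      positivity
    · have hq : (0 : ℝ) < q := by exact_mod_cast h
      have hq1 : (1 : ℝ) ≤ q := by exact_mod_cast h
      have e : (q : ℝ) ^ (-(1 + δ)) = q * (q : ℝ) ^ (-(2 + δ)) := by
        rw [show -(1 + δ) = 1 + -(2 + δ) by ring, Real.rpow_add hq, Real.rpow_one]
      rw [e, ← mul_assoc]
      refine mul_le_mul_of_nonneg_right ?_ (by positivity)
      push_cast; linarith
  refine ne_top_of_le_ne_top ?_ (ENNReal.tsum_le_tsum h1)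
  have hs : Summable fun q : ℕ => 2 * (q : ℝ) ^ (-(1 + δ)) :=
    (Real.summable_nat_rpow.2 (by linarith)).mul_left 2
  exact hs.tsum_ofReal_ne_top

theorem tsum_window_weight_ne_top (m : ℕ) {δ : ℝ} (hδ : 0 < δ) :
    ∑' c : ℕ × ℕ, (if c.2 < 2 * (m * 2 ^ c.1) + 1 then
      ENNReal.ofReal (((2 : ℝ) ^ c.1) ^ (-(2 + δ))) else 0) ≠ ⊤ := by
  rw [ENNReal.tsum_prod']
  set r : ℝ := (2 : ℝ) ^ (-(1 + δ)) with hr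
  have hr0 : 0 ≤ r := by positivity
  have hr1 : r < 1 := Real.rpow_lt_one_of_one_lt_of_neg (by norm_num) (by linarith)
  have h1 : ∀ j : ℕ, ∑' i : ℕ, (if i < 2 * (m * 2 ^ j) + 1 then
      ENNReal.ofReal (((2 : ℝ) ^ j) ^ (-(2 + δ))) else 0) ≤
      ENNReal.ofReal ((2 * m + 1) * r ^ j) := fun j => by
    rw [tsum_eq_sum (s := Finset.range (2 * (m * 2 ^ j) + 1)) (fun a ha => by
      rw [if_neg]; simpa using ha)]
    rw [Finset.sum_congr rfl (g := fun _ => ENNReal.ofReal (((2 : ℝ) ^ j) ^ (-(2 + δ))))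
      (fun a ha => if_pos (Finset.mem_range.1 ha)), Finset.sum_const,
      Finset.card_range, nsmul_eq_mul, ← ENNReal.ofReal_natCast, ← ENNReal.ofReal_mul (by positivity)]
    refine ENNReal.ofReal_le_ofReal ?_
    have hj : (1 : ℝ) ≤ 2 ^ j := one_le_pow₀ (by norm_num)
    have e : r ^ j = 2 ^ j * ((2 : ℝ) ^ j) ^ (-(2 + δ)) := by
      have e1 : r ^ j = ((2 : ℝ) ^ j) ^ (-(1 + δ)) := by
        rw [hr, ← Real.rpow_natCast, ← Real.rpow_natCast, ← Real.rpow_mul (zero_le_two (α := ℝ)),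
          ← Real.rpow_mul (zero_le_two (α := ℝ)), mul_comm]
      rw [e1, show -(1 + δ) = 1 + -(2 + δ) by ring, Real.rpow_add (by positivity), Real.rpow_one]
    rw [e, ← mul_assoc (2 * (m : ℝ) + 1)]
    have hw : (0 : ℝ) ≤ ((2 : ℝ) ^ j) ^ (-(2 + δ)) := by positivity
    refine mul_le_mul_of_nonneg_right ?_ hw
    push_cast; nlinarith
  refine ne_top_of_le_ne_top ?_ (ENNReal.tsum_le_tsum h1)
  have hs : Summable fun j : ℕ => (2 * (m : ℝ) + 1) * r ^ j :=
    (summable_geometric_of_lt_one hr0 hr1).mul_left _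
  exact hs.tsum_ofReal_ne_top

/-- The sum over all frequencies at scale `2^k` of the moduli of the phase averages. -/
def freqSum (d k : ℕ) (h : (Fin d → ℤ) → ℝ) (x : Fin d → ℤ) : ℝ≥0∞ :=
  ∑ t ∈ Finset.range (freqCount d k), ‖boxSum d ((t : ℝ) / freqCount d k) k h x‖ₑ

theorem exists_lpNormE_iSup_freqSum_le {d : ℕ} (hd : 5 ≤ d) {p : ℝ} (hp : (d : ℝ) / (d - 2) < p)
    (hp2 : p < 2) : ∃ C : ℝ≥0, ∀ (L : ℕ) (h : (Fin d → ℤ) → ℝ), (∀ y, 0 ≤ h y) →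
      lpNormE d p (fun x => ⨆ k ∈ Finset.range L, freqSum d k h x) ≤
        C * lpNormE d p (fun x => ENNReal.ofReal (h x)) := by
  classical
  have hd5 : (5 : ℝ) ≤ d := by exact_mod_cast hd
  have hd2 : (0 : ℝ) < d - 2 := by linarith
  have hp1 : 1 < p := lt_trans (by rw [one_lt_div hd2]; linarith) hp
  obtain ⟨C, δ, hC, hδ, H⟩ := exists_lpNormE_boxSup_le hd hp hp2
  set m := 4 * (d + 1) with hm
  set u : ℕ × ℕ → ℝ≥0∞ := fun c =>
    if c.2 ≤ c.1 then ENNReal.ofReal ((c.1 : ℝ) ^ (-(2 + δ))) else 0 with hu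
  set v : ℕ × ℕ → ℝ≥0∞ := fun c => if c.2 < 2 * (m * 2 ^ c.1) + 1 then
    ENNReal.ofReal (((2 : ℝ) ^ c.1) ^ (-(2 + δ))) else 0 with hv
  set B : ℝ≥0∞ := ENNReal.ofReal C * ((∑' c, u c) * ∑' c, v c) with hB
  have hBtop : B ≠ ⊤ := ENNReal.mul_ne_top ENNReal.ofReal_ne_top
    (ENNReal.mul_ne_top (tsum_frac_weight_ne_top hδ) (tsum_window_weight_ne_top m hδ))
  refine ⟨B.toNNReal, fun L h h0 => ?_⟩
  rw [ENNReal.coe_toNNReal hBtop]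
  have hex : ∀ k t, ∃ c : (ℕ × ℕ) × ℕ × ℕ, t < freqCount d k → 1 ≤ c.1.1 ∧
      Nat.Coprime c.1.2 c.1.1 ∧ c.1.2 ≤ c.1.1 ∧ c.2.2 < 2 * (m * 2 ^ c.2.1) + 1 ∧
      (t : ℝ) / freqCount d k = c.1.2 / c.1.1 + freqOffset d c.1.1 c.1.2 (m * 2 ^ c.2.1) c.2.2 k ∧
      IsOffset c.1.1 c.2.1 k (freqOffset d c.1.1 c.1.2 (m * 2 ^ c.2.1) c.2.2 k) := by
    intro k t
    by_cases ht : t < freqCount d k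
    · obtain ⟨q, a, j, i, hh⟩ := exists_freqOffset d k t ht
      exact ⟨((q, a), (j, i)), fun _ => hh⟩
    · exact ⟨((0, 0), (0, 0)), fun h => absurd h ht⟩
  choose c hc using hex
  set 𝒞 : Finset ((ℕ × ℕ) × ℕ × ℕ) := (Finset.range L).biUnion fun k =>
    (Finset.range (freqCount d k)).image (c k) with h𝒞
  set β : (ℕ × ℕ) × ℕ × ℕ → ℕ → ℝ := fun c k =>
    freqOffset d c.1.1 c.1.2 (m * 2 ^ c.2.1) c.2.2 k with hβ
  set S : (ℕ × ℕ) × ℕ × ℕ → Finset ℕ := fun c =>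
    (Finset.range L).filter fun k => IsOffset c.1.1 c.2.1 k (β c k) with hS
  set U : (ℕ × ℕ) × ℕ × ℕ → (Fin d → ℤ) → ℝ≥0∞ := fun c =>
    boxSup d (S c) (fun k => (c.1.2 : ℝ) / c.1.1 + β c k) h with hU
  have hpt : ∀ x, (⨆ k ∈ Finset.range L, freqSum d k h x) ≤ ∑ c ∈ 𝒞, U c x := by
    intro x
    refine iSup₂_le fun k hk => ?_
    have hinj : Set.InjOn (c k) (Finset.range (freqCount d k)) := by
      intro t ht t' ht' he
      have ht1 : t < freqCount d k := by simpa using ht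
      have ht2 : t' < freqCount d k := by simpa using ht'
      have e1 := (hc k t ht1).2.2.2.2.1
      have e2 := (hc k t' ht2).2.2.2.2.1
      rw [he, ← e2] at e1
      have hP0 : (freqCount d k : ℝ) ≠ 0 := by
        have : 0 < freqCount d k := by omega
        positivity
      have e3 := (div_left_inj' hP0).1 e1
      exact_mod_cast e3
    have hle : ∀ t ∈ Finset.range (freqCount d k),
        ‖boxSum d ((t : ℝ) / freqCount d k) k h x‖ₑ ≤ U (c k t) x := fun t ht => by
      have hh := hc k t (Finset.mem_range.1 ht)
      have hkS : k ∈ S (c k t) := Finset.mem_filter.2 ⟨hk, hh.2.2.2.2.2⟩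
      rw [hh.2.2.2.2.1]
      exact le_iSup₂ (f := fun l (_ : l ∈ S (c k t)) =>
        ‖boxSum d (((c k t).1.2 : ℝ) / (c k t).1.1 + β (c k t) l) l h x‖ₑ) k hkS
    refine (Finset.sum_le_sum hle).trans ?_
    rw [← Finset.sum_image (f := fun c => U c x) hinj]
    exact Finset.sum_le_sum_of_subset (Finset.subset_biUnion_of_mem
      (fun k => (Finset.range (freqCount d k)).image (c k)) hk)
  have hUb : ∀ c ∈ 𝒞, lpNormE d p (U c) ≤
      ENNReal.ofReal C * (u c.1 * v c.2) * lpNormE d p (fun x => ENNReal.ofReal (h x)) := by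
    intro c' hc'
    obtain ⟨k, hk, hc'⟩ := Finset.mem_biUnion.1 hc'
    obtain ⟨t, ht, rfl⟩ := Finset.mem_image.1 hc'
    obtain ⟨h1, h2, h3, h4, -, -⟩ := hc k t (Finset.mem_range.1 ht)
    refine (H _ _ (c k t).2.1 (S (c k t)) (β (c k t)) h1 h2
      (fun l hl => (Finset.mem_filter.1 hl).2) h h0).trans ?_
    refine mul_le_mul (le_of_eq ?_) le_rfl bot_le bot_le
    simp only [hu, hv]
    rw [if_pos h3, if_pos h4, Real.mul_rpow (by positivity) (by positivity),
      ENNReal.ofReal_mul hC.le, ENNReal.ofReal_mul (by positivity)]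
  refine (lpNormE_mono (by linarith) hpt).trans ((lpNormE_sum_le hp1.le 𝒞 U).trans
    ((Finset.sum_le_sum hUb).trans ?_))
  rw [← Finset.sum_mul, ← Finset.mul_sum]
  refine mul_le_mul (mul_le_mul le_rfl ?_ bot_le bot_le) le_rfl bot_le bot_le
  refine (ENNReal.sum_le_tsum _).trans (le_of_eq ?_)
  rw [ENNReal.tsum_prod (f := fun a b => u a * v b)]
  simp_rw [ENNReal.tsum_mul_left, ENNReal.tsum_mul_right]

/-- The points of the sphere `|v|² = m` inside the box of side comparable to `2^k`. -/
def boxSphere (d k m : ℕ) : Finset (Fin d → ℤ) :=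
  (latticeBox d (2 ^ (k + 1))).filter fun v => normSq v = (m : ℤ)

/-- The truncated linear spherical maximal operator, with all radii `m < 4^(k+1)` normalized by
`2^(k (d - 2))`. -/
def sphMax (d L : ℕ) (h : (Fin d → ℤ) → ℝ≥0∞) (x : Fin d → ℤ) : ℝ≥0∞ :=
  ⨆ k ∈ Finset.range L, ⨆ m ∈ Finset.range (4 ^ (k + 1)),
    ((2 : ℝ≥0∞) ^ (k * (d - 2)))⁻¹ * ∑ v ∈ boxSphere d k m, h (x - v)

theorem sum_boxSphere_le_sphMax {d L k m : ℕ} (hk : k < L) (hm : m < 4 ^ (k + 1))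
    (h : (Fin d → ℤ) → ℝ≥0∞) (x : Fin d → ℤ) :
    ((2 : ℝ≥0∞) ^ (k * (d - 2)))⁻¹ * ∑ v ∈ boxSphere d k m, h (x - v) ≤ sphMax d L h x :=
  le_trans (le_iSup₂ (f := fun m (_ : m ∈ Finset.range (4 ^ (k + 1))) =>
      ((2 : ℝ≥0∞) ^ (k * (d - 2)))⁻¹ * ∑ v ∈ boxSphere d k m, h (x - v)) m (Finset.mem_range.2 hm))
    (le_iSup₂ (f := fun k (_ : k ∈ Finset.range L) => ⨆ m ∈ Finset.range (4 ^ (k + 1)),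
      ((2 : ℝ≥0∞) ^ (k * (d - 2)))⁻¹ * ∑ v ∈ boxSphere d k m, h (x - v)) k (Finset.mem_range.2 hk))

theorem sphMax_mono_left (d : ℕ) (h : (Fin d → ℤ) → ℝ≥0∞) (x : Fin d → ℤ) :
    Monotone fun L => sphMax d L h x := fun _ _ hL =>
  biSup_mono fun _ hk => Finset.mem_range.2 ((Finset.mem_range.1 hk).trans_le hL)

theorem hlMax_mono_left (d : ℕ) (h : (Fin d → ℤ) → ℝ≥0∞) (x : Fin d → ℤ) :
    Monotone fun L => hlMax d L h x := fun _ _ hL =>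
  biSup_mono fun _ hk => Finset.mem_range.2 ((Finset.mem_range.1 hk).trans_le hL)

theorem sum_range_expi_div {P : ℕ} {n : ℤ} (hn : |n| < P) :
    ∑ t ∈ Finset.range P, expi ((t : ℝ) / P * n) = if n = 0 then (P : ℂ) else 0 := by
  have hP : 0 < (P : ℤ) := lt_of_le_of_lt (abs_nonneg n) hn
  have hP0 : (P : ℝ) ≠ 0 := by
    have : P ≠ 0 := by omega
    exact_mod_cast this
  split_ifs with h
  · subst h; simp
  · have e : ∀ t : ℕ, expi ((t : ℝ) / P * n) = expi ((n : ℝ) / P) ^ t := fun t => by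
      rw [← expi_nat_mul]; congr 1; ring
    simp_rw [e]
    have hne : expi ((n : ℝ) / P) ≠ 1 := by
      intro h1
      rw [expi, Complex.exp_eq_one_iff] at h1
      obtain ⟨z, hz⟩ := h1
      have hz' : (((2 * Real.pi * ((n : ℝ) / P) : ℝ)) : ℂ) = ((z * (2 * Real.pi) : ℝ) : ℂ) := by
        have : ((2 * Real.pi * ((n : ℝ) / P) : ℝ) : ℂ) * Complex.I =
            ((z * (2 * Real.pi) : ℝ) : ℂ) * Complex.I := by
          rw [hz]; push_cast; ring
        exact mul_right_cancel₀ Complex.I_ne_zero this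
      have hz2 : 2 * Real.pi * ((n : ℝ) / P) = z * (2 * Real.pi) := by exact_mod_cast hz'
      have hpi := Real.pi_pos
      have hz3 : (n : ℝ) / P = z := by
        have : 2 * Real.pi * ((n : ℝ) / P) = 2 * Real.pi * z := by rw [hz2]; ring
        exact mul_left_cancel₀ (by positivity) this
      rw [div_eq_iff hP0] at hz3
      have hz4 : n = z * P := by exact_mod_cast hz3
      rw [hz4, abs_mul, abs_of_pos hP] at hn
      have hz5 : |z| < 1 := by
        by_contra hc
        push Not at hc
        nlinarith
      rw [Int.abs_lt_one_iff] at hz5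
      exact h (by rw [hz4, hz5, zero_mul])
    rw [geom_sum_eq hne, ← expi_nat_mul, mul_div_cancel₀ _ hP0, expi_int]
    simp

theorem normSq_le_of_mem_latticeBox {d R : ℕ} {v : Fin d → ℤ} (hv : v ∈ latticeBox d R) :
    normSq v ≤ d * (R : ℤ) ^ 2 := by
  rw [mem_latticeBox] at hv
  refine (Finset.sum_le_sum (g := fun _ => (R : ℤ) ^ 2) fun i _ => ?_).trans (by simp)
  exact sq_le_sq' (hv i).1 (hv i).2

theorem normSq_nonneg {d : ℕ} (v : Fin d → ℤ) : 0 ≤ normSq v :=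
  Finset.sum_nonneg fun i _ => sq_nonneg (v i)

theorem freqCount_mul_sum_boxSphere {d k m : ℕ} (hm : m < 4 ^ (k + 1))
    (h : (Fin d → ℤ) → ℝ) (x : Fin d → ℤ) :
    (freqCount d k : ℂ) * (∑ v ∈ boxSphere d k m, (h (x - v) : ℂ)) =
      2 ^ (k * d) * ∑ t ∈ Finset.range (freqCount d k), expi (-((t : ℝ) / freqCount d k * m)) *
        boxSum d ((t : ℝ) / freqCount d k) k h x := by
  set P := freqCount d k with hP
  have hsmall : ∀ v ∈ latticeBox d (2 ^ (k + 1)), |normSq v - (m : ℤ)| < P := fun v hv => by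
    have h1 := normSq_le_of_mem_latticeBox hv
    have h2 := normSq_nonneg v
    have e : (((2 ^ (k + 1) : ℕ) : ℤ)) ^ 2 = 4 ^ (k + 1) := by
      push_cast; rw [← pow_mul, mul_comm, pow_mul]; norm_num
    rw [e] at h1
    have hm' : (m : ℤ) < 4 ^ (k + 1) := by exact_mod_cast hm
    have h0 : (0 : ℤ) ≤ m := by positivity
    have hPe : (P : ℤ) = d * 4 ^ (k + 1) + 4 ^ (k + 1) := by rw [hP, freqCount]; push_cast; ring
    have h3 : (0 : ℤ) ≤ d * 4 ^ (k + 1) := by positivity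
    have h4 : (0 : ℤ) < 4 ^ (k + 1) := by positivity
    rw [abs_lt]; constructor <;> linarith
  have key : ∀ v ∈ latticeBox d (2 ^ (k + 1)),
      (if normSq v = (m : ℤ) then (P : ℂ) * (h (x - v) : ℂ) else 0) =
      ∑ t ∈ Finset.range P, expi (-((t : ℝ) / P * m)) *
        (expi ((t : ℝ) / P * normSq v) * (h (x - v) : ℂ)) := fun v hv => by
    have e : ∀ t : ℕ, expi (-((t : ℝ) / P * m)) * (expi ((t : ℝ) / P * normSq v) *
        (h (x - v) : ℂ)) = expi ((t : ℝ) / P * ((normSq v - (m : ℤ) : ℤ) : ℝ)) *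
          (h (x - v) : ℂ) := fun t => by
      rw [← mul_assoc, ← expi_add]; congr 2; push_cast; ring
    simp_rw [e]
    rw [← Finset.sum_mul, sum_range_expi_div (hsmall v hv)]
    simp only [sub_eq_zero]
    split_ifs <;> simp
  rw [boxSphere, Finset.mul_sum, Finset.sum_filter, Finset.sum_congr rfl key, Finset.sum_comm,
    Finset.mul_sum]
  refine Finset.sum_congr rfl fun t _ => ?_
  have h2 : ((2 : ℂ) ^ (k * d)) ≠ 0 := pow_ne_zero _ two_ne_zero
  rw [boxSum, ← Finset.mul_sum]
  field_simp

theorem sphMax_le_iSup_freqSum {d : ℕ} (hd : 2 ≤ d) (L : ℕ) {h : (Fin d → ℤ) → ℝ}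
    (h0 : ∀ y, 0 ≤ h y) (x : Fin d → ℤ) :
    sphMax d L (fun y => ENNReal.ofReal (h y)) x ≤ ⨆ k ∈ Finset.range L, freqSum d k h x := by
  refine iSup₂_mono fun k hk => iSup₂_le fun m hm => ?_
  have e := congrArg (fun z : ℂ => ‖z‖ₑ) (freqCount_mul_sum_boxSphere (Finset.mem_range.1 hm) h x)
  simp only [enorm_mul] at e
  have e1 : ‖∑ v ∈ boxSphere d k m, (h (x - v) : ℂ)‖ₑ =
      ∑ v ∈ boxSphere d k m, ENNReal.ofReal (h (x - v)) := by
    rw [← Complex.ofReal_sum, ← ofReal_norm, Complex.norm_real, Real.norm_eq_abs,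
      abs_of_nonneg (Finset.sum_nonneg fun v _ => h0 _),
      ENNReal.ofReal_sum_of_nonneg fun v _ => h0 _]
  have e2 : ‖(freqCount d k : ℂ)‖ₑ = (freqCount d k : ℝ≥0∞) := by
    rw [← ofReal_norm, Complex.norm_natCast, ENNReal.ofReal_natCast]
  have e3 : ‖(2 : ℂ) ^ (k * d)‖ₑ = (2 : ℝ≥0∞) ^ (k * d) := by
    rw [← ofReal_norm, norm_pow, Complex.norm_ofNat, ENNReal.ofReal_pow (by norm_num)]
    norm_num
  have e4 : ‖∑ t ∈ Finset.range (freqCount d k), expi (-((t : ℝ) / freqCount d k * m)) *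
        boxSum d ((t : ℝ) / freqCount d k) k h x‖ₑ ≤ freqSum d k h x := by
    refine (enorm_sum_le _ _).trans (Finset.sum_le_sum fun t _ => le_of_eq ?_)
    rw [enorm_mul, ← ofReal_norm (expi _), norm_expi, ENNReal.ofReal_one, one_mul]
  rw [e1, e2, e3] at e
  have hA : (2 : ℝ≥0∞) ^ (k * (d - 2)) ≠ 0 := by positivity
  have hA' : (2 : ℝ≥0∞) ^ (k * (d - 2)) ≠ ⊤ := ENNReal.pow_ne_top (by norm_num)
  rw [ENNReal.inv_mul_le_iff hA hA']
  have hB : (4 : ℝ≥0∞) ^ k ≠ 0 := by positivity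
  have hB' : (4 : ℝ≥0∞) ^ k ≠ ⊤ := ENNReal.pow_ne_top (by norm_num)
  rw [← ENNReal.mul_le_mul_iff_right hB hB']
  have hPB : (4 : ℝ≥0∞) ^ k ≤ freqCount d k := by
    have : 4 ^ k ≤ freqCount d k := by
      rw [freqCount, pow_succ]; nlinarith [Nat.zero_le (4 ^ k)]
    exact_mod_cast this
  have e5 : (4 : ℝ≥0∞) ^ k * (2 : ℝ≥0∞) ^ (k * (d - 2)) = 2 ^ (k * d) := by
    rw [show (4 : ℝ≥0∞) = 2 ^ 2 by norm_num, ← pow_mul, ← pow_add]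
    congr 1
    obtain ⟨c, rfl⟩ := Nat.exists_eq_add_of_le hd
    rw [Nat.add_sub_cancel_left]; ring
  calc _ ≤ (freqCount d k : ℝ≥0∞) * ∑ v ∈ boxSphere d k m, ENNReal.ofReal (h (x - v)) :=
        mul_le_mul hPB le_rfl bot_le bot_le
    _ ≤ 2 ^ (k * d) * freqSum d k h x := by rw [e]; exact mul_le_mul le_rfl e4 bot_le bot_le
    _ = _ := by rw [← mul_assoc, e5]

theorem exists_lpNormE_sphMax_le_of_lt_two {d : ℕ} (hd : 5 ≤ d) {p : ℝ}
    (hp : (d : ℝ) / (d - 2) < p) (hp2 : p < 2) : ∃ C : ℝ≥0, ∀ (L : ℕ) (h : (Fin d → ℤ) → ℝ≥0∞),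
      (∀ y, h y ≠ ⊤) → lpNormE d p (sphMax d L h) ≤ C * lpNormE d p h := by
  have hd5 : (5 : ℝ) ≤ d := by exact_mod_cast hd
  have hp0 : 0 < p := lt_trans (by apply div_pos <;> linarith) hp
  obtain ⟨C, H⟩ := exists_lpNormE_iSup_freqSum_le hd hp hp2
  refine ⟨C, fun L h hh => ?_⟩
  have e : h = fun y => ENNReal.ofReal ((h y).toReal) :=
    funext fun y => (ENNReal.ofReal_toReal (hh y)).symm
  rw [e]
  exact (lpNormE_mono hp0.le fun x => sphMax_le_iSup_freqSum (by omega) L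
    (fun y => ENNReal.toReal_nonneg) x).trans (H L _ fun y => ENNReal.toReal_nonneg)

theorem exists_card_boxSphere_le {d : ℕ} (hd : 5 ≤ d) : ∃ K : ℝ≥0, ∀ k m : ℕ, m < 4 ^ (k + 1) →
    ((2 : ℝ≥0∞) ^ (k * (d - 2)))⁻¹ * (boxSphere d k m).card ≤ K := by
  classical
  have hd5 : (5 : ℝ) ≤ d := by exact_mod_cast hd
  obtain ⟨p, hp, hp2⟩ := exists_between (show (d : ℝ) / (d - 2) < 2 by
    rw [div_lt_iff₀ (by linarith)]; linarith)
  have hp0 : 0 < p := lt_trans (by apply div_pos <;> linarith) hp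
  obtain ⟨C, H⟩ := exists_lpNormE_sphMax_le_of_lt_two hd hp hp2
  set K : ℝ≥0∞ := ((C : ℝ≥0∞) ^ p * 2 ^ d) ^ (1 / p) with hK
  have hKtop : K ≠ ⊤ := ENNReal.rpow_ne_top_of_nonneg (by positivity) (ENNReal.mul_ne_top
    (ENNReal.rpow_ne_top_of_nonneg hp0.le ENNReal.coe_ne_top) (ENNReal.pow_ne_top (by norm_num)))
  refine ⟨K.toNNReal, fun k m hm => ?_⟩
  rw [ENNReal.coe_toNNReal hKtop]
  set w : ℝ≥0∞ := ((2 : ℝ≥0∞) ^ (k * (d - 2)))⁻¹ * (boxSphere d k m).card with hw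
  set B₁ := latticeBox d (2 ^ (k + 1)) with hB₁
  set B₂ := latticeBox d (2 ^ (k + 2)) with hB₂
  set h : (Fin d → ℤ) → ℝ≥0∞ := fun x => if x ∈ B₂ then 1 else 0 with hh
  have h1 : ∀ x ∈ B₁, w ≤ sphMax d (k + 1) h x := fun x hx => by
    refine le_trans (le_of_eq ?_) (sum_boxSphere_le_sphMax (Nat.lt_succ_self k) hm h x)
    rw [hw, Finset.sum_congr rfl (g := fun _ => (1 : ℝ≥0∞))]
    · simp
    · intro v hv
      have hv1 := mem_latticeBox.1 (Finset.mem_filter.1 hv).1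
      have hx1 := mem_latticeBox.1 hx
      refine if_pos (mem_latticeBox.2 fun i => ?_)
      have := hv1 i
      have := hx1 i
      rw [Pi.sub_apply, pow_succ 2 (k + 1)]
      push_cast at *
      constructor <;> linarith
  have h2 : (B₁.card : ℝ≥0∞) * w ^ p ≤ lpNormE d p (sphMax d (k + 1) h) ^ p := by
    rw [lpNormE_rpow hp0]
    refine le_trans ?_ (ENNReal.sum_le_tsum B₁)
    rw [← nsmul_eq_mul, ← Finset.sum_const]
    exact Finset.sum_le_sum fun x hx => ENNReal.rpow_le_rpow (h1 x hx) hp0.le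
  have h3 : lpNormE d p h ^ p = (B₂.card : ℝ≥0∞) := by
    rw [lpNormE_rpow hp0, tsum_eq_sum (s := B₂) (fun x hx => by
      simp only [hh]; rw [if_neg hx, ENNReal.zero_rpow_of_pos hp0]),
      Finset.sum_congr rfl (g := fun _ => (1 : ℝ≥0∞)) (fun x hx => by
        simp only [hh]; rw [if_pos hx, ENNReal.one_rpow])]
    simp
  have h4 : (B₂.card : ℝ≥0∞) ≤ 2 ^ d * B₁.card := by
    have : B₂.card ≤ 2 ^ d * B₁.card := by
      rw [hB₁, hB₂, card_latticeBox, card_latticeBox, ← mul_pow]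
      refine Nat.pow_le_pow_left ?_ d
      rw [pow_succ 2 (k + 1)]; omega
    exact_mod_cast this
  have h5 := ENNReal.rpow_le_rpow (H (k + 1) h (fun y => by
    simp only [hh]; split_ifs <;> simp)) hp0.le
  rw [ENNReal.mul_rpow_of_nonneg _ _ hp0.le, h3] at h5
  have hc0 : (B₁.card : ℝ≥0∞) ≠ 0 := by
    rw [hB₁, card_latticeBox]; positivity
  have h6 : (B₁.card : ℝ≥0∞) * w ^ p ≤ B₁.card * ((C : ℝ≥0∞) ^ p * 2 ^ d) :=
    calc _ ≤ (C : ℝ≥0∞) ^ p * B₂.card := h2.trans h5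
      _ ≤ (C : ℝ≥0∞) ^ p * (2 ^ d * B₁.card) := mul_le_mul le_rfl h4 bot_le bot_le
      _ = _ := by ring
  rw [ENNReal.mul_le_mul_iff_right hc0 (ENNReal.natCast_ne_top _)] at h6
  rw [hK, one_div, ENNReal.le_rpow_inv_iff hp0]
  exact h6

theorem sphMax_rpow_le {d : ℕ} {K : ℝ≥0} (hK : ∀ k m : ℕ, m < 4 ^ (k + 1) →
    ((2 : ℝ≥0∞) ^ (k * (d - 2)))⁻¹ * (boxSphere d k m).card ≤ K) {s : ℝ} (hs : 1 ≤ s) (L : ℕ)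
    (h : (Fin d → ℤ) → ℝ≥0∞) (x : Fin d → ℤ) :
    sphMax d L h x ^ s ≤ (K : ℝ≥0∞) ^ (s - 1) * sphMax d L (fun y => h y ^ s) x := by
  have hs0 : 0 < s := by linarith
  rw [← ENNReal.le_rpow_inv_iff hs0]
  refine iSup₂_le fun k hk => iSup₂_le fun m hm => ?_
  rw [ENNReal.le_rpow_inv_iff hs0]
  set w : ℝ≥0∞ := ((2 : ℝ≥0∞) ^ (k * (d - 2)))⁻¹ with hw
  have hs1 : 0 ≤ s - 1 := by linarith
  have hws : w ^ s = w ^ (s - 1) * w := by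
    have := ENNReal.rpow_add_of_nonneg (x := w) (s - 1) 1 hs1 zero_le_one
    rwa [sub_add_cancel, ENNReal.rpow_one] at this
  calc (w * ∑ v ∈ boxSphere d k m, h (x - v)) ^ s
      ≤ w ^ s * ((boxSphere d k m).card ^ (s - 1) * ∑ v ∈ boxSphere d k m, h (x - v) ^ s) := by
        rw [ENNReal.mul_rpow_of_nonneg _ _ hs0.le]
        exact mul_le_mul le_rfl (ENNReal.rpow_sum_le_const_mul_sum_rpow _ _ hs) bot_le bot_le
    _ = (w * (boxSphere d k m).card) ^ (s - 1) * (w * ∑ v ∈ boxSphere d k m, h (x - v) ^ s) := by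
        rw [hws, ENNReal.mul_rpow_of_nonneg _ _ hs1]; ring
    _ ≤ _ := mul_le_mul (ENNReal.rpow_le_rpow (hK k m (Finset.mem_range.1 hm)) hs1)
        (sum_boxSphere_le_sphMax (Finset.mem_range.1 hk) (Finset.mem_range.1 hm)
          (fun y => h y ^ s) x) bot_le bot_le

theorem lpNormE_rpow_left {d : ℕ} {p s : ℝ} (hs : 0 < s)
    (F : (Fin d → ℤ) → ℝ≥0∞) : lpNormE d p (fun x => F x ^ s) = lpNormE d (s * p) F ^ s := by
  unfold lpNormE
  rw [← ENNReal.rpow_mul]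
  simp_rw [← ENNReal.rpow_mul]
  congr 1
  field_simp

theorem exists_lpNormE_sphMax_le {d : ℕ} (hd : 5 ≤ d) {q : ℝ} (hq : (d : ℝ) / (d - 2) < q) :
    ∃ C : ℝ≥0, ∀ (L : ℕ) (h : (Fin d → ℤ) → ℝ≥0∞), (∀ y, h y ≠ ⊤) →
      lpNormE d q (sphMax d L h) ≤ C * lpNormE d q h := by
  have hd5 : (5 : ℝ) ≤ d := by exact_mod_cast hd
  obtain ⟨p, hp, hp2⟩ := exists_between (show (d : ℝ) / (d - 2) < min 2 q by
    refine lt_min ?_ hq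
    rw [div_lt_iff₀ (by linarith)]; linarith)
  have hp0 : 0 < p := lt_trans (by apply div_pos <;> linarith) hp
  obtain ⟨C, H⟩ := exists_lpNormE_sphMax_le_of_lt_two hd hp (hp2.trans_le (min_le_left _ _))
  obtain ⟨K, hK⟩ := exists_card_boxSphere_le hd
  set s := q / p with hs
  have hs1 : 1 ≤ s := by rw [hs, one_le_div hp0]; exact (hp2.trans_le (min_le_right _ _)).le
  have hs0 : 0 < s := by linarith
  have hsp : s * p = q := by rw [hs]; field_simp
  set D : ℝ≥0∞ := ((K : ℝ≥0∞) ^ (s - 1) * C) ^ (1 / s) with hD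
  have hDtop : D ≠ ⊤ := ENNReal.rpow_ne_top_of_nonneg (by positivity) (ENNReal.mul_ne_top
    (ENNReal.rpow_ne_top_of_nonneg (by linarith) ENNReal.coe_ne_top) ENNReal.coe_ne_top)
  refine ⟨D.toNNReal, fun L h hh => ?_⟩
  rw [ENNReal.coe_toNNReal hDtop, ← ENNReal.rpow_le_rpow_iff hs0,
    ENNReal.mul_rpow_of_nonneg _ _ hs0.le, hD, ← ENNReal.rpow_mul, one_div_mul_cancel hs0.ne',
    ENNReal.rpow_one]
  have e1 := lpNormE_rpow_left (p := p) hs0 (sphMax d L h)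
  have e2 := lpNormE_rpow_left (p := p) hs0 h
  rw [hsp] at e1 e2
  rw [← e1, ← e2]
  refine (lpNormE_mono hp0.le (sphMax_rpow_le hK hs1 L h)).trans ?_
  rw [lpNormE_const_mul hp0, mul_assoc]
  exact mul_le_mul le_rfl (H L _ fun y => ENNReal.rpow_ne_top_of_nonneg hs0.le (hh y)) bot_le bot_le

theorem lpNormE_mul_le {d : ℕ} {p q r : ℝ} (hr : 0 < r) (hp : 0 < p) (hq : 0 < q)
    (h : 1 / r = 1 / p + 1 / q) (F G : (Fin d → ℤ) → ℝ≥0∞) :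
    lpNormE d r (fun x => F x * G x) ≤ lpNormE d p F * lpNormE d q G := by
  have hrp : r < p := by
    rw [← one_div_lt_one_div hp hr, h]
    have : 0 < 1 / q := by positivity
    linarith
  have := ENNReal.lintegral_Lp_mul_le_Lq_mul_Lr hr hrp h MeasureTheory.Measure.count
    (f := F) (g := G) (Measurable.of_discrete.aemeasurable) (Measurable.of_discrete.aemeasurable)
  simpa [MeasureTheory.lintegral_count, lpNormE] using this

theorem lpNormE_anti {d : ℕ} {r s : ℝ} (hr : 0 < r) (hrs : r ≤ s) (F : (Fin d → ℤ) → ℝ≥0∞) :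
    lpNormE d s F ≤ lpNormE d r F := by
  have hs : 0 < s := hr.trans_le hrs
  set N := lpNormE d r F with hN
  have hx : ∀ x, F x ≤ N := fun x => by
    rw [← ENNReal.rpow_le_rpow_iff hr, hN, lpNormE_rpow hr]
    exact ENNReal.le_tsum x
  have hsr : 0 ≤ s - r := by linarith
  rw [← ENNReal.rpow_le_rpow_iff hs, lpNormE_rpow hs]
  have e : ∀ y : ℝ≥0∞, y ^ s = y ^ r * y ^ (s - r) := fun y => by
    rw [← ENNReal.rpow_add_of_nonneg _ _ hr.le hsr]; congr 1; ring
  calc ∑' x, F x ^ s ≤ ∑' x, F x ^ r * N ^ (s - r) := ENNReal.tsum_le_tsum fun x => by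
        rw [e]; exact mul_le_mul le_rfl (ENNReal.rpow_le_rpow (hx x) hsr) bot_le bot_le
    _ = N ^ s := by rw [ENNReal.tsum_mul_right, ← lpNormE_rpow hr, e N]

theorem mem_latticeBox_of_normSq_le {d k : ℕ} {v : Fin d → ℤ} (hv : normSq v ≤ 4 ^ (k + 1)) :
    v ∈ latticeBox d (2 ^ (k + 1)) := by
  refine mem_latticeBox.2 fun i => abs_le.1 ?_
  have h1 : v i ^ 2 ≤ normSq v :=
    Finset.single_le_sum (f := fun i => v i ^ 2) (fun i _ => sq_nonneg (v i)) (Finset.mem_univ i)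
  refine abs_le_of_sq_le_sq (h1.trans (hv.trans (le_of_eq ?_))) (by positivity)
  push_cast
  rw [← pow_mul, mul_comm, pow_mul]
  norm_num

theorem biAvg_eq_sum {d k lam : ℕ} (hlam : lam < 4 ^ (k + 1)) (f g : (Fin d → ℤ) → ℂ)
    (x : Fin d → ℤ) : biAvg d f g lam x = ((lam : ℂ) ^ (d - 1))⁻¹ *
      ∑ u ∈ latticeBox d (2 ^ (k + 1)), ∑ v ∈ (latticeBox d (2 ^ (k + 1))).filter
        (fun v => normSq u + normSq v = (lam : ℤ)), f (x - u) * g (x - v) := by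
  classical
  set B := latticeBox d (2 ^ (k + 1)) with hB
  rw [biAvg]
  congr 1
  have hl : (lam : ℤ) < 4 ^ (k + 1) := by exact_mod_cast hlam
  have hS : ∀ w : (Fin d → ℤ) × (Fin d → ℤ), normSq w.1 + normSq w.2 = (lam : ℤ) ↔
      w ∈ ((((B ×ˢ B).filter fun w => normSq w.1 + normSq w.2 = (lam : ℤ)) : Finset _) :
        Set ((Fin d → ℤ) × (Fin d → ℤ))) := fun w => by
    simp only [Finset.coe_filter, Finset.mem_product, Set.mem_ofPred_eq]
    refine ⟨fun h => ⟨?_, h⟩, fun h => h.2⟩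
    have h1 := normSq_nonneg w.1
    have h2 := normSq_nonneg w.2
    exact ⟨mem_latticeBox_of_normSq_le (by linarith), mem_latticeBox_of_normSq_le (by linarith)⟩
  refine (finsum_congr fun w => finsum_congr_Prop (propext (hS w)) fun _ => rfl).trans ?_
  rw [finsum_mem_coe_finset, Finset.sum_filter, Finset.sum_product]
  simp_rw [Finset.sum_filter]

theorem enorm_biAvg_le {d : ℕ} (hd : 2 ≤ d) {k L lam : ℕ} (hk : k < L) (h1 : 4 ^ k ≤ lam)
    (h2 : lam < 4 ^ (k + 1)) (f g : (Fin d → ℤ) → ℂ) (x : Fin d → ℤ) :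
    ‖biAvg d f g lam x‖ₑ ≤ hlMax d L (fun y => ‖f y‖ₑ) x * sphMax d L (fun y => ‖g y‖ₑ) x := by
  set F := hlMax d L (fun y => ‖f y‖ₑ) x with hF
  set G := sphMax d L (fun y => ‖g y‖ₑ) x with hG
  set A : ℝ≥0∞ := 2 ^ (k * (d - 2)) with hA
  have hA0 : A ≠ 0 := by positivity
  have hAt : A ≠ ⊤ := ENNReal.pow_ne_top (by norm_num)
  have hinner : ∀ u ∈ latticeBox d (2 ^ (k + 1)), ∑ v ∈ (latticeBox d (2 ^ (k + 1))).filter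
      (fun v => normSq u + normSq v = (lam : ℤ)), ‖g (x - v)‖ₑ ≤ A * G := fun u _ => by
    rcases le_or_gt (normSq u) (lam : ℤ) with hu | hu
    · have hm : (((lam : ℤ) - normSq u).toNat : ℤ) = lam - normSq u :=
        Int.toNat_of_nonneg (by linarith)
      have hu0 := normSq_nonneg u
      have hm2 : ((lam : ℤ) - normSq u).toNat < 4 ^ (k + 1) := by omega
      have := sum_boxSphere_le_sphMax hk hm2 (fun y => ‖g y‖ₑ) x
      rw [ENNReal.inv_mul_le_iff hA0 hAt] at this
      refine le_trans (le_of_eq (Finset.sum_congr (Finset.filter_congr fun v _ => ?_)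
        fun _ _ => rfl)) this
      rw [hm]
      constructor <;> intro h <;> linarith
    · rw [Finset.sum_eq_zero]
      · exact bot_le
      · intro v hv
        have := (Finset.mem_filter.1 hv).2
        have := normSq_nonneg v
        linarith
  have hfsum : ∑ u ∈ latticeBox d (2 ^ (k + 1)), ‖f (x - u)‖ₑ ≤ 2 ^ (k * d) * F := by
    have := sum_latticeBox_le_hlMax hk (fun y => ‖f y‖ₑ) x
    rwa [ENNReal.inv_mul_le_iff (by positivity) (ENNReal.pow_ne_top (by norm_num))] at this
  have hl0 : (lam : ℝ≥0∞) ^ (d - 1) ≠ 0 := by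
    have : 0 < lam := lt_of_lt_of_le (by positivity) h1
    positivity
  have hlt : (lam : ℝ≥0∞) ^ (d - 1) ≠ ⊤ := ENNReal.pow_ne_top (ENNReal.natCast_ne_top _)
  have hln : ‖((lam : ℂ) ^ (d - 1))⁻¹‖ₑ = ((lam : ℝ≥0∞) ^ (d - 1))⁻¹ := by
    rw [enorm_inv (by
      have : lam ≠ 0 := (lt_of_lt_of_le (by positivity) h1).ne'
      exact pow_ne_zero _ (by exact_mod_cast this)), enorm_pow, ← ofReal_norm,
      Complex.norm_natCast, ENNReal.ofReal_natCast]
  rw [biAvg_eq_sum h2, enorm_mul, hln, ENNReal.inv_mul_le_iff hl0 hlt]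
  have hpow : (2 : ℝ≥0∞) ^ (k * d) * A ≤ (lam : ℝ≥0∞) ^ (d - 1) := by
    have e : (2 : ℝ≥0∞) ^ (k * d) * A = ((4 : ℝ≥0∞) ^ k) ^ (d - 1) := by
      rw [hA, show (4 : ℝ≥0∞) = 2 ^ 2 by norm_num, ← pow_mul, ← pow_add, ← pow_mul]
      congr 1
      obtain ⟨c, rfl⟩ := Nat.exists_eq_add_of_le hd
      rw [Nat.add_sub_cancel_left, show 2 + c - 1 = c + 1 by omega]; ring
    rw [e]
    have : (4 : ℝ≥0∞) ^ k ≤ lam := by exact_mod_cast h1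
    exact pow_le_pow_left₀ bot_le this _
  calc _ ≤ ∑ u ∈ latticeBox d (2 ^ (k + 1)), ‖f (x - u)‖ₑ * (A * G) := by
        refine (enorm_sum_le _ _).trans (Finset.sum_le_sum fun u hu => ?_)
        refine (enorm_sum_le _ _).trans ?_
        simp_rw [enorm_mul]
        rw [← Finset.mul_sum]
        exact mul_le_mul le_rfl (hinner u hu) bot_le bot_le
    _ ≤ (2 ^ (k * d) * F) * (A * G) := by
        rw [← Finset.sum_mul]; exact mul_le_mul hfsum le_rfl bot_le bot_le
    _ = (2 ^ (k * d) * A) * (F * G) := by ring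
    _ ≤ _ := mul_le_mul hpow le_rfl bot_le bot_le

theorem biMax_le_iSup {d : ℕ} (hd : 2 ≤ d) (f g : (Fin d → ℤ) → ℂ) (x : Fin d → ℤ) :
    biMax d f g x ≤
      ⨆ L, hlMax d L (fun y => ‖f y‖ₑ) x * sphMax d L (fun y => ‖g y‖ₑ) x := by
  refine iSup₂_le fun lam hlam => ?_
  have h1 := Nat.pow_log_le_self 4 (x := lam) (by omega)
  have h2 := Nat.lt_pow_succ_log_self (b := 4) (by norm_num) lam
  exact (enorm_biAvg_le hd (Nat.lt_succ_self _) h1 h2 f g x).trans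
    (le_iSup (fun L => hlMax d L (fun y => ‖f y‖ₑ) x * sphMax d L (fun y => ‖g y‖ₑ) x) _)

/-- For `d ≥ 5`, the discrete bilinear spherical maximal operator is bounded
`ℓ^p(ℤ^d) × ℓ^q(ℤ^d) → ℓ^r(ℤ^d)` whenever `1 < p`, `d/(d-2) < q` and `1/r ≤ 1/p + 1/q`
(so in particular `r > d/(2d-2)`). -/
theorem discrete_bilinear_spherical_maximal_bounded
    (d : ℕ) (hd : 5 ≤ d) (p q r : ℝ)
    (hp : 1 < p) (hq : (d : ℝ) / ((d : ℝ) - 2) < q) (hr : 0 < r)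
    (hpqr : 1 / r ≤ 1 / p + 1 / q) :
    ∃ C : ℝ≥0, 0 < C ∧ ∀ f g : (Fin d → ℤ) → ℂ,
      lpNormE d r (biMax d f g) ≤ (C : ℝ≥0∞) * lpNorm d p f * lpNorm d q g := by
  have hd5 : (5 : ℝ) ≤ d := by exact_mod_cast hd
  have hp0 : 0 < p := by linarith
  have hq0 : 0 < q := lt_trans (by apply div_pos <;> linarith) hq
  obtain ⟨C₁, H₁⟩ := hlMax_lp d hp
  obtain ⟨C₂, H₂⟩ := exists_lpNormE_sphMax_le hd hq
  refine ⟨C₁ * C₂ + 1, by positivity, fun f g => ?_⟩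
  set ρ : ℝ := (1 / p + 1 / q)⁻¹ with hρ
  have hρ0 : 0 < ρ := by positivity
  have hρe : 1 / ρ = 1 / p + 1 / q := by rw [hρ, one_div, inv_inv]
  have hρr : ρ ≤ r := by rwa [← one_div_le_one_div hr hρ0, hρe]
  have hf : lpNorm d p f = lpNormE d p fun y => ‖f y‖ₑ := rfl
  have hg : lpNorm d q g = lpNormE d q fun y => ‖g y‖ₑ := rfl
  rw [hf, hg]
  refine (lpNormE_anti hρ0 hρr _).trans ((lpNormE_mono hρ0.le
    (biMax_le_iSup (by omega) f g)).trans ?_)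
  refine lpNormE_iSup_le hρ0 (F := fun L x =>
    hlMax d L (fun y => ‖f y‖ₑ) x * sphMax d L (fun y => ‖g y‖ₑ) x) (fun L L' hL x =>
      mul_le_mul (hlMax_mono_left d _ x hL) (sphMax_mono_left d _ x hL) bot_le bot_le) fun L => ?_
  refine (lpNormE_mul_le hρ0 hp0 hq0 hρe _ _).trans ?_
  calc _ ≤ (C₁ * lpNormE d p fun y => ‖f y‖ₑ) * (C₂ * lpNormE d q fun y => ‖g y‖ₑ) :=
        mul_le_mul (H₁ L _) (H₂ L _ fun y => enorm_ne_top) bot_le bot_le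
    _ = (C₁ * C₂ : ℝ≥0∞) * (lpNormE d p fun y => ‖f y‖ₑ) * (lpNormE d q fun y => ‖g y‖ₑ) := by
        ring
    _ ≤ _ := by
        refine mul_le_mul (mul_le_mul ?_ le_rfl bot_le bot_le) le_rfl bot_le bot_le
        push_cast
        exact le_self_add
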